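/- arXiv:1902.03802 — 6 statements merged into one kernel-verified Lean document; each statement's English description precedes it below -/
import Mathlib

section
/- Let X be an oriented graph with edge set E and let w be a transition weight on X. Then there exists a unique continuous linear operator T on ℓ²(E) such that T e = ∑_{f ∈ E} w(e,f) f for every e ∈ E (with the sum converging in ℓ²(E)); moreover ∑_{e ∈ E} ‖T e‖ < ∞, so T is a trace class operator. -/
theorem aux_hasSum_apply {H ι : Type*} [NormedAddCommGroup H] [NormedSpace ℂ H]
    (A : ι → (H →L[ℂ] H)) (hA : Summable A) (x : H) :
    HasSum (fun q => A q x) ((∑' q, A q) x) :=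
  (ContinuousLinearMap.apply ℂ H x).hasSum hA.hasSum

set_option maxHeartbeats 1000000 in
/-- For an oriented graph with edge set `E` (source and target maps
`s, t`) and a transition weight `w`, there is a unique continuous linear operator `T`
on `ℓ²(E)` with `T e = ∑_f w(e,f) f` for every basis vector `e`, and any such `T`
satisfies `∑_e ‖T e‖ < ∞`, i.e. it is trace class. -/
theorem stmt6 {V E : Type*} [DecidableEq E] (s t : E → V) (w : E → E → ℝ)
    (hw_nonneg : ∀ e f, 0 ≤ w e f)
    (hw_adj : ∀ e f, w e f ≠ 0 → t e = s f)
    (hw_sum : Summable fun q : E × E => w q.1 q.2) :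
    (∃! T : lp (fun _ : E => ℂ) 2 →L[ℂ] lp (fun _ : E => ℂ) 2,
      ∀ e : E, HasSum (fun f : E => (w e f : ℂ) • lp.single 2 f (1 : ℂ))
        (T (lp.single 2 e 1))) ∧
    ∀ T : lp (fun _ : E => ℂ) 2 →L[ℂ] lp (fun _ : E => ℂ) 2,
      (∀ e : E, HasSum (fun f : E => (w e f : ℂ) • lp.single 2 f (1 : ℂ))
        (T (lp.single 2 e 1))) →
      Summable fun e : E => ‖T (lp.single 2 e 1)‖ := by
  have hn1 : ∀ e : E, ‖(lp.single 2 e (1 : ℂ) : lp (fun _ : E => ℂ) 2)‖ = 1 := by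
    intro e
    rw [lp.norm_single (by norm_num)]
    simp
  have hnw : ∀ e f : E, ‖(w e f : ℂ) • (lp.single 2 f (1 : ℂ) : lp (fun _ : E => ℂ) 2)‖ = w e f := by
    intro e f
    rw [norm_smul, hn1, mul_one, Complex.norm_real, Real.norm_of_nonneg (hw_nonneg e f)]
  refine ⟨?_, ?_⟩
  · let A : E × E → (lp (fun _ : E => ℂ) 2 →L[ℂ] lp (fun _ : E => ℂ) 2) := fun q =>
      (innerSL ℂ (lp.single 2 q.1 (1 : ℂ) : lp (fun _ : E => ℂ) 2)).smulRight
        ((w q.1 q.2 : ℂ) • (lp.single 2 q.2 (1 : ℂ) : lp (fun _ : E => ℂ) 2))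
    have hA : Summable A := by
      refine Summable.of_norm_bounded hw_sum ?_
      intro q
      simp only [A]
      rw [ContinuousLinearMap.norm_smulRight_apply, innerSL_apply_norm, hn1, hnw, one_mul]
    have hex : ∀ e : E, HasSum (fun f : E => (w e f : ℂ) • (lp.single 2 f (1 : ℂ) : lp (fun _ : E => ℂ) 2))
        ((∑' q, A q) (lp.single 2 e 1)) := by
      intro e
      have h1 : HasSum (fun q => A q (lp.single 2 e (1 : ℂ))) ((∑' q, A q) (lp.single 2 e (1 : ℂ))) :=
        aux_hasSum_apply A hA _
      have hinj : Function.Injective (fun f : E => (e, f)) := fun a b h => (Prod.mk.inj h).2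
      have hAe : ∀ q, A q (lp.single 2 e (1 : ℂ)) =
          (if q.1 = e then (1 : ℂ) else 0) •
            ((w q.1 q.2 : ℂ) • (lp.single 2 q.2 (1 : ℂ) : lp (fun _ : E => ℂ) 2)) := by
        intro q
        simp only [A, ContinuousLinearMap.smulRight_apply, innerSL_apply_apply]
        congr 1
        rw [lp.inner_single_left]
        by_cases h : q.1 = e
        · subst h
          simp
        · simp [h]
      have h2 := (hinj.hasSum_iff (f := fun q => A q (lp.single 2 e (1 : ℂ))) (by
        rintro ⟨a, b⟩ hq
        rw [hAe]
        have : a ≠ e := by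
          rintro rfl
          exact hq ⟨b, rfl⟩
        simp [this])).2 h1
      convert h2 using 1
      funext f
      simp only [Function.comp, hAe]
      simp
    refine ⟨∑' q, A q, hex, ?_⟩
    · intro T hT
      ext1 x
      have hx := lp.hasSum_single (p := 2) (by norm_num) x
      have key : ∀ (i : E), T (lp.single 2 i (x i)) = (∑' q, A q) (lp.single 2 i (x i)) := by
        intro i
        have : (lp.single 2 i (x i) : lp (fun _ : E => ℂ) 2) = x i • lp.single 2 i (1 : ℂ) := by
          rw [← lp.single_smul]
          simp
        rw [this, map_smul, map_smul, (hT i).unique (hex i)]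
      have h1 := T.hasSum hx
      have h2 := (∑' q, A q).hasSum hx
      simp only [key] at h1
      exact h1.unique h2
  · intro T hT
    refine Summable.of_nonneg_of_le (fun _ => norm_nonneg _) (fun e => ?_) hw_sum.prod
    have hs : Summable (fun f => w e f) := hw_sum.prod_factor e
    rw [← (hT e).tsum_eq]
    refine (norm_tsum_le_tsum_norm (by simpa only [hnw] using hs)).trans (le_of_eq ?_)
    simp only [hnw]
end

section
/- Let X be an oriented graph with edge set E, w a transition weight on X, and T the Bass operator on ℓ²(E); assume the spectral radius r = r(T) is positive. For m ≥ 1 let N_m = ∑_p w(p), the sum over all closed paths p of length m. Then there exist an integer s ≥ 1, positive integers n₁, …, n_s, ε ∈ (0, r) and C > 0 such that for all m ≥ 1, | N_m − r^m ∑_{k=1}^s n_k·1_{n_k ∣ m} | ≤ C (r − ε)^m, where 1_{n_k ∣ m} is 1 if n_k divides m and 0 otherwise. -/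
namespace PGT

variable {V E : Type*}

/-- Cyclic shift by `d` on `Fin n`. -/
def cyc {n : ℕ} (i : Fin n) (d : ℕ) : Fin n :=
  ⟨(i.1 + d) % n, Nat.mod_lt _ i.pos⟩

/-- A tuple `p = (e₁, …, eₙ)` of edges is a closed path if the target of each
edge is the source of the (cyclically) next one. -/
def IsClosedPath (s t : E → V) {n : ℕ} (p : Fin n → E) : Prop :=
  ∀ i : Fin n, t (p i) = s (p (cyc i 1))

/-- The weight `w(p) = w(e₁,e₂)⋯w(e_{n-1},eₙ)w(eₙ,e₁)` of a closed path. -/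
def pathWeight (w : E → E → ℝ) {n : ℕ} (p : Fin n → E) : ℝ :=
  ∏ i : Fin n, w (p i) (p (cyc i 1))

/-- `T` is the Bass operator of the weighted graph: `T e = ∑_f w(e,f) f` on `ℓ²(E)`. -/
def IsBassOperator [DecidableEq E] (w : E → E → ℝ)
    (T : lp (fun _ : E => ℂ) 2 →L[ℂ] lp (fun _ : E => ℂ) 2) : Prop :=
  ∀ e : E, HasSum (fun f : E => (w e f : ℂ) • lp.single 2 f (1 : ℂ))
    (T (lp.single 2 e 1))

end PGT

namespace BassAux
open PowerSeries Filter Topology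

/-- Germ of a function at zero with given Taylor series. -/
def Germ (f : PowerSeries ℂ) (h : ℂ → ℂ) : Prop :=
  ∀ᶠ z in 𝓝 (0:ℂ), HasSum (fun n => coeff n f * z ^ n) (h z)

noncomputable def fms (f : PowerSeries ℂ) : FormalMultilinearSeries ℂ ℂ ℂ :=
  FormalMultilinearSeries.ofScalars ℂ (fun n => coeff n f)

lemma fms_apply (f : PowerSeries ℂ) (n : ℕ) (z : ℂ) :
    (fms f n fun _ => z) = coeff n f * z ^ n := by
  simp [fms, mul_comm]

lemma fms_radius {f : PowerSeries ℂ} {y : ℝ} (hy : 0 < y)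
    (hs : Summable fun n => ‖coeff n f‖ * y ^ n) : ENNReal.ofReal y ≤ (fms f).radius := by
  have := (fms f).le_radius_of_summable_norm (r := y.toNNReal) (by
    simpa [fms, FormalMultilinearSeries.ofScalars_norm, hy.le] using hs)
  simpa [ENNReal.ofReal] using this

lemma germ_iff {f : PowerSeries ℂ} {h : ℂ → ℂ} : Germ f h ↔ HasFPowerSeriesAt h (fms f) 0 := by
  rw [hasFPowerSeriesAt_iff]
  simp only [Germ, zero_add]
  refine eventually_congr (Eventually.of_forall fun z => ?_)
  have : (fms f).coeff = fun n => coeff n f := by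
    funext n; simp [fms, FormalMultilinearSeries.coeff_ofScalars]
  simp [this, mul_comm]

lemma Germ.analyticAt {f h} (H : Germ f h) : AnalyticAt ℂ h 0 :=
  ⟨_, germ_iff.1 H⟩

lemma Germ.val {f h} (H : Germ f h) : h 0 = coeff 0 f := by
  have := H.self_of_nhds
  have h2 := hasSum_single (f := fun n => coeff n f * (0:ℂ) ^ n) 0 (by
    intro n hn; simp [hn])
  simpa using this.unique h2

lemma Germ.congr {f h h'} (H : Germ f h) (e : h =ᶠ[𝓝 0] h') : Germ f h' := by
  filter_upwards [H, e] with z h1 h2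
  rwa [← h2]

lemma Germ.unique {f g h} (H : Germ f h) (H' : Germ g h) : f = g := by
  have := (germ_iff.1 H).eq_formalMultilinearSeries (germ_iff.1 H')
  have h2 := FormalMultilinearSeries.ofScalars_series_injective ℂ ℂ this
  ext n
  exact congrFun h2 n

lemma germ_exists {h : ℂ → ℂ} (H : AnalyticAt ℂ h 0) : ∃ f, Germ f h := by
  obtain ⟨p, hp⟩ := H
  refine ⟨PowerSeries.mk p.coeff, ?_⟩
  rw [hasFPowerSeriesAt_iff] at hp
  filter_upwards [hp] with z hz
  simpa [mul_comm] using hz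

lemma Germ.add {f g h k} (H : Germ f h) (H' : Germ g k) : Germ (f + g) (h + k) := by
  filter_upwards [H, H'] with z h1 h2
  simpa [add_mul] using h1.add h2

lemma Germ.sub {f g h k} (H : Germ f h) (H' : Germ g k) : Germ (f - g) (h - k) := by
  filter_upwards [H, H'] with z h1 h2
  simpa [sub_mul] using h1.sub h2

lemma hasSum_mul {f g : PowerSeries ℂ} {z a b : ℂ} (h1 : HasSum (fun n => coeff n f * z ^ n) a)
    (h2 : HasSum (fun n => coeff n g * z ^ n) b) :
    HasSum (fun n => coeff n (f * g) * z ^ n) (a * b) := by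
  have n1 := h1.summable.norm
  have n2 := h2.summable.norm
  have e : ∀ n, coeff n (f * g) * z ^ n = ∑ kl ∈ Finset.HasAntidiagonal.antidiagonal n,
      (coeff kl.1 f * z ^ kl.1) * (coeff kl.2 g * z ^ kl.2) := by
    intro n
    rw [coeff_mul, Finset.sum_mul]
    refine Finset.sum_congr rfl fun x hx => ?_
    rw [← Finset.HasAntidiagonal.mem_antidiagonal.1 hx, pow_add]; ring
  simp only [e]
  rw [← h1.tsum_eq, ← h2.tsum_eq, tsum_mul_tsum_eq_tsum_sum_antidiagonal_of_summable_norm n1 n2]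
  exact (summable_norm_sum_mul_antidiagonal_of_summable_norm n1 n2).of_norm.hasSum

lemma Germ.mul {f g h k} (H : Germ f h) (H' : Germ g k) : Germ (f * g) (h * k) := by
  filter_upwards [H, H'] with z h1 h2
  exact hasSum_mul h1 h2

lemma germ_one : Germ 1 1 := by
  refine Eventually.of_forall fun z => ?_
  have h2 := hasSum_single (f := fun n => coeff n (1 : PowerSeries ℂ) * z ^ n) 0 (by
    intro n hn; simp [coeff_one, hn])
  simpa using h2

lemma Germ.inv {f h} (H : Germ f h) (h0 : coeff 0 f ≠ 0) : Germ f⁻¹ h⁻¹ := by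
  have ha := H.analyticAt
  have hne : h 0 ≠ 0 := by rwa [H.val]
  obtain ⟨g, hg⟩ := germ_exists (ha.inv hne)
  have h1 : Germ (g * f) 1 := (hg.mul H).congr (by
    filter_upwards [ha.continuousAt.eventually_ne hne] with z hz
    simp [hz])
  have h2 := h1.unique germ_one
  have : f⁻¹ = g := by
    rw [PowerSeries.inv_eq_iff_mul_eq_one (by simpa using h0)]
    exact h2
  rwa [this]

lemma Germ.summable {f h} {x y : ℝ} (H : Germ f h) (hd : DifferentiableOn ℂ h (Metric.ball 0 y))
    (hx : 0 ≤ x) (hxy : x < y) : Summable fun n => ‖coeff n f‖ * x ^ n := by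
  obtain ⟨x', h1, h2⟩ := exists_between hxy
  have hb : DifferentiableOn ℂ h (Metric.closedBall 0 (x'.toNNReal)) := hd.mono (by
    rw [Real.coe_toNNReal _ (hx.trans h1.le)]
    exact Metric.closedBall_subset_ball h2)
  have hp := hb.hasFPowerSeriesOnBall (by simpa using hx.trans_lt h1)
  have e := hp.hasFPowerSeriesAt.eq_formalMultilinearSeries (germ_iff.1 H)
  have hr := hp.r_le
  rw [e] at hr
  have : ((x.toNNReal : NNReal) : ENNReal) < (fms f).radius := lt_of_lt_of_le (by
    rw [ENNReal.coe_lt_coe]; exact Real.toNNReal_lt_toNNReal_iff (hx.trans_lt h1) |>.2 h1) hr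
  have := (fms f).summable_norm_mul_pow this
  simpa [fms, FormalMultilinearSeries.ofScalars_norm, hx] using this

lemma exists_fun {f : PowerSeries ℂ} {y : ℝ} (hy : 0 < y)
    (hs : Summable fun n => ‖coeff n f‖ * y ^ n) :
    ∃ h : ℂ → ℂ, DifferentiableOn ℂ h (Metric.ball 0 y) ∧ Germ f h ∧
      ∀ z ∈ Metric.ball (0:ℂ) y, HasSum (fun n => coeff n f * z ^ n) (h z) := by
  have hr := fms_radius hy hs
  have hp := ((fms f).hasFPowerSeriesOnBall (lt_of_lt_of_le (by simpa using hy) hr)).mono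
    (by simpa using hy) hr
  have he : Metric.eball (0:ℂ) (ENNReal.ofReal y) = Metric.ball 0 y := Metric.eball_ofReal
  refine ⟨(fms f).sum, ?_, germ_iff.2 hp.hasFPowerSeriesAt, fun z hz => ?_⟩
  · rw [← he]; exact hp.differentiableOn
  · have := hp.hasSum (he ▸ hz)
    simp only [fms_apply, zero_add] at this
    exact this

lemma exists_ball {O : Set ℂ} (hO : IsOpen O) (h : Metric.closedBall (0:ℂ) 1 ⊆ O) :
    ∃ y : ℝ, 1 < y ∧ Metric.ball (0:ℂ) y ⊆ O := by
  obtain ⟨δ, hδ, hs⟩ := (isCompact_closedBall (0:ℂ) 1).exists_thickening_subset_open hO h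
  refine ⟨1 + δ, by linarith, ?_⟩
  rw [thickening_closedBall hδ zero_le_one] at hs
  rwa [add_comm] 

def Good (f : PowerSeries ℝ) : Prop := ∃ y : ℝ, 1 < y ∧ Summable fun n => ‖coeff n f‖ * y ^ n

noncomputable def toC (f : PowerSeries ℝ) : PowerSeries ℂ := PowerSeries.map Complex.ofRealHom f

lemma coeff_toC (f : PowerSeries ℝ) (n : ℕ) : coeff n (toC f) = ((coeff n f : ℝ) : ℂ) := by
  simp [toC]

lemma toC_inv (f : PowerSeries ℝ) (h0 : coeff 0 f ≠ 0) : toC f⁻¹ = (toC f)⁻¹ := by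
  symm
  have h1 : constantCoeff (toC f) ≠ 0 := by
    rw [← coeff_zero_eq_constantCoeff_apply, coeff_toC]
    exact_mod_cast h0
  rw [PowerSeries.inv_eq_iff_mul_eq_one h1, toC, toC, ← map_mul,
    PowerSeries.inv_mul_cancel _ (by simpa using h0), map_one]

/-- evaluation -/
lemma good_inv {H : PowerSeries ℝ} (hg : Good H)
    (hne : ∀ z : ℂ, ‖z‖ ≤ 1 → ∀ a, HasSum (fun n => ((coeff n H : ℝ) : ℂ) * z ^ n) a → a ≠ 0) :
    Good H⁻¹ := by
  obtain ⟨y, hy, hs⟩ := hg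
  obtain ⟨h, hd, hG, hsum⟩ := exists_fun (f := toC H) (y := y) (by linarith)
    (by simpa [coeff_toC] using hs)
  simp only [coeff_toC] at hsum
  have hO : IsOpen (Metric.ball (0:ℂ) y ∩ h ⁻¹' {0}ᶜ) :=
    hd.continuousOn.isOpen_inter_preimage Metric.isOpen_ball isOpen_compl_singleton
  obtain ⟨y', hy', hb⟩ := exists_ball hO (fun z hz => by
    have hz' : z ∈ Metric.ball (0:ℂ) y := Metric.closedBall_subset_ball hy hz
    exact ⟨hz', hne z (by simpa using hz) _ (hsum z hz')⟩)
  have h0 : coeff 0 (toC H) ≠ 0 := by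
    rw [← hG.val]
    exact (hb (Metric.mem_ball_self (by linarith))).2
  have h0' : coeff 0 H ≠ 0 := by
    rw [coeff_toC] at h0; exact_mod_cast h0
  have hd' : DifferentiableOn ℂ h⁻¹ (Metric.ball 0 y') :=
    (hd.mono fun z hz => (hb hz).1).inv fun z hz => (hb hz).2
  obtain ⟨x, hx1, hx2⟩ := exists_between hy'
  refine ⟨x, hx1, ?_⟩
  have := (hG.inv h0).summable hd' (by linarith) hx2
  rw [← toC_inv _ h0'] at this
  simpa [coeff_toC] using this

lemma good_mono {f g : PowerSeries ℝ} (hg : Good g) (h : ∀ n, ‖coeff n f‖ ≤ ‖coeff n g‖) :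
    Good f := by
  obtain ⟨y, hy, hs⟩ := hg
  exact ⟨y, hy, hs.of_nonneg_of_le (fun n => by positivity) fun n => by gcongr; exact h n⟩

lemma good_iff (f : PowerSeries ℝ) : Good f ↔ ∃ y : ℝ, 1 < y ∧ ∃ C, ∀ n, ‖coeff n f‖ * y ^ n ≤ C := by
  constructor
  · rintro ⟨y, hy, hs⟩
    exact ⟨y, hy, _, fun n => hs.le_tsum n fun i _ => by positivity⟩
  · rintro ⟨y, hy, C, hC⟩
    obtain ⟨x, hx1, hx2⟩ := exists_between hy
    refine ⟨x, hx1, ?_⟩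
    have hq : Summable fun n => C * (x / y) ^ n :=
      (summable_geometric_of_lt_one (by positivity) (by rw [div_lt_one] <;> linarith)).mul_left C
    refine hq.of_nonneg_of_le (fun n => by positivity) fun n => ?_
    have hyn : 0 < y ^ n := by positivity
    have hxn : 0 ≤ x ^ n := by positivity
    rw [div_pow, mul_div_assoc', le_div_iff₀ hyn]
    nlinarith [hC n]

lemma good_common {f g : PowerSeries ℝ} (hf : Good f) (hg : Good g) :
    ∃ y : ℝ, 1 < y ∧ (Summable fun n => ‖coeff n f‖ * y ^ n) ∧
      Summable fun n => ‖coeff n g‖ * y ^ n := by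
  obtain ⟨y, hy, hs⟩ := hf
  obtain ⟨x, hx, hs'⟩ := hg
  refine ⟨min x y, lt_min hx hy, ?_, ?_⟩
  · exact hs.of_nonneg_of_le (fun n => by positivity) fun n => by gcongr; exact min_le_right _ _
  · exact hs'.of_nonneg_of_le (fun n => by positivity) fun n => by gcongr; exact min_le_left _ _

lemma good_add {f g : PowerSeries ℝ} (hf : Good f) (hg : Good g) : Good (f + g) := by
  obtain ⟨y, hy, h1, h2⟩ := good_common hf hg
  refine ⟨y, hy, (h1.add h2).of_nonneg_of_le (fun n => by positivity) fun n => ?_⟩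
  rw [map_add, ← add_mul]
  gcongr
  exact norm_add_le _ _

lemma good_neg {f : PowerSeries ℝ} (hf : Good f) : Good (-f) :=
  good_mono hf fun n => by simp

lemma good_mul {f g : PowerSeries ℝ} (hf : Good f) (hg : Good g) : Good (f * g) := by
  obtain ⟨y, hy, h1, h2⟩ := good_common hf hg
  have hy0 : 0 ≤ y := by linarith
  refine ⟨y, hy, ?_⟩
  have n1 : Summable fun n => ‖coeff n f * y ^ n‖ := by simpa [abs_of_nonneg hy0] using h1
  have n2 : Summable fun n => ‖coeff n g * y ^ n‖ := by simpa [abs_of_nonneg hy0] using h2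
  have := summable_norm_sum_mul_antidiagonal_of_summable_norm n1 n2
  refine this.congr fun n => ?_
  have : ∑ kl ∈ Finset.HasAntidiagonal.antidiagonal n,
      (coeff kl.1 f * y ^ kl.1) * (coeff kl.2 g * y ^ kl.2) = coeff n (f * g) * y ^ n := by
    rw [coeff_mul, Finset.sum_mul]
    refine Finset.sum_congr rfl fun x hx => ?_
    rw [← Finset.HasAntidiagonal.mem_antidiagonal.1 hx, pow_add]; ring
  rw [this, norm_mul, norm_pow, Real.norm_of_nonneg hy0]

lemma good_X_deriv {f : PowerSeries ℝ} (hf : Good f) :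
    Good (X * PowerSeries.derivative ℝ f) := by
  obtain ⟨y, hy, C, hC⟩ := (good_iff f).1 hf
  rw [good_iff]
  obtain ⟨x, hx1, hx2⟩ := exists_between hy
  have hx0 : 0 < x := by linarith
  have hy0 : 0 < y := by linarith
  have hlt : ‖x / y‖ < 1 := by
    rw [Real.norm_of_nonneg (by positivity), div_lt_one hy0]; exact hx2
  have hq := (tendsto_self_mul_const_pow_of_abs_lt_one (r := x / y) (by rwa [← Real.norm_eq_abs])).bddAbove_range
  obtain ⟨B, hB⟩ := hq
  refine ⟨x, hx1, C * B, fun n => ?_⟩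
  have hBn : (n:ℝ) * (x / y) ^ n ≤ B := hB ⟨n, rfl⟩
  have hc : coeff n (X * PowerSeries.derivative ℝ f) = n * coeff n f := by
    cases n with
    | zero => simp
    | succ n => rw [coeff_succ_X_mul, coeff_derivative]; push_cast; ring
  rw [hc, norm_mul, Real.norm_of_nonneg (by positivity : (0:ℝ) ≤ n)]
  have e : (n:ℝ) * ‖coeff n f‖ * x ^ n = (‖coeff n f‖ * y ^ n) * (n * (x/y)^n) := by
    rw [div_pow]; field_simp
  rw [e]
  have hC0 : 0 ≤ C := le_trans (by positivity) (hC 0)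
  exact mul_le_mul (hC n) hBn (by positivity) hC0

end BassAux

namespace BassAux
open PowerSeries Filter Topology

lemma mero_bound {f : PowerSeries ℝ} (h0 : ∀ n, 0 ≤ coeff n f)
    (hx : ∀ x : ℝ, 0 ≤ x → x < 1 → (Summable fun n => coeff n f * x ^ n) ∧
      ∑' n, coeff n f * x ^ n ≤ 1) {h : ℂ → ℂ} (hm : MeromorphicOn h (Metric.ball 0 2))
    (hG : Germ (toC f) h) (z : ℂ) (hz : ‖z‖ < 1) : ∀ᶠ z' in 𝓝[≠] z, ‖h z'‖ ≤ 1 := by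
  obtain ⟨y, hy1, hy2⟩ := exists_between hz
  have hy0 : 0 < y := lt_of_le_of_lt (norm_nonneg z) hy1
  have hs : Summable fun n => ‖coeff n (toC f)‖ * y ^ n := by
    simpa [coeff_toC, abs_of_nonneg (h0 _)] using (hx y hy0.le hy2).1
  obtain ⟨k, hkd, hkG, hk⟩ := exists_fun hy0 hs
  have hka : AnalyticOnNhd ℂ k (Metric.ball 0 y) := hkd.analyticOnNhd Metric.isOpen_ball
  have hmd : MeromorphicOn (h - k) (Metric.ball 0 y) :=
    (hm.mono_set (Metric.ball_subset_ball (by linarith))).sub hka.meromorphicOn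
  have hpre : IsPreconnected (Metric.ball (0:ℂ) y) := (convex_ball _ _).isPreconnected
  have htop : meromorphicOrderAt (h - k) z = ⊤ := by
    by_contra hne
    have h2 := hmd.meromorphicOrderAt_ne_top_of_isPreconnected hpre (x := z) (y := 0)
      (by simpa using hy1) (Metric.mem_ball_self hy0) hne
    apply h2
    rw [meromorphicOrderAt_eq_top_iff]
    refine Filter.Eventually.filter_mono nhdsWithin_le_nhds ?_
    filter_upwards [hG, hkG] with w h3 h4
    simp [h3.unique h4]
  rw [meromorphicOrderAt_eq_top_iff] at htop
  have hb : ∀ᶠ w in 𝓝[≠] z, w ∈ Metric.ball (0:ℂ) y :=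
    Filter.Eventually.filter_mono nhdsWithin_le_nhds
      (Metric.isOpen_ball.mem_nhds (by simpa using hy1))
  filter_upwards [htop, hb] with w h3 h4
  have e : h w = k w := by simpa [sub_eq_zero] using h3
  rw [e, ← (hk w h4).tsum_eq]
  have hw : ‖w‖ < y := by simpa using h4
  have hxx := hx ‖w‖ (norm_nonneg _) (hw.trans hy2)
  have hn : Summable fun n => ‖coeff n (toC f) * w ^ n‖ := by
    simpa [coeff_toC, abs_of_nonneg (h0 _)] using hxx.1
  refine (norm_tsum_le_tsum_norm hn).trans ?_
  simpa [coeff_toC, abs_of_nonneg (h0 _)] using hxx.2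

lemma good_of_mero {f : PowerSeries ℝ} (h0 : ∀ n, 0 ≤ coeff n f)
    (hx : ∀ x : ℝ, 0 ≤ x → x < 1 → (Summable fun n => coeff n f * x ^ n) ∧
      ∑' n, coeff n f * x ^ n ≤ 1) {h : ℂ → ℂ} (hm : MeromorphicOn h (Metric.ball 0 2))
    (hG : Germ (toC f) h) : Good f := by
  have hord : ∀ z : ℂ, ‖z‖ ≤ 1 → 0 ≤ meromorphicOrderAt h z := by
    intro z hz
    by_contra! hneg
    have hc := tendsto_cobounded_of_meromorphicOrderAt_neg hneg
    have hlarge : ∀ᶠ w in 𝓝[≠] z, 1 < ‖h w‖ := by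
      have := (tendsto_norm_cobounded_atTop.comp hc).eventually (eventually_gt_atTop 1)
      exact this
    rcases hz.lt_or_eq with hlt | heq
    · obtain ⟨w, h1, h2⟩ := (hlarge.and (mero_bound h0 hx hm hG z hlt)).exists
      linarith
    · have hcl : z ∈ closure (Metric.ball (0:ℂ) 1) := by
        rw [closure_ball _ one_ne_zero]; simpa using hz
      have hnb : (𝓝[Metric.ball (0:ℂ) 1] z).NeBot := mem_closure_iff_nhdsWithin_neBot.1 hcl
      have hle : 𝓝[Metric.ball (0:ℂ) 1] z ≤ 𝓝[≠] z := nhdsWithin_mono _ (by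
        intro w hw hwz
        rw [Set.mem_singleton_iff] at hwz
        subst hwz
        simp [heq] at hw)
      have h1 := (eventually_eventually_nhdsWithin.2 hlarge).filter_mono hle
      have h2 : ∀ᶠ w in 𝓝[Metric.ball (0:ℂ) 1] z, w ∈ Metric.ball (0:ℂ) 1 :=
        self_mem_nhdsWithin
      have h3 : ∀ᶠ w in 𝓝[Metric.ball (0:ℂ) 1] z, w ∈ ({z}ᶜ : Set ℂ) :=
        hle self_mem_nhdsWithin
      obtain ⟨w, ⟨h1, h2⟩, h3⟩ := ((h1.and h2).and h3).exists
      rw [isOpen_compl_singleton.nhdsWithin_eq h3] at h1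
      have h4 := h1.filter_mono (nhdsWithin_le_nhds (s := {w}ᶜ))
      obtain ⟨v, h5, h6⟩ := (h4.and (mero_bound h0 hx hm hG w (by simpa using h2))).exists
      linarith
  set h' := toMeromorphicNFOn h (Metric.ball 0 2) with hh'
  have han : ∀ z : ℂ, ‖z‖ ≤ 1 → AnalyticAt ℂ h' z := by
    intro z hz
    have hzb : z ∈ Metric.ball (0:ℂ) 2 := by
      rw [mem_ball_zero_iff]; linarith
    have hnf : MeromorphicNFAt h' z := meromorphicNFOn_toMeromorphicNFOn h _ hzb
    rw [← hnf.meromorphicOrderAt_nonneg_iff_analyticAt, hh',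
      meromorphicOrderAt_toMeromorphicNFOn hm hzb]
    exact hord z hz
  obtain ⟨y, hy, hb⟩ := exists_ball (isOpen_analyticAt ℂ h') (fun z hz => han z (by simpa using hz))
  have hG' : Germ (toC f) h' := by
    refine hG.congr ?_
    have e := hm.toMeromorphicNFOn_eq_self_on_nhdsNE (x := 0) (Metric.mem_ball_self (by norm_num))
    exact (hG.analyticAt.frequently_eq_iff_eventually_eq (han 0 (by simp))).1
      (e.mono fun _ hh => hh.symm).frequently
  obtain ⟨x, hx1, hx2⟩ := exists_between hy
  refine ⟨x, hx1, ?_⟩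
  have := hG'.summable (x := x) (fun z hz => (hb hz).differentiableAt.differentiableWithinAt)
    (by linarith) hx2
  simpa [coeff_toC] using this

noncomputable def K (k : ℕ) : PowerSeries ℝ := PowerSeries.mk fun m => if k ∣ m then 1 else 0

noncomputable def Z (k : ℕ) : PowerSeries ℝ := (k : PowerSeries ℝ) * (X ^ k * K k)

lemma coeff_Z {k m : ℕ} (hm : 1 ≤ m) :
    coeff m (Z k) = if k ∣ m then (k:ℝ) else 0 := by
  have : (k : PowerSeries ℝ) = C (k:ℝ) := by simp
  rw [Z, this, coeff_C_mul, coeff_X_pow_mul']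
  by_cases hkm : k ≤ m
  · have : k ∣ m - k ↔ k ∣ m := by
      conv_rhs => rw [← Nat.sub_add_cancel hkm]
      simp
    simp [hkm, K, this]
  · have : ¬ k ∣ m := fun h => hkm (Nat.le_of_dvd hm h)
    simp [hkm, this]

lemma K_mul {k : ℕ} (hk : 0 < k) : (1 - X ^ k) * K k = 1 := by
  ext m
  rw [sub_mul, one_mul, map_sub, coeff_X_pow_mul', coeff_one]
  by_cases hkm : k ≤ m
  · have : k ∣ m - k ↔ k ∣ m := by
      conv_rhs => rw [← Nat.sub_add_cancel hkm]
      simp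
    have hm : m ≠ 0 := by omega
    simp [hkm, K, this, hm]
  · by_cases hm : m = 0
    · subst hm; simp [K, hk.ne']
    · have : ¬ k ∣ m := fun h => hkm (Nat.le_of_dvd (by omega) h)
      simp [hkm, this, hm, K]

lemma pow_eq_one_of {F : PowerSeries ℝ} (h0 : ∀ n, 0 ≤ coeff n F)
    (h1 : HasSum (fun n => coeff n F) 1) {z : ℂ} (hz : ‖z‖ ≤ 1)
    (hs : HasSum (fun n => ((coeff n F : ℝ) : ℂ) * z ^ n) 1) (n : ℕ) (hn : coeff n F ≠ 0) :
    z ^ n = 1 := by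
  have hre := Complex.hasSum_re hs
  simp only [Complex.re_ofReal_mul, Complex.one_re] at hre
  have hd := h1.sub hre
  rw [sub_self] at hd
  have hle : ∀ m, (z ^ m).re ≤ 1 := fun m =>
    (Complex.re_le_norm _).trans (by rw [norm_pow]; exact pow_le_one₀ (norm_nonneg _) hz)
  have hz0 := (hasSum_zero_iff_of_nonneg (fun m => by
    have := h0 m; have := hle m; change 0 ≤ coeff m F - coeff m F * (z ^ m).re; nlinarith)).1 hd
  have := congrFun hz0 n
  simp only [Pi.zero_apply] at this
  have hre1 : (z ^ n).re = 1 := by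
    have : coeff n F * (1 - (z ^ n).re) = 0 := by linarith
    rcases mul_eq_zero.1 this with h | h
    · exact absurd h hn
    · linarith
  have hnorm : ‖z ^ n‖ ≤ 1 := by rw [norm_pow]; exact pow_le_one₀ (norm_nonneg _) hz
  have hsq : (z ^ n).re ^ 2 + (z ^ n).im ^ 2 ≤ 1 := by
    have := Complex.sq_norm (z ^ n)
    rw [Complex.normSq_apply] at this
    nlinarith [norm_nonneg (z ^ n)]
  apply Complex.ext
  · simpa using hre1
  · have : (z ^ n).im ^ 2 ≤ 0 := by rw [hre1] at hsq; linarith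
    simpa using pow_eq_zero_iff (two_ne_zero) |>.1 (le_antisymm this (sq_nonneg _))

lemma good_one : Good 1 := ⟨2, by norm_num, summable_of_ne_finset_zero (s := {0}) (by
  intro n hn; simp at hn; simp [coeff_one, hn])⟩

lemma Good.summable {F : PowerSeries ℝ} (h : Good F) : Summable fun n => coeff n F := by
  obtain ⟨y, hy, hs⟩ := h
  refine Summable.of_norm (hs.of_nonneg_of_le (fun n => norm_nonneg _) fun n => ?_)
  exact le_mul_of_one_le_right (norm_nonneg _) (one_le_pow₀ hy.le)

lemma Good.summable_mul {F : PowerSeries ℝ} (h : Good F) {z : ℂ} (hz : ‖z‖ ≤ 1) :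
    Summable fun n => ((coeff n F : ℝ) : ℂ) * z ^ n := by
  refine Summable.of_norm_bounded h.summable.norm fun n => ?_
  rw [norm_mul, norm_pow, Complex.norm_real]
  exact mul_le_of_le_one_right (norm_nonneg _) (pow_le_one₀ (norm_nonneg _) hz)

lemma hasSum_one_sub {F : PowerSeries ℝ} {z a : ℂ}
    (hs : HasSum (fun n => ((coeff n F : ℝ) : ℂ) * z ^ n) a) :
    HasSum (fun n => ((coeff n (1 - F) : ℝ) : ℂ) * z ^ n) (1 - a) := by
  have h2 := hasSum_single (f := fun n => coeff n (1 : PowerSeries ℂ) * z ^ n) 0 (by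
    intro n hn; simp [coeff_one, hn])
  have e0 : coeff 0 (1 : PowerSeries ℂ) * z ^ 0 = 1 := by simp
  rw [e0] at h2
  refine (h2.sub hs).congr_fun fun n => ?_
  rw [map_sub, Complex.ofReal_sub, sub_mul, coeff_one, coeff_one]
  split_ifs <;> simp

set_option maxHeartbeats 2000000 in
lemma renewal {F : PowerSeries ℝ} (h0 : ∀ n, 0 ≤ coeff n F) (hF0 : coeff 0 F = 0)
    (hg : Good F) (h1 : ∑' n, coeff n F ≤ 1) {D : PowerSeries ℝ}
    (hD : D * (1 - F) = X * PowerSeries.derivative ℝ F) :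
    ∃ L : List ℕ, (∀ k ∈ L, 0 < k) ∧ (∃ g, Good g ∧ D = (L.map Z).sum + g) ∧
      (L = [] → Good (1 - F)⁻¹) := by
  have hone : constantCoeff (1 - F) ≠ 0 := by
    rw [← coeff_zero_eq_constantCoeff_apply, map_sub, hF0]; simp
  have hg1 : Good (1 - F) := by rw [sub_eq_add_neg]; exact good_add good_one (good_neg hg)
  rcases h1.lt_or_eq with hlt | heq
  · have hinv : Good (1 - F)⁻¹ := by
      refine good_inv hg1 ?_
      intro z hz a ha hazero
      subst hazero
      have h2 := hasSum_one_sub (hg.summable_mul hz).hasSum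
      have h3 := ha.unique h2
      have h4 : ∑' n, ((coeff n F : ℝ) : ℂ) * z ^ n = 1 := by linear_combination h3
      have h5 := norm_tsum_le_tsum_norm (hg.summable_mul hz).norm
      rw [h4, norm_one] at h5
      have h6 : ∑' n, ‖((coeff n F : ℝ) : ℂ) * z ^ n‖ ≤ ∑' n, coeff n F := by
        refine (hg.summable_mul hz).norm.tsum_le_tsum (fun n => ?_) hg.summable
        rw [norm_mul, norm_pow, Complex.norm_real, Real.norm_of_nonneg (h0 n)]
        exact mul_le_of_le_one_right (h0 n) (pow_le_one₀ (norm_nonneg _) hz)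
      linarith
    refine ⟨[], by simp, ⟨D, ?_, by simp⟩, fun _ => hinv⟩
    have : D = X * PowerSeries.derivative ℝ F * (1 - F)⁻¹ := by
      rw [← hD, mul_assoc, PowerSeries.mul_inv_cancel _ hone, mul_one]
    rw [this]
    exact good_mul (good_X_deriv hg) hinv
  · have hsum1 : HasSum (fun n => coeff n F) 1 := heq ▸ hg.summable.hasSum
    obtain ⟨n0, hn0⟩ : ∃ n, coeff n F ≠ 0 := by
      by_contra! hall
      simp [hall] at heq
    have hn0pos : 0 < n0 := by
      rcases Nat.eq_zero_or_pos n0 with h | h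
      · subst h; exact absurd hF0 hn0
      · exact h
    classical
    let Q : ℕ → Prop := fun d => ∀ n, coeff n F ≠ 0 → d ∣ n
    set k := Nat.findGreatest Q n0 with hk
    have hkQ : Q k := Nat.findGreatest_spec (P := Q) (m := 1) hn0pos (fun n _ => one_dvd n)
    have hkpos : 0 < k := Nat.findGreatest_pos.2 ⟨1, one_pos, hn0pos, fun n _ => one_dvd n⟩
    have hroot : ∀ z : ℂ, (∀ n, coeff n F ≠ 0 → z ^ n = 1) → z ^ k = 1 := by
      intro z hz
      have hl : Q (Nat.lcm k (orderOf z)) := fun n hn =>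
        Nat.lcm_dvd (hkQ n hn) (orderOf_dvd_of_pow_eq_one (hz n hn))
      have hle : Nat.lcm k (orderOf z) ≤ k :=
        Nat.le_findGreatest (Nat.le_of_dvd hn0pos (hl n0 hn0)) hl
      have hd : Nat.lcm k (orderOf z) ∣ n0 := hl n0 hn0
      have hpos : 0 < Nat.lcm k (orderOf z) := Nat.pos_of_dvd_of_pos hd hn0pos
      have he : Nat.lcm k (orderOf z) = k :=
        le_antisymm hle (Nat.le_of_dvd hpos (Nat.dvd_lcm_left _ _))
      exact orderOf_dvd_iff_pow_eq_one.1 (he ▸ Nat.dvd_lcm_right k (orderOf z))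
    set H : PowerSeries ℝ := (1 - F) * K k with hH
    have hHF : (1 - X ^ k) * H = 1 - F := by
      rw [hH, mul_left_comm, K_mul hkpos, mul_one]
    have hcH : ∀ m, coeff m H = if k ∣ m then 1 - ∑ j ∈ Finset.range (m + 1), coeff j F else 0 := by
      intro m
      rw [hH, coeff_mul, Finset.Nat.sum_antidiagonal_eq_sum_range_succ_mk]
      have hz : ∀ j ∈ Finset.range (m+1), coeff j (1 - F) * coeff (m - j) (K k)
          = if k ∣ m then coeff j (1 - F) else 0 := by
        intro j hj
        have hjm : j ≤ m := by simp at hj; omega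
        by_cases hkj : k ∣ j
        · have : k ∣ m - j ↔ k ∣ m := by
            rw [Nat.dvd_sub_iff_left hjm hkj]
          simp [K, this]
        · have h3 : coeff j F = 0 := by
            by_contra h; exact hkj (hkQ j h)
          have h4 : j ≠ 0 := by rintro rfl; exact hkj (dvd_zero k)
          have : coeff j (1 - F) = 0 := by simp [coeff_one, h4, h3]
          simp [this]
      rw [Finset.sum_congr rfl hz]
      split_ifs with hkm
      · simp [coeff_one, Finset.sum_sub_distrib]
      · simp
    have htail : ∀ m, 0 ≤ 1 - ∑ j ∈ Finset.range (m + 1), coeff j F := fun m => by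
      have := sum_le_hasSum (Finset.range (m+1)) (fun i _ => h0 i) hsum1
      linarith
    have hHnn : ∀ m, 0 ≤ coeff m H := fun m => by
      rw [hcH]; split_ifs
      · exact htail m
      · rfl
    have hHgood : Good H := by
      obtain ⟨y, hy, hs⟩ := hg
      rw [good_iff]
      refine ⟨y, hy, ∑' n, ‖coeff n F‖ * y ^ n, fun m => ?_⟩
      have hym : 0 < y ^ m := by positivity
      have e1 : ‖coeff m H‖ ≤ 1 - ∑ j ∈ Finset.range (m + 1), coeff j F := by
        rw [Real.norm_of_nonneg (hHnn m), hcH]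
        split_ifs
        · rfl
        · exact htail m
      have e2 : HasSum (fun n => coeff (n + (m+1)) F) (1 - ∑ j ∈ Finset.range (m + 1), coeff j F) :=
        (hasSum_nat_add_iff' (m+1)).2 hsum1
      have e3 : Summable fun n => ‖coeff (n + (m+1)) F‖ * y ^ (n + (m+1)) :=
        (summable_nat_add_iff (m+1)).2 hs
      have e4 : (1 - ∑ j ∈ Finset.range (m + 1), coeff j F) * y ^ m ≤
          ∑' n, ‖coeff (n + (m+1)) F‖ * y ^ (n + (m+1)) := by
        refine hasSum_le (fun n => ?_) (e2.mul_right (y ^ m)) e3.hasSum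
        rw [Real.norm_of_nonneg (h0 _)]
        exact mul_le_mul_of_nonneg_left (pow_le_pow_right₀ hy.le (by omega)) (h0 _)
      have e5 : ∑' n, ‖coeff (n + (m+1)) F‖ * y ^ (n + (m+1)) ≤ ∑' n, ‖coeff n F‖ * y ^ n := by
        rw [← hs.sum_add_tsum_nat_add (m+1)]
        have : 0 ≤ ∑ i ∈ Finset.range (m+1), ‖coeff i F‖ * y ^ i :=
          Finset.sum_nonneg fun i _ => by positivity
        linarith
      calc _ ≤ _ := mul_le_mul_of_nonneg_right e1 hym.le
        _ ≤ _ := e4.trans e5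
    have hHinv : Good H⁻¹ := by
      refine good_inv hHgood ?_
      intro z hz a ha hazero
      subst hazero
      have hFs := (hg.summable_mul hz).hasSum
      have h2 := hasSum_one_sub hFs
      have h3 : HasSum (fun n => ((coeff n (1 - F) : ℝ) : ℂ) * z ^ n) ((1 - z ^ k) * 0) := by
        have hp : HasSum (fun n => coeff n ((1 - X ^ k : PowerSeries ℂ)) * z ^ n) (1 - z ^ k) := by
          have e1 := hasSum_single (f := fun n => coeff n (1 : PowerSeries ℂ) * z ^ n) 0 (by
            intro n hn; simp [coeff_one, hn])
          have e2 := hasSum_single (f := fun n => coeff n (X ^ k : PowerSeries ℂ) * z ^ n) k (by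
            intro n hn; simp [coeff_X_pow, hn])
          simpa [sub_mul] using e1.sub e2
        have ha' : HasSum (fun n => coeff n (toC H) * z ^ n) 0 := by simpa [coeff_toC] using ha
        have := hasSum_mul hp ha'
        have e : (1 - X ^ k) * toC H = toC (1 - F) := by
          rw [← hHF]; simp [toC]
        rw [e] at this
        simpa only [coeff_toC] using this
      have h4 := h3.unique h2
      have h5 : ∑' n, ((coeff n F : ℝ) : ℂ) * z ^ n = 1 := by linear_combination h4
      rw [h5] at hFs
      have hzk := hroot z (pow_eq_one_of h0 hsum1 hz hFs)
      have h6 : HasSum (fun n => ((coeff n H : ℝ) : ℂ)) 0 := by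
        convert ha using 2 with n
        by_cases hkn : k ∣ n
        · obtain ⟨c, rfl⟩ := hkn
          simp [pow_mul, hzk]
        · simp [hcH n, hkn]
      have h7 : HasSum (fun n => coeff n H) 0 := by simpa using Complex.hasSum_re h6
      have h8 := le_hasSum h7 0 (fun j _ => hHnn j)
      rw [hcH] at h8
      simp only [dvd_zero, if_true, zero_add, Finset.sum_range_one, hF0] at h8
      norm_num at h8
    refine ⟨[k], by simpa using hkpos, ⟨-(X * PowerSeries.derivative ℝ H * H⁻¹),
      good_neg (good_mul (good_X_deriv hHgood) hHinv), ?_⟩, by simp⟩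
    have hHne : constantCoeff H ≠ 0 := by
      rw [← coeff_zero_eq_constantCoeff_apply, hcH]; 
      simp only [dvd_zero, if_true, zero_add, Finset.sum_range_one, hF0]; norm_num
    have hder : - PowerSeries.derivative ℝ F = - ((k : PowerSeries ℝ) * X ^ (k-1)) * H
        + (1 - X ^ k) * PowerSeries.derivative ℝ H := by
      have := congrArg (PowerSeries.derivative ℝ) hHF
      rw [Derivation.leibniz, map_sub, map_sub, derivative_pow, derivative_one, derivative_X] at this
      simp only [smul_eq_mul] at this
      linear_combination -this
    have hXk : X * X ^ (k-1) = (X ^ k : PowerSeries ℝ) := by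
      rw [← pow_succ']; congr 1; omega
    have hcan : (1 - F) ≠ 0 := fun h => hone (by rw [h, map_zero])
    apply mul_right_cancel₀ hcan
    rw [hD]
    simp only [List.map_cons, List.map_nil, List.sum_cons, List.sum_nil, add_zero, Z]
    have hK := K_mul hkpos
    have hI := PowerSeries.inv_mul_cancel H hHne
    rw [← hHF]
    linear_combination (-X) * hder + (k : PowerSeries ℝ) * H * hXk
      - (k : PowerSeries ℝ) * X ^ k * H * hK + X * PowerSeries.derivative ℝ H * (1 - X^k) * hI

end BassAux

namespace BassAux
open PowerSeries Filter Topology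
open scoped ENNReal
variable {E : Type*}

/-- weights of paths of length `n` from `i` to `j` with intermediate vertices weighted by `u`. -/
noncomputable def P (A : E → E → ℝ≥0∞) (u : E → ℝ≥0∞) : ℕ → E → E → ℝ≥0∞
  | 0 => fun _ _ => 0
  | n + 1 => fun i j => (if n = 0 then A i j else 0) + ∑' k, A i k * (u k * P A u n k j)

variable (A : E → E → ℝ≥0∞)

lemma P_zero (u : E → ℝ≥0∞) (i j : E) : P A u 0 i j = 0 := rfl
lemma P_succ (u : E → ℝ≥0∞) (n : ℕ) (i j : E) : P A u (n+1) i j =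
  (if n = 0 then A i j else 0) + ∑' k, A i k * (u k * P A u n k j) := rfl
lemma P_one (u : E → ℝ≥0∞) (i j : E) : P A u 1 i j = A i j := by simp [P_succ, P_zero]
lemma P_succ_succ (u : E → ℝ≥0∞) (n : ℕ) (i j : E) : P A u (n+2) i j =
  ∑' k, A i k * (u k * P A u (n+1) k j) := by rw [P_succ]; simp

lemma P_mono {u v : E → ℝ≥0∞} (h : ∀ k, u k ≤ v k) (n : ℕ) (i j : E) :
    P A u n i j ≤ P A v n i j := by
  induction n generalizing i with
  | zero => simp [P_zero]
  | succ n ih =>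
    rw [P_succ, P_succ]
    gcongr with k
    · exact h k
    · exact ih k

lemma P_scale (c : ℝ≥0∞) (u : E → ℝ≥0∞) (n : ℕ) (i j : E) :
    P (fun i j => c * A i j) u n i j = c ^ n * P A u n i j := by
  induction n generalizing i with
  | zero => simp [P_zero]
  | succ n ih =>
    rw [P_succ, P_succ, mul_add, ← ENNReal.tsum_mul_left]
    congr 1
    · split_ifs with h
      · simp [h]
      · simp
    · refine tsum_congr fun k => ?_
      rw [ih, pow_succ]; ring

lemma P_first [DecidableEq E] (u u' : E → ℝ≥0∞) (a : E)
    (hu : ∀ k, u' k = u k + if k = a then 1 else 0) (n : ℕ) (i j : E) :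
    P A u' n i j = P A u n i j +
      ∑ x ∈ Finset.HasAntidiagonal.antidiagonal n, P A u x.1 i a * P A u' x.2 a j := by
  induction n generalizing i with
  | zero => simp [P_zero]
  | succ n ih =>
    rw [Finset.Nat.sum_antidiagonal_succ, P_zero, zero_mul, zero_add, P_succ A u' n i j,
      P_succ A u n i j]
    have e1 : ∑' k, A i k * (u' k * P A u' n k j) =
        ∑' k, A i k * (u k * P A u' n k j) + A i a * P A u' n a j := by
      have : ∀ k, A i k * (u' k * P A u' n k j) = A i k * (u k * P A u' n k j) +
          (if k = a then A i a * P A u' n a j else 0) := by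
        intro k
        rw [hu]
        split_ifs with h
        · subst h; ring
        · simp
      simp only [this]
      rw [ENNReal.tsum_add, tsum_ite_eq]
    have e2 : ∑' k, A i k * (u k * P A u' n k j) = ∑' k, A i k * (u k * P A u n k j) +
        ∑ x ∈ Finset.HasAntidiagonal.antidiagonal n,
          (∑' k, A i k * (u k * P A u x.1 k a)) * P A u' x.2 a j := by
      have : ∀ k, A i k * (u k * P A u' n k j) = A i k * (u k * P A u n k j) +
          ∑ x ∈ Finset.HasAntidiagonal.antidiagonal n,
            A i k * (u k * P A u x.1 k a) * P A u' x.2 a j := by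
        intro k
        rw [ih k, mul_add, mul_add, Finset.mul_sum, Finset.mul_sum]
        congr 1
        refine Finset.sum_congr rfl fun x _ => by ring
      simp only [this]
      rw [ENNReal.tsum_add, Summable.tsum_finsetSum (fun _ _ => ENNReal.summable)]
      simp only [ENNReal.tsum_mul_right]
    have e3 : ∑ x ∈ Finset.HasAntidiagonal.antidiagonal n, P A u (x.1 + 1) i a * P A u' x.2 a j
        = A i a * P A u' n a j + ∑ x ∈ Finset.HasAntidiagonal.antidiagonal n,
          (∑' k, A i k * (u k * P A u x.1 k a)) * P A u' x.2 a j := by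
      simp only [P_succ A u, add_mul, Finset.sum_add_distrib]
      congr 1
      rw [Finset.sum_eq_single (0, n)]
      · simp
      · rintro ⟨p, q⟩ hx hne
        have : p ≠ 0 := by
          rintro rfl
          have := Finset.HasAntidiagonal.mem_antidiagonal.1 hx
          simp at this; subst this; exact hne rfl
        simp [this]
      · intro h; exact absurd (Finset.HasAntidiagonal.mem_antidiagonal.2 (by simp)) h
    rw [e1, e2, e3]
    ring

lemma P_CK (u : E → ℝ≥0∞) (l m : ℕ) (i j : E) :
    ∑' e, P A u (l+1) i e * (u e * P A u (m+1) e j) = P A u (l+1+(m+1)) i j := by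
  induction l generalizing i with
  | zero => 
    simp only [zero_add, P_one]
    rw [show 1 + (m+1) = m + 2 by ring, P_succ_succ]
  | succ l ih =>
    rw [show l + 1 + 1 + (m+1) = (l + m + 1) + 2 by ring, P_succ_succ]
    simp only [P_succ_succ A u l]
    simp only [← ENNReal.tsum_mul_right]
    rw [ENNReal.tsum_comm]
    refine tsum_congr fun k => ?_
    rw [show l + m + 1 + 1 = l + 1 + (m+1) by ring, ← ih, ← ENNReal.tsum_mul_left,
      ← ENNReal.tsum_mul_left]
    refine tsum_congr fun e => by ring

/-- trace -/
noncomputable def NN (u : E → ℝ≥0∞) (n : ℕ) : ℝ≥0∞ := ∑' e, u e * P A u n e e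

/-- total -/
noncomputable def SS (u : E → ℝ≥0∞) (n : ℕ) : ℝ≥0∞ := ∑' i, ∑' j, P A u n i j

/-- excess -/
noncomputable def WW (u u' : E → ℝ≥0∞) (a : E) (n : ℕ) : ℝ≥0∞ := P A u' n a a +
  ∑' e, u e * ∑ x ∈ Finset.HasAntidiagonal.antidiagonal n, P A u x.1 e a * P A u' x.2 a e

lemma NN_eq [DecidableEq E] (u u' : E → ℝ≥0∞) (a : E)
    (hu : ∀ k, u' k = u k + if k = a then 1 else 0) (n : ℕ) :
    NN A u' n = NN A u n + WW A u u' a n := by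
  have : ∀ e, u' e * P A u' n e e = (if e = a then P A u' n a a else 0) +
      (u e * P A u n e e + u e * ∑ x ∈ Finset.HasAntidiagonal.antidiagonal n, P A u x.1 e a * P A u' x.2 a e) := by
    intro e
    rw [hu, add_mul, ← mul_add, ← P_first A u u' a hu]
    split_ifs with h
    · subst h; ring
    · simp
  rw [NN]
  simp only [this]
  rw [ENNReal.tsum_add, ENNReal.tsum_add, tsum_ite_eq, NN, WW]
  ring

lemma VV_eq (u : E → ℝ≥0∞) (a : E) (n : ℕ) : P A u n a a +
  ∑' e, u e * ∑ x ∈ Finset.HasAntidiagonal.antidiagonal n, P A u x.1 e a * P A u x.2 a e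
    = n * P A u n a a := by
  rcases n with _ | _ | n
  · simp [P_zero]
  · simp [P_zero, Finset.Nat.sum_antidiagonal_succ]
  · simp only [Finset.mul_sum]
    rw [Summable.tsum_finsetSum (fun _ _ => ENNReal.summable), Finset.Nat.sum_antidiagonal_succ,
      Finset.Nat.sum_antidiagonal_succ']
    simp only [P_zero, mul_zero, zero_mul, tsum_zero, zero_add, add_zero]
    have : ∀ x ∈ Finset.HasAntidiagonal.antidiagonal n,
      ∑' e, u e * (P A u (x.1 + 1) e a * P A u (x.2 + 1) a e) = P A u (n+2) a a := by
      intro x hx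
      have hx := Finset.HasAntidiagonal.mem_antidiagonal.1 hx
      rw [show n + 2 = x.2 + 1 + (x.1 + 1) by omega, ← P_CK]
      exact tsum_congr fun e => by ring
    rw [Finset.sum_congr rfl this]
    simp
    ring

lemma WW_eq [DecidableEq E] (u u' : E → ℝ≥0∞) (a : E)
    (hu : ∀ k, u' k = u k + if k = a then 1 else 0) (n : ℕ) :
    WW A u u' a n = n * P A u n a a +
      ∑ x ∈ Finset.HasAntidiagonal.antidiagonal n, P A u x.1 a a * WW A u u' a x.2 := by
  rw [← VV_eq]
  have h1 := P_first A u u' a hu n a a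
  have key : ∀ e, ∑ x ∈ Finset.HasAntidiagonal.antidiagonal n, P A u x.1 e a * P A u' x.2 a e =
     ∑ x ∈ Finset.HasAntidiagonal.antidiagonal n, P A u x.1 e a * P A u x.2 a e +
     ∑ x ∈ Finset.HasAntidiagonal.antidiagonal n, P A u x.1 a a *
       ∑ y ∈ Finset.HasAntidiagonal.antidiagonal x.2, P A u y.1 e a * P A u' y.2 a e := by
    intro e
    have hp : ∀ x : ℕ × ℕ, P A u x.1 e a * P A u' x.2 a e = P A u x.1 e a * P A u x.2 a e +
        P A u x.1 e a * ∑ y ∈ Finset.HasAntidiagonal.antidiagonal x.2, P A u y.1 a a * P A u' y.2 a e := by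
      intro x; rw [← mul_add, ← P_first A u u' a hu]
    rw [Finset.sum_congr rfl fun x _ => hp x, Finset.sum_add_distrib]
    congr 1
    -- associativity and commutativity of convolution
    have hc := congrArg (coeff n) (mul_left_comm (PowerSeries.mk fun n => P A u n e a)
      (PowerSeries.mk fun n => P A u n a a) (PowerSeries.mk fun n => P A u' n a e))
    simpa [coeff_mul] using hc
  conv_lhs => rw [WW]
  simp only [key, mul_add]
  rw [ENNReal.tsum_add]
  conv_lhs => rw [h1]
  simp only [WW, mul_add, Finset.sum_add_distrib]
  have : ∑' e, u e * ∑ x ∈ Finset.HasAntidiagonal.antidiagonal n, P A u x.1 a a *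
       ∑ y ∈ Finset.HasAntidiagonal.antidiagonal x.2, P A u y.1 e a * P A u' y.2 a e =
     ∑ x ∈ Finset.HasAntidiagonal.antidiagonal n, P A u x.1 a a * ∑' e, u e *
       ∑ y ∈ Finset.HasAntidiagonal.antidiagonal x.2, P A u y.1 e a * P A u' y.2 a e := by
    simp only [Finset.mul_sum (s := Finset.HasAntidiagonal.antidiagonal n)]
    rw [Summable.tsum_finsetSum (fun _ _ => ENNReal.summable)]
    refine Finset.sum_congr rfl fun x _ => ?_
    rw [← ENNReal.tsum_mul_left]
    exact tsum_congr fun e => by ring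
  rw [this]
  ring

lemma SS_eq [DecidableEq E] (u u' : E → ℝ≥0∞) (a : E)
    (hu : ∀ k, u' k = u k + if k = a then 1 else 0) (n : ℕ) :
    SS A u' n = SS A u n + ∑ x ∈ Finset.HasAntidiagonal.antidiagonal n,
      (∑' i, P A u x.1 i a) * ∑' j, P A u' x.2 a j := by
  rw [SS]
  simp only [P_first A u u' a hu n]
  simp only [ENNReal.tsum_add]
  rw [SS]
  congr 1
  have : ∀ i, ∑' j, ∑ x ∈ Finset.HasAntidiagonal.antidiagonal n, P A u x.1 i a * P A u' x.2 a j =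
     ∑ x ∈ Finset.HasAntidiagonal.antidiagonal n, P A u x.1 i a * ∑' j, P A u' x.2 a j := by
    intro i
    rw [Summable.tsum_finsetSum (fun _ _ => ENNReal.summable)]
    simp only [ENNReal.tsum_mul_left]
  simp only [this]
  rw [Summable.tsum_finsetSum (fun _ _ => ENNReal.summable)]
  simp only [ENNReal.tsum_mul_right]

lemma row_eq [DecidableEq E] (u u' : E → ℝ≥0∞) (a : E)
    (hu : ∀ k, u' k = u k + if k = a then 1 else 0) (n : ℕ) :
    ∑' j, P A u' n a j = ∑' j, P A u n a j + ∑ x ∈ Finset.HasAntidiagonal.antidiagonal n,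
      P A u x.1 a a * ∑' j, P A u' x.2 a j := by
  simp only [P_first A u u' a hu n]
  simp only [ENNReal.tsum_add]
  congr 1
  rw [Summable.tsum_finsetSum (fun _ _ => ENNReal.summable)]
  simp only [ENNReal.tsum_mul_left]

/-- bounds -/
lemma row_bound {u : E → ℝ≥0∞} (hu : ∀ k, u k = 0 ∨ u k = 1) {M c : ℝ≥0∞}
    (hM : ∑' i, ∑' j, A i j ≤ M) (hc : ∀ k, u k = 1 → ∑' l, A k l * u l ≤ c) (n : ℕ) (k : E)
    (hk : u k = 1) : ∑' j, P A u (n+1) k j ≤ M * c ^ n := by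
  induction n generalizing k with
  | zero => 
    simp only [zero_add, P_one, pow_zero, mul_one]
    exact (ENNReal.le_tsum k).trans hM
  | succ n ih =>
    simp only [P_succ_succ]
    rw [ENNReal.tsum_comm]
    simp only [ENNReal.tsum_mul_left]
    calc ∑' l, A k l * (u l * ∑' j, P A u (n+1) l j) ≤ ∑' l, (A k l * u l) * (M * c ^ n) := by
          refine ENNReal.tsum_le_tsum fun l => ?_
          rcases hu l with h | h
          · simp [h]
          · rw [h, one_mul, mul_one]; gcongr; exact ih l h
      _ ≤ c * (M * c ^ n) := by rw [ENNReal.tsum_mul_right]; gcongr; exact hc k hk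
      _ = _ := by ring

lemma SS_bound {u : E → ℝ≥0∞} (hu : ∀ k, u k = 0 ∨ u k = 1) {M c : ℝ≥0∞}
    (hM : ∑' i, ∑' j, A i j ≤ M) (hc : ∀ k, u k = 1 → ∑' l, A k l * u l ≤ c) (n : ℕ) :
    SS A u (n+2) ≤ M * M * c ^ n := by
  rw [SS]
  have : ∀ i, ∑' j, P A u (n+2) i j ≤ (∑' k, A i k) * (M * c ^ n) := by
    intro i
    simp only [P_succ_succ]
    rw [ENNReal.tsum_comm]
    simp only [ENNReal.tsum_mul_left]
    rw [← ENNReal.tsum_mul_right]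
    refine ENNReal.tsum_le_tsum fun l => ?_
    rcases hu l with h | h
    · simp [h]
    · rw [h, one_mul]; gcongr; exact row_bound A hu hM hc n l h
  calc _ ≤ ∑' i, (∑' k, A i k) * (M * c ^ n) := ENNReal.tsum_le_tsum this
    _ ≤ M * (M * c ^ n) := by rw [ENNReal.tsum_mul_right]; gcongr
    _ = _ := by ring

lemma SS_ne_top {u : E → ℝ≥0∞} (hu : ∀ k, u k = 0 ∨ u k = 1)
    (hM : ∑' i, ∑' j, A i j ≠ ⊤) (n : ℕ) : SS A u n ≠ ⊤ := by
  rcases n with _ | _ | n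
  · simp [SS, P_zero]
  · simpa [SS, P_one] using hM
  · refine ne_top_of_le_ne_top ?_ (SS_bound A hu le_rfl (c := ∑' i, ∑' j, A i j) ?_ n)
    · exact ENNReal.mul_ne_top (ENNReal.mul_ne_top hM hM) (ENNReal.pow_ne_top hM)
    · intro k _
      refine le_trans ?_ (ENNReal.le_tsum k)
      refine ENNReal.tsum_le_tsum fun l => ?_
      rcases hu l with h | h <;> simp [h]

lemma row_le_SS (u : E → ℝ≥0∞) (n : ℕ) (i : E) : ∑' j, P A u n i j ≤ SS A u n := 
  ENNReal.le_tsum (f := fun i => ∑' j, P A u n i j) i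
lemma col_le_SS (u : E → ℝ≥0∞) (n : ℕ) (j : E) : ∑' i, P A u n i j ≤ SS A u n := 
  ENNReal.tsum_le_tsum fun i => ENNReal.le_tsum j
lemma P_le_SS (u : E → ℝ≥0∞) (n : ℕ) (i j : E) : P A u n i j ≤ SS A u n := 
  (ENNReal.le_tsum j).trans (row_le_SS A u n i)
lemma NN_le_SS {u : E → ℝ≥0∞} (hu : ∀ k, u k = 0 ∨ u k = 1) (n : ℕ) : NN A u n ≤ SS A u n := by
  refine ENNReal.tsum_le_tsum fun i => ?_
  refine le_trans ?_ (ENNReal.le_tsum i)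
  rcases hu i with h | h <;> simp [h]

/-- real series -/
noncomputable def ser (a : ℕ → ℝ≥0∞) : PowerSeries ℝ := PowerSeries.mk fun n => (a n).toReal

lemma coeff_ser (a : ℕ → ℝ≥0∞) (n : ℕ) : coeff n (ser a) = (a n).toReal := by simp [ser]

lemma ser_nonneg (a : ℕ → ℝ≥0∞) (n : ℕ) : 0 ≤ coeff n (ser a) := by simp [ser]

lemma ser_eq {a b c d : ℕ → ℝ≥0∞} (ha : ∀ n, a n ≠ ⊤) (h : ∀ n, a n = b n +
    ∑ x ∈ Finset.HasAntidiagonal.antidiagonal n, c x.1 * d x.2) :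
    ser a = ser b + ser c * ser d := by
  ext n
  have hn := ha n
  rw [h n, ENNReal.add_ne_top, ENNReal.sum_ne_top] at hn
  rw [map_add, coeff_mul, coeff_ser, h n, ENNReal.toReal_add hn.1 (ENNReal.sum_ne_top.2 hn.2),
    ENNReal.toReal_sum hn.2]
  simp [ser]

lemma good_ser_mono {a b : ℕ → ℝ≥0∞} (hb : ∀ n, b n ≠ ⊤) (h : ∀ n, a n ≤ b n)
    (hg : Good (ser b)) : Good (ser a) := by
  refine good_mono hg fun n => ?_
  rw [Real.norm_of_nonneg (ser_nonneg _ _), Real.norm_of_nonneg (ser_nonneg _ _), coeff_ser, coeff_ser]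
  exact ENNReal.toReal_mono (hb n) (h n)

end BassAux

namespace BassAux
open PowerSeries Filter Topology
open scoped ENNReal
variable {E : Type*}

def Claim (A : E → E → ℝ≥0∞) (u : E → ℝ≥0∞) : Prop :=
  (∀ i j, ∃ h : ℂ → ℂ, MeromorphicOn h (Metric.ball 0 2) ∧
    Germ (toC (ser (fun n => P A u n i j))) h) ∧
  ∃ L : List ℕ, (∀ k ∈ L, 0 < k) ∧ ∃ g, Good g ∧ ser (NN A u) = (L.map Z).sum + g ∧
    (L = [] → Good (ser (SS A u)))

lemma small_of_geom {F G : PowerSeries ℝ} (hF : ∀ n, 0 ≤ coeff n F) (hG : ∀ n, 0 ≤ coeff n G)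
    (h : G = F + F * G)
    (hs : ∀ x : ℝ, 0 ≤ x → x < 1 → Summable fun n => coeff n G * x ^ n) (x : ℝ) (hx0 : 0 ≤ x)
    (hx1 : x < 1) :
    (Summable fun n => coeff n F * x ^ n) ∧ ∑' n, coeff n F * x ^ n ≤ 1 := by
  have hle : ∀ n, coeff n F ≤ coeff n G := by
    intro n
    conv_rhs => rw [h]
    rw [map_add, coeff_mul]
    have : 0 ≤ ∑ p ∈ Finset.HasAntidiagonal.antidiagonal n, coeff p.1 F * coeff p.2 G :=
      Finset.sum_nonneg fun p _ => mul_nonneg (hF _) (hG _)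
    linarith
  have hGs := hs x hx0 hx1
  have hFs : Summable fun n => coeff n F * x ^ n :=
    hGs.of_nonneg_of_le (fun n => mul_nonneg (hF n) (by positivity)) fun n => by
      gcongr; exact hle n
  refine ⟨hFs, ?_⟩
  have cF : HasSum (fun n => coeff n (toC F) * (x:ℂ) ^ n) ((∑' n, coeff n F * x ^ n : ℝ) : ℂ) := by
    have := Complex.hasSum_ofReal.2 hFs.hasSum
    simpa [coeff_toC] using this
  have cG : HasSum (fun n => coeff n (toC G) * (x:ℂ) ^ n) ((∑' n, coeff n G * x ^ n : ℝ) : ℂ) := by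
    have := Complex.hasSum_ofReal.2 hGs.hasSum
    simpa [coeff_toC] using this
  have e : toC G = toC F + toC F * toC G := by
    conv_lhs => rw [h]
    simp [toC]
  have h1 := cF.add (hasSum_mul cF cG)
  have h2 : (fun n => coeff n (toC G) * (x:ℂ) ^ n) =
      fun n => coeff n (toC F) * (x:ℂ) ^ n + coeff n (toC F * toC G) * (x:ℂ) ^ n := by
    funext n
    conv_lhs => rw [e]
    rw [map_add, add_mul]
  rw [← h2] at h1
  have h2 := h1
  have h3 := cG.unique h2
  norm_cast at h3
  set f := ∑' n, coeff n F * x ^ n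
  set g := ∑' n, coeff n G * x ^ n
  have hg0 : 0 ≤ g := tsum_nonneg fun n => mul_nonneg (hG n) (by positivity)
  by_contra! hf
  nlinarith

lemma sum_le_one_of {F : PowerSeries ℝ} (hF : ∀ n, 0 ≤ coeff n F)
    (h : ∀ x : ℝ, 0 ≤ x → x < 1 →
      (Summable fun n => coeff n F * x ^ n) ∧ ∑' n, coeff n F * x ^ n ≤ 1) :
    ∑' n, coeff n F ≤ 1 := by
  refine Real.tsum_le_of_sum_le hF fun s => ?_
  have hc : Tendsto (fun x : ℝ => ∑ n ∈ s, coeff n F * x ^ n) (𝓝[<] 1) (𝓝 (∑ n ∈ s, coeff n F * 1 ^ n)) := by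
    have : Continuous fun x : ℝ => ∑ n ∈ s, coeff n F * x ^ n := by fun_prop
    exact this.continuousAt.tendsto.mono_left nhdsWithin_le_nhds
  simp only [one_pow, mul_one] at hc
  refine le_of_tendsto hc ?_
  have : Set.Ioo (0:ℝ) 1 ∈ 𝓝[<] (1:ℝ) := Ioo_mem_nhdsLT zero_lt_one
  filter_upwards [this] with x hx
  obtain ⟨h1, h2⟩ := h x hx.1.le hx.2
  exact (h1.sum_le_tsum s fun n _ => mul_nonneg (hF n) (pow_nonneg hx.1.le n)).trans h2

lemma step [DecidableEq E] (A : E → E → ℝ≥0∞) (hM : ∑' i, ∑' j, A i j ≠ ⊤) (u u' : E → ℝ≥0∞)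
    (a : E) (h01 : ∀ k, u k = 0 ∨ u k = 1) (h01' : ∀ k, u' k = 0 ∨ u' k = 1)
    (hu : ∀ k, u' k = u k + if k = a then 1 else 0)
    (H : ∀ x : ℝ, 0 ≤ x → x < 1 → Summable fun n => (P A u' n a a).toReal * x ^ n)
    (hc : Claim A u) : Claim A u' := by
  obtain ⟨hmer, L, hL, g, hg, hN, hS⟩ := hc
  have ftS := SS_ne_top A h01 hM
  have ftS' := SS_ne_top A h01' hM
  have ftP : ∀ i j n, P A u n i j ≠ ⊤ := fun i j n => ne_top_of_le_ne_top (ftS n) (P_le_SS A u n i j)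
  have ftP' : ∀ i j n, P A u' n i j ≠ ⊤ := fun i j n =>
    ne_top_of_le_ne_top (ftS' n) (P_le_SS A u' n i j)
  set F := ser (fun n => P A u n a a) with hFdef
  have hF0 : coeff 0 F = 0 := by simp [hFdef, coeff_ser, P_zero]
  have hFnn : ∀ n, 0 ≤ coeff n F := ser_nonneg _
  have hone : constantCoeff (1 - F) ≠ 0 := by
    rw [← coeff_zero_eq_constantCoeff_apply, map_sub, hF0]; simp
  have hrec : ∀ i j, ser (fun n => P A u' n i j) = ser (fun n => P A u n i j) +
      ser (fun n => P A u n i a) * ser (fun n => P A u' n a j) := fun i j =>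
    ser_eq (ftP' i j) fun n => P_first A u u' a hu n i j
  have hsolve : ∀ {x y : PowerSeries ℝ}, x = y + F * x → x = (1 - F)⁻¹ * y := by
    intro x y h
    have : (1 - F) * x = y := by linear_combination h
    rw [← this, ← mul_assoc, PowerSeries.inv_mul_cancel _ hone, one_mul]
  have hx := small_of_geom hFnn (ser_nonneg (fun n => P A u' n a a)) (hrec a a)
    (fun x h0 h1 => by simpa only [coeff_ser] using H x h0 h1)
  obtain ⟨hFf, hFm, hFG⟩ := hmer a a
  have hFgood : Good F := good_of_mero hFnn hx hFm hFG
  have hF1 := sum_le_one_of hFnn hx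
  -- the excess series
  have ftN' : ∀ n, NN A u' n ≠ ⊤ := fun n => ne_top_of_le_ne_top (ftS' n) (NN_le_SS A h01' n)
  have ftN : ∀ n, NN A u n ≠ ⊤ := fun n => ne_top_of_le_ne_top (ftS n) (NN_le_SS A h01 n)
  have ftW : ∀ n, WW A u u' a n ≠ ⊤ := fun n => by
    have := ftN' n
    rw [NN_eq A u u' a hu] at this
    exact (ENNReal.add_ne_top.1 this).2
  set D := ser (WW A u u' a) with hDdef
  have hND : ser (NN A u') = ser (NN A u) + D := by
    ext n
    rw [map_add, coeff_ser, coeff_ser, hDdef, coeff_ser, NN_eq A u u' a hu,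
      ENNReal.toReal_add (ftN n) (ftW n)]
  have hD1 : D = ser (fun n => n * P A u n a a) + F * D :=
    ser_eq ftW fun n => WW_eq A u u' a hu n
  have hD2 : ser (fun n => n * P A u n a a) = X * PowerSeries.derivative ℝ F := by
    ext n
    cases n with
    | zero => simp [coeff_ser]
    | succ n =>
      rw [coeff_succ_X_mul, coeff_derivative, hFdef, coeff_ser, coeff_ser, ENNReal.toReal_mul,
        ENNReal.toReal_natCast]
      push_cast; ring
  obtain ⟨L', hL', ⟨g', hg', hD'⟩, hinv⟩ := renewal hFnn hF0 hFgood hF1 (D := D)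
    (by rw [← hD2]; linear_combination hD1)
  refine ⟨fun i j => ?_, L ++ L', ?_, g + g', good_add hg hg', ?_, ?_⟩
  · obtain ⟨h1, m1, g1⟩ := hmer i j
    obtain ⟨h2, m2, g2⟩ := hmer i a
    obtain ⟨h3, m3, g3⟩ := hmer a j
    have h10 : coeff 0 (1 - F) ≠ 0 := by simpa using hone
    have gi : Germ (toC (1 - F)⁻¹) (1 - hFf)⁻¹ := by
      rw [toC_inv _ h10]
      refine Germ.inv ?_ ?_
      · have : toC (1 - F) = 1 - toC F := by simp [toC]
        rw [this]
        exact germ_one.sub hFG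
      · rw [coeff_toC]; exact_mod_cast h10
    refine ⟨h1 + h2 * ((1 - hFf)⁻¹ * h3), ?_, ?_⟩
    · exact m1.add (m2.mul ((((MeromorphicOn.const (1:ℂ)).sub hFm).inv).mul m3))
    · have : ser (fun n => P A u' n i j) = ser (fun n => P A u n i j) +
        ser (fun n => P A u n i a) * ((1 - F)⁻¹ * ser (fun n => P A u n a j)) := by
        rw [hrec i j, ← hsolve (hrec a j)]
      rw [this]
      have e : ∀ x y z w : PowerSeries ℝ, toC (x + y * (z * w)) = toC x + toC y * (toC z * toC w) := by
        intro x y z w; simp [toC]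
      rw [e]
      exact g1.add (g2.mul (gi.mul g3))
  · intro k hk
    rcases List.mem_append.1 hk with h | h
    · exact hL k h
    · exact hL' k h
  · rw [hND, hN, hD', List.map_append, List.sum_append]; ring
  · intro hnil
    obtain ⟨e1, e2⟩ := List.append_eq_nil_iff.1 hnil
    have hS1 := hS e1
    have hI := hinv e2
    have ftr : ∀ n, ∑' j, P A u n a j ≠ ⊤ := fun n => ne_top_of_le_ne_top (ftS n) (row_le_SS A u n a)
    have ftr' : ∀ n, ∑' j, P A u' n a j ≠ ⊤ := fun n =>
      ne_top_of_le_ne_top (ftS' n) (row_le_SS A u' n a)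
    have r1 : ser (fun n => ∑' j, P A u' n a j) = ser (fun n => ∑' j, P A u n a j) +
        F * ser (fun n => ∑' j, P A u' n a j) := ser_eq ftr' fun n => row_eq A u u' a hu n
    have r2 := hsolve r1
    have s1 : ser (SS A u') = ser (SS A u) + ser (fun n => ∑' i, P A u n i a) *
        ser (fun n => ∑' j, P A u' n a j) := ser_eq ftS' fun n => SS_eq A u u' a hu n
    rw [s1, r2]
    exact good_add hS1 (good_mul (good_ser_mono ftS (fun n => col_le_SS A u n a) hS1)
      (good_mul hI (good_ser_mono ftS (fun n => row_le_SS A u n a) hS1)))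

lemma base (A : E → E → ℝ≥0∞) (hM : ∑' i, ∑' j, A i j ≠ ⊤) (u : E → ℝ≥0∞)
    (h01 : ∀ k, u k = 0 ∨ u k = 1)
    (hc : ∀ k, u k = 1 → ∑' l, A k l * u l ≤ 1/4) : Claim A u := by
  have ftS := SS_ne_top A h01 hM
  set M := ∑' i, ∑' j, A i j with hMdef
  have hsum : Summable fun n => (SS A u n).toReal * 2 ^ n := by
    rw [← summable_nat_add_iff 2]
    have hq : Summable fun n : ℕ => (M * M).toReal * 4 * (1/2:ℝ) ^ n :=
      (summable_geometric_of_lt_one (by norm_num) (by norm_num)).mul_left _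
    refine hq.of_nonneg_of_le (fun n => by positivity) fun n => ?_
    have h1 := SS_bound A h01 hMdef.ge hc n
    have h2 : (SS A u (n+2)).toReal ≤ (M * M).toReal * (1/4:ℝ) ^ n := by
      refine (ENNReal.toReal_mono ?_ h1).trans_eq ?_
      · exact ENNReal.mul_ne_top (ENNReal.mul_ne_top hM hM) (ENNReal.pow_ne_top (by simp))
      · rw [ENNReal.toReal_mul, ENNReal.toReal_pow]; simp
    calc (SS A u (n+2)).toReal * 2 ^ (n+2) ≤ ((M * M).toReal * (1/4:ℝ) ^ n) * 2 ^ (n+2) := by gcongr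
      _ = (M * M).toReal * 4 * ((1/4:ℝ) ^ n * 2 ^ n) := by ring
      _ = _ := by rw [← mul_pow]; norm_num
  have hSg : Good (ser (SS A u)) := ⟨2, by norm_num, by
    simpa [coeff_ser] using hsum⟩
  refine ⟨fun i j => ?_, [], by simp, ser (NN A u), 
    good_ser_mono ftS (NN_le_SS A h01) hSg, by simp, fun _ => hSg⟩
  have hs2 : Summable fun n => ‖coeff n (toC (ser fun n => P A u n i j))‖ * 2 ^ n := by
    refine hsum.of_nonneg_of_le (fun n => by positivity) fun n => ?_
    rw [coeff_toC, coeff_ser, Complex.norm_real, Real.norm_of_nonneg ENNReal.toReal_nonneg]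
    gcongr
    · exact ftS n
    · exact P_le_SS A u n i j
  obtain ⟨h, hd, hG, -⟩ := exists_fun (by norm_num) hs2
  exact ⟨h, (hd.analyticOnNhd Metric.isOpen_ball).meromorphicOn, hG⟩

lemma core (A : E → E → ℝ≥0∞) (hM : ∑' i, ∑' j, A i j ≠ ⊤)
    (H : ∀ a, ∀ x : ℝ, 0 ≤ x → x < 1 → Summable fun n => (P A 1 n a a).toReal * x ^ n) :
    Claim A 1 := by
  classical
  have hM' : ∑' q : E × E, A q.1 q.2 ≠ ⊤ := by rwa [ENNReal.tsum_prod']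
  have ft1 := SS_ne_top A (u := 1) (fun _ => Or.inr rfl) hM
  -- finite set
  have hT := ENNReal.tendsto_tsum_compl_atTop_zero hM'
  obtain ⟨Q, hQ⟩ := (hT.eventually (gt_mem_nhds (show (0:ℝ≥0∞) < 1/4 by simp))).exists
  let S : Finset E := Q.image Prod.fst
  let U : Finset E → E → ℝ≥0∞ := fun S e => if e ∈ S then 0 else 1
  have h01 : ∀ S k, U S k = 0 ∨ U S k = 1 := by
    intro S k; simp only [U]; split_ifs <;> simp
  have hbase : Claim A (U S) := by
    refine base A hM _ (h01 S) fun k hk => ?_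
    have hkS : k ∉ S := by
      intro h; simp [U, h] at hk
    refine le_trans ?_ hQ.le
    have hinj : Function.Injective (fun l : E => (⟨(k, l), fun h => hkS
      (Finset.mem_image.2 ⟨_, h, rfl⟩)⟩ : {q : E × E // q ∉ Q})) := by
      intro l l' h
      simpa using h
    refine le_trans (ENNReal.tsum_le_tsum fun l => ?_)
      (ENNReal.tsum_comp_le_tsum_of_injective hinj (fun q => A q.1.1 q.1.2))
    rcases h01 S l with h | h <;> simp [h]
  have hind : ∀ S : Finset E, Claim A (U S) → Claim A (U ∅) := by
    intro S
    induction S using Finset.induction_on with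
    | empty => exact id
    | insert a S ha ih =>
      intro hc
      apply ih
      refine step A hM (U (insert a S)) (U S) a (h01 _) (h01 _) ?_ ?_ hc
      · intro k
        by_cases hk : k = a
        · subst hk; simp [U, ha]
        · simp [U, hk]
      · intro x hx0 hx1
        refine (H a x hx0 hx1).of_nonneg_of_le (fun n => by positivity) fun n => ?_
        gcongr
        · exact ne_top_of_le_ne_top (ft1 n) (P_le_SS A 1 n a a)
        · exact P_mono A (fun k => by rcases h01 S k with h | h <;> simp [h]) n a a
  have := hind S hbase
  have e : U ∅ = 1 := by funext k; simp [U]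
  rwa [e] at this

end BassAux

namespace BassAux
open PowerSeries Filter Topology
open scoped ENNReal
variable {E : Type*}

section Gelf
variable {B : Type*} [NormedRing B] [NormedAlgebra ℂ B] [CompleteSpace B]

lemma ev_pow_le (T : B) {r ρ : ℝ} (h : spectralRadius ℂ T = ENNReal.ofReal r)
    (hr : 0 < r) (hρ : r < ρ) : ∀ᶠ n in atTop, ‖T ^ n‖ ≤ ρ ^ n := by
  have h1 := spectrum.pow_norm_pow_one_div_tendsto_nhds_spectralRadius T
  rw [h] at h1
  have h2 := h1.eventually (gt_mem_nhds ((ENNReal.ofReal_lt_ofReal_iff (hr.trans hρ)).2 hρ))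
  filter_upwards [h2, eventually_gt_atTop 0] with n hn hn0
  have := (ENNReal.ofReal_lt_ofReal_iff (hr.trans hρ)).1 hn
  have h3 := pow_le_pow_left₀ (by positivity) this.le n
  rwa [← Real.rpow_natCast, ← Real.rpow_mul (norm_nonneg _), one_div,
    inv_mul_cancel₀ (by positivity), Real.rpow_one] at h3

lemma radius_le (T : B) {r ρ q C : ℝ} (h : spectralRadius ℂ T = ENNReal.ofReal r)
    (hr : 0 < r) (hq : 0 ≤ q) (hρ : q < ρ) (hT : ∀ n, 1 ≤ n → ‖T ^ n‖ ≤ C * q ^ n) : r ≤ ρ := by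
  have hρ0 : 0 < ρ := hq.trans_lt hρ
  have h1 := spectrum.pow_norm_pow_one_div_tendsto_nhds_spectralRadius T
  rw [h] at h1
  have h2 : Tendsto (fun n : ℕ => C * (q / ρ) ^ n) atTop (𝓝 (C * 0)) :=
    (tendsto_pow_atTop_nhds_zero_of_lt_one (by positivity) ((div_lt_one hρ0).2 hρ)).const_mul C
  rw [mul_zero] at h2
  rw [← ENNReal.ofReal_le_ofReal_iff hρ0.le]
  refine le_of_tendsto h1 ?_
  filter_upwards [h2.eventually (gt_mem_nhds one_pos), eventually_gt_atTop 0] with n hn hn0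
  refine ENNReal.ofReal_le_ofReal ?_
  have h3 : ‖T ^ n‖ ≤ ρ ^ n := by
    refine (hT n hn0).trans ?_
    rw [div_pow, mul_div_assoc', div_lt_one (by positivity)] at hn
    exact hn.le
  rw [one_div]
  refine (Real.rpow_le_rpow (norm_nonneg _) h3 (by positivity)).trans ?_
  rw [Real.pow_rpow_inv_natCast hρ0.le hn0.ne']
end Gelf

section Op
variable [DecidableEq E] {w : E → E → ℝ} {T : lp (fun _ : E => ℂ) 2 →L[ℂ] lp (fun _ : E => ℂ) 2}

/-- kernel -/
noncomputable def ker (w : E → E → ℝ) : E → E → ℝ≥0∞ := fun e f => ENNReal.ofReal (w e f)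

lemma ker_fin (hw : ∀ e f, 0 ≤ w e f) (hs : Summable fun q : E × E => w q.1 q.2) :
    ∑' i, ∑' j, ker w i j ≠ ⊤ := by
  rw [← ENNReal.tsum_prod (f := fun i j => ker w i j)]
  exact hs.tsum_ofReal_ne_top

lemma P_fin (hw : ∀ e f, 0 ≤ w e f) (hs : Summable fun q : E × E => w q.1 q.2) (n : ℕ) (i j : E) :
    P (ker w) 1 n i j ≠ ⊤ :=
  ne_top_of_le_ne_top (SS_ne_top (ker w) (fun _ => Or.inr rfl) (ker_fin hw hs) n) (P_le_SS _ _ _ _ _)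

lemma op_coord (hw : ∀ e f, 0 ≤ w e f) (hs : Summable fun q : E × E => w q.1 q.2)
    (hT : PGT.IsBassOperator w T) (n : ℕ) (i j : E) :
    (T ^ (n+1)) (lp.single 2 i 1) j = ((P (ker w) 1 (n+1) i j).toReal : ℂ) := by
  have key : ∀ n i, HasSum (fun f => (w i f : ℂ) * (T ^ n) (lp.single 2 f 1) j)
      ((T ^ (n+1)) (lp.single 2 i 1) j) := by
    intro n i
    have := (hT i).mapL ((lp.evalCLM ℂ (fun _ : E => ℂ) 2 j).comp (T ^ n))
    refine (this.congr_fun fun f => ?_)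
    rw [map_smul]
    rfl
  induction n generalizing i with
  | zero =>
    have := key 0 i
    rw [zero_add, P_one, ker, ENNReal.toReal_ofReal (hw _ _), pow_one]
    rw [zero_add, pow_one] at this
    refine this.unique ?_
    convert hasSum_ite_eq j (w i j : ℂ) using 2 with f
    by_cases h : f = j
    · subst h; simp
    · simp [h, lp.single_apply, Pi.single_apply, Ne.symm h]
  | succ n ih =>
    have h1 := key (n+1) i
    simp only [ih] at h1
    rw [← h1.tsum_eq, P_succ_succ, ENNReal.tsum_toReal_eq, Complex.ofReal_tsum]
    · refine tsum_congr fun f => ?_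
      simp [ker, ENNReal.toReal_ofReal (hw _ _)]
    · intro f
      simpa using ENNReal.mul_ne_top (by simp [ker]) (P_fin hw hs _ _ _)

lemma op_entry (hw : ∀ e f, 0 ≤ w e f) (hs : Summable fun q : E × E => w q.1 q.2)
    (hT : PGT.IsBassOperator w T) (n : ℕ) (i j : E) :
    (P (ker w) 1 n i j).toReal ≤ ‖T ^ n‖ := by
  cases n with
  | zero => simp [P_zero]
  | succ n =>
    have h1 := lp.norm_apply_le_norm (p := 2) (by simp) ((T ^ (n+1)) (lp.single 2 i 1)) j
    rw [op_coord hw hs hT, Complex.norm_real, Real.norm_of_nonneg ENNReal.toReal_nonneg] at h1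
    refine h1.trans (((T ^ (n+1)).le_opNorm _).trans ?_)
    rw [lp.norm_single (by simp)]; simp

lemma enorm_le_coord (v : lp (fun _ : E => ℂ) 2) : ‖v‖ₑ ≤ ∑' j, ‖v j‖ₑ := by
  have h := (lp.hasSum_single (p := 2) (by simp) v).tsum_eq
  conv_lhs => rw [← h]
  refine enorm_tsum_le_tsum_enorm.trans (ENNReal.tsum_le_tsum fun j => ?_)
  rw [← ofReal_norm, lp.norm_single (by simp), ofReal_norm]

lemma op_norm (hw : ∀ e f, 0 ≤ w e f) (hs : Summable fun q : E × E => w q.1 q.2)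
    (hT : PGT.IsBassOperator w T) (n : ℕ) (hn : 1 ≤ n) :
    ‖T ^ n‖ ≤ (SS (ker w) 1 n).toReal := by
  obtain ⟨n, rfl⟩ : ∃ k, n = k + 1 := ⟨n - 1, by omega⟩
  refine ContinuousLinearMap.opNorm_le_bound _ ENNReal.toReal_nonneg fun v => ?_
  have fin := SS_ne_top (ker w) (u := 1) (fun _ => Or.inr rfl) (ker_fin hw hs) (n+1)
  have h := ((lp.hasSum_single (p := 2) (by simp) v).mapL (T ^ (n+1))).tsum_eq
  have h2 : ‖(T ^ (n+1)) v‖ₑ ≤ SS (ker w) 1 (n+1) * ‖v‖ₑ := by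
    rw [← h, SS, ← ENNReal.tsum_mul_right]
    refine enorm_tsum_le_tsum_enorm.trans (ENNReal.tsum_le_tsum fun i => ?_)
    have e : lp.single 2 i (v i) = (v i) • lp.single (E := fun _ : E => ℂ) 2 i (1:ℂ) := by
      rw [← lp.single_smul]; simp
    rw [e, map_smul, enorm_smul, mul_comm]
    gcongr
    · refine (enorm_le_coord _).trans (ENNReal.tsum_le_tsum fun j => ?_)
      rw [op_coord hw hs hT, ← ofReal_norm, Complex.norm_real,
        Real.norm_of_nonneg ENNReal.toReal_nonneg, ENNReal.ofReal_toReal (P_fin hw hs _ _ _)]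
    · rw [← ofReal_norm, ← ofReal_norm]
      exact ENNReal.ofReal_le_ofReal (lp.norm_apply_le_norm (by simp) v i)
  have h3 := ENNReal.toReal_mono (ENNReal.mul_ne_top fin (by simp)) h2
  rwa [ENNReal.toReal_mul, toReal_enorm, toReal_enorm] at h3
end Op

lemma path_sum (A : E → E → ℝ≥0∞) (n : ℕ) (i j : E) :
    ∑' q : Fin n → E, ∏ k : Fin (n+1), A (Fin.cons (α := fun _ => E) i q k)
      (Fin.snoc (α := fun _ => E) q j k) = P A 1 (n+1) i j := by
  induction n generalizing i with
  | zero => simp [P_one, Fin.snoc]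
  | succ n ih =>
    rw [P_succ_succ, ← (Fin.consEquiv (fun _ : Fin (n+1) => E)).tsum_eq, ENNReal.tsum_prod']
    refine tsum_congr fun f => ?_
    rw [Pi.one_apply, one_mul, ← ih, ← ENNReal.tsum_mul_left]
    refine tsum_congr fun q => ?_
    rw [Fin.prod_univ_succ]
    simp only [Fin.consEquiv_apply, Fin.cons_zero, Fin.cons_succ]
    have e : (Fin.consEquiv fun _ : Fin (n+1) => E) (f, q) = Fin.cons (α := fun _ => E) f q := rfl
    have e2 := Fin.cons_snoc_eq_snoc_cons (β := E) f q j
    rw [e, ← e2]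
    simp

lemma N_eq {V : Type*} (s t : E → V) {w : E → E → ℝ} (hw : ∀ e f, 0 ≤ w e f)
    (hadj : ∀ e f, w e f ≠ 0 → t e = s f) (m : ℕ) (hm : 1 ≤ m) :
    ∑' p : {p : Fin m → E // PGT.IsClosedPath s t p}, PGT.pathWeight w p.1 =
      (NN (ker w) 1 m).toReal := by
  obtain ⟨n, rfl⟩ : ∃ k, m = k + 1 := ⟨m - 1, by omega⟩
  have h1 := tsum_subtype_eq_of_support_subset (f := fun p : Fin (n+1) → E => PGT.pathWeight w p)
    (s := {p | PGT.IsClosedPath s t p}) (by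
      intro p hp i
      exact hadj _ _ fun h => hp (Finset.prod_eq_zero (Finset.mem_univ i) h))
  refine h1.trans ?_
  have h2 : NN (ker w) 1 (n+1) = ∑' p : Fin (n+1) → E, ENNReal.ofReal (PGT.pathWeight w p) := by
    rw [NN, ← (Fin.consEquiv (fun _ : Fin (n+1) => E)).tsum_eq, ENNReal.tsum_prod']
    refine tsum_congr fun e => ?_
    rw [Pi.one_apply, one_mul, ← path_sum]
    refine tsum_congr fun q => ?_
    rw [PGT.pathWeight, ENNReal.ofReal_prod_of_nonneg (fun _ _ => hw _ _)]
    refine Finset.prod_congr rfl fun k _ => ?_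
    simp only [Fin.consEquiv_apply, ker]
    congr 2
    refine Fin.lastCases ?_ (fun k => ?_) k
    · have : PGT.cyc (Fin.last n) 1 = 0 := by ext; simp [PGT.cyc]
      rw [this]; simp
    · have : PGT.cyc k.castSucc 1 = k.succ := by
        ext; simp [PGT.cyc]
      rw [this]; simp
  rw [h2, ENNReal.tsum_toReal_eq (by simp)]
  refine tsum_congr fun p => ?_
  rw [ENNReal.toReal_ofReal]
  exact Finset.prod_nonneg fun _ _ => hw _ _

end BassAux

open PGT in
/-- Let `T` be the Bass operator of a weighted oriented graph with
positive spectral radius `r`, and for `m ≥ 1` let `N m = ∑_p w(p)`, the sum over all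
closed paths of length `m`. Then there are `s ≥ 1`, positive integers `n₁, …, n_s`,
`ε ∈ (0, r)` and `C > 0` with
`|N m - r^m ∑_k n_k 1_{n_k ∣ m}| ≤ C (r - ε)^m` for all `m ≥ 1`. -/
theorem stmt9 {V E : Type*} [DecidableEq E] (s t : E → V) (w : E → E → ℝ)
    (hw_nonneg : ∀ e f, 0 ≤ w e f)
    (hw_adj : ∀ e f, w e f ≠ 0 → t e = s f)
    (hw_sum : Summable fun q : E × E => w q.1 q.2)
    (T : lp (fun _ : E => ℂ) 2 →L[ℂ] lp (fun _ : E => ℂ) 2)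
    (hT : IsBassOperator w T)
    (r : ℝ) (hr : 0 < r) (hrad : spectralRadius ℂ T = ENNReal.ofReal r)
    (N : ℕ → ℝ)
    (hN : ∀ m : ℕ, N m =
      ∑' p : {p : Fin m → E // IsClosedPath s t p}, pathWeight w p.1) :
    ∃ (s' : ℕ) (nn : Fin s' → ℕ) (ε C : ℝ),
      1 ≤ s' ∧ (∀ k, 0 < nn k) ∧ 0 < ε ∧ ε < r ∧ 0 < C ∧
      ∀ m : ℕ, 1 ≤ m →
        |N m - r ^ m * ∑ k : Fin s', (if nn k ∣ m then (nn k : ℝ) else 0)|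
          ≤ C * (r - ε) ^ m := by
  set c : ENNReal := ENNReal.ofReal (1 / r) with hc
  have hcr : c.toReal = 1 / r := ENNReal.toReal_ofReal (by positivity)
  set A : E → E → ENNReal := fun i j => c * BassAux.ker w i j with hA
  have hP : ∀ n i j, BassAux.P A 1 n i j = c ^ n * BassAux.P (BassAux.ker w) 1 n i j :=
    fun n i j => BassAux.P_scale _ _ _ _ _ _
  have hNN : ∀ n, BassAux.NN A 1 n = c ^ n * BassAux.NN (BassAux.ker w) 1 n := fun n => by
    simp only [BassAux.NN, hP, Pi.one_apply, one_mul, ENNReal.tsum_mul_left]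
  have hSS : ∀ n, BassAux.SS A 1 n = c ^ n * BassAux.SS (BassAux.ker w) 1 n := fun n => by
    simp only [BassAux.SS, hP, ENNReal.tsum_mul_left]
  have hfin : ∑' i, ∑' j, A i j ≠ ⊤ := by
    simp only [hA, ENNReal.tsum_mul_left]
    exact ENNReal.mul_ne_top (by simp [hc]) (BassAux.ker_fin hw_nonneg hw_sum)
  obtain ⟨-, L, hL, g, hg, hLg, hLn⟩ := BassAux.core A hfin (by
    intro a x hx0 hx1
    have h1 := BassAux.ev_pow_le T (ρ := r * (2 / (1 + x))) hrad hr (by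
      have : 1 < 2 / (1 + x) := by rw [lt_div_iff₀ (by positivity)]; linarith
      nlinarith)
    have h0 : 2 * x / (1 + x) < 1 := by rw [div_lt_one (by positivity)]; linarith
    refine Summable.of_norm_bounded_eventually_nat
      (summable_geometric_of_lt_one (r := 2 * x / (1 + x)) (by positivity) h0) ?_
    filter_upwards [h1] with n hn
    have h2 := (BassAux.op_entry hw_nonneg hw_sum hT n a a).trans hn
    rw [Real.norm_of_nonneg (by positivity), hP, ENNReal.toReal_mul, ENNReal.toReal_pow, hcr]
    calc _ ≤ (1 / r) ^ n * (r * (2 / (1 + x))) ^ n * x ^ n := by gcongr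
      _ = _ := by
        rw [← mul_pow, ← mul_pow]; congr 1; field_simp)
  have hL0 : L ≠ [] := by
    intro h
    obtain ⟨y, hy, C, hC⟩ := (BassAux.good_iff _).1 (hLn h)
    have hy0 : 0 < y := by linarith
    have hlt : r / y < r := div_lt_self hr hy
    obtain ⟨ρ, h1, h2⟩ := exists_between hlt
    refine absurd (BassAux.radius_le T (C := C) hrad hr (by positivity) h1 fun n hn => ?_)
      (not_le.2 h2)
    refine (BassAux.op_norm hw_nonneg hw_sum hT n hn).trans ?_
    have h3 := hC n
    rw [BassAux.coeff_ser, hSS, ENNReal.toReal_mul, ENNReal.toReal_pow, hcr,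
      Real.norm_of_nonneg (by positivity)] at h3
    rw [div_pow, mul_div_assoc', le_div_iff₀ (by positivity)]
    have h4 : r ^ n * ((1 / r) ^ n * (BassAux.SS (BassAux.ker w) 1 n).toReal * y ^ n) ≤ r ^ n * C := by
      gcongr
    rw [← mul_assoc, ← mul_assoc, ← mul_pow, mul_one_div_cancel hr.ne', one_pow, one_mul] at h4
    linarith
  obtain ⟨y, hy, C, hC⟩ := (BassAux.good_iff _).1 hg
  have hy0 : 0 < y := by linarith
  have hlt : r / y < r := div_lt_self hr hy
  have hpos : 0 < r / y := by positivity
  refine ⟨L.length, L.get, r - r / y, |C| + 1, ?_, fun k => hL _ (List.get_mem _ _), by linarith,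
    by linarith, by positivity, fun m hm => ?_⟩
  · exact List.length_pos_iff.2 hL0
  have h1 : PowerSeries.coeff m (BassAux.ser (BassAux.NN A 1)) = (1 / r) ^ m * N m := by
    rw [BassAux.coeff_ser, hNN, ENNReal.toReal_mul, ENNReal.toReal_pow, hcr, hN,
      BassAux.N_eq s t hw_nonneg hw_adj m hm]
  have h2 : PowerSeries.coeff m (L.map BassAux.Z).sum =
      ∑ k : Fin L.length, (if L.get k ∣ m then (L.get k : ℝ) else 0) := by
    rw [map_list_sum, List.map_map, ← List.sum_ofFn]
    congr 1
    conv_lhs => rw [← List.ofFn_get L, List.map_ofFn]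
    congr 1
    funext k
    simp [BassAux.coeff_Z hm]
  rw [hLg, map_add, h2] at h1
  have h3 : N m = r ^ m * (∑ k : Fin L.length, (if L.get k ∣ m then (L.get k : ℝ) else 0)
      + PowerSeries.coeff m g) := by
    rw [h1, ← mul_assoc, ← mul_pow, mul_one_div_cancel hr.ne', one_pow, one_mul]
  rw [h3, mul_add, add_sub_cancel_left, abs_mul, abs_of_pos (by positivity), sub_sub_cancel,
    div_pow, mul_div_assoc', le_div_iff₀ (by positivity)]
  have h4 := hC m
  rw [Real.norm_eq_abs] at h4
  calc _ = r ^ m * (|PowerSeries.coeff m g| * y ^ m) := by ring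
    _ ≤ r ^ m * C := by gcongr
    _ ≤ r ^ m * (|C| + 1) := by gcongr; linarith [le_abs_self C]
    _ = _ := by ring
end

section
/- Let r > 1, ε ∈ (0, r), s ≥ 1, let n₁, …, n_s be positive integers with least common multiple K, and let C₀ > 0. Suppose (a_m)_{m≥1} is a sequence of real numbers satisfying | a_m − r^m ∑_{k=1}^s n_k·1_{n_k ∣ m} | ≤ C₀ (r − ε)^m for all m ≥ 1. Then lim_{n→∞} r^{−nK} ∑_{m=1}^{nK} a_m = ∑_{k=1}^s n_k r^{n_k}/(r^{n_k} − 1). -/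
open Filter

theorem aux_main (r : ℝ) (d : ℕ) (N : ℕ) :
    (∑ m ∈ Finset.Icc 1 N, (if d ∣ m then r ^ m else 0)) * (r ^ d - 1)
      = r ^ d * (r ^ (d * (N / d)) - 1) := by
  induction N with
  | zero => simp
  | succ N ih =>
    rw [Finset.sum_Icc_succ_top (by omega), add_mul, ih, Nat.succ_div]
    split_ifs with h
    · have h2 : N + 1 = d * (N / d) + d := by
        have h3 := Nat.succ_div (a := N) (b := d)
        rw [if_pos h] at h3
        have h4 := Nat.mul_div_cancel' h
        rw [h3] at h4
        rw [← h4]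
        ring
      rw [mul_add, mul_one, h2, pow_add]
      ring
    · simp

theorem aux_err (e : ℕ → ℝ) (C x r : ℝ) (hr : 1 < r) (hx : 0 < x) (hxr : x < r) (hC : 0 < C)
    (he : ∀ m : ℕ, 1 ≤ m → |e m| ≤ C * x ^ m) :
    Tendsto (fun N : ℕ => (∑ m ∈ Finset.Icc 1 N, e m) / r ^ N) atTop (nhds 0) := by
  obtain ⟨y, hy1, hyr⟩ := exists_between (max_lt hr hxr)
  have h1y : 1 < y := lt_of_le_of_lt (le_max_left _ _) hy1
  have hxy : x < y := lt_of_le_of_lt (le_max_right _ _) hy1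
  have hy0 : 0 < y - 1 := by linarith
  obtain ⟨D, hD⟩ : ∃ D, D = C * y / (y - 1) := ⟨_, rfl⟩
  have hD0 : 0 ≤ D := by rw [hD]; positivity
  have hDy : D * (y - 1) = C * y := by rw [hD]; field_simp
  have key : ∀ N : ℕ, |∑ m ∈ Finset.Icc 1 N, e m| ≤ D * y ^ N := by
    intro N
    induction N with
    | zero => simpa using hD0
    | succ N ih =>
      rw [Finset.sum_Icc_succ_top (by omega)]
      have h1 := he (N + 1) (by omega)
      have h2 : C * x ^ (N + 1) ≤ C * y ^ (N + 1) := by gcongr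
      have h3 : D * y ^ (N + 1) = D * y ^ N + C * y ^ (N + 1) := by
        rw [pow_succ]
        linear_combination y ^ N * hDy
      have h4 := abs_add_le (∑ m ∈ Finset.Icc 1 N, e m) (e (N + 1))
      linarith
  have hlim : Tendsto (fun N : ℕ => D * (y / r) ^ N) atTop (nhds 0) := by
    have := (tendsto_pow_atTop_nhds_zero_of_lt_one (r := y / r) (by positivity)
      ((div_lt_one (by linarith)).2 hyr)).const_mul D
    simpa using this
  refine squeeze_zero_norm (fun N => ?_) hlim
  have hrN : 0 < r ^ N := by positivity
  rw [Real.norm_eq_abs, abs_div, abs_of_pos hrN, div_pow, ← mul_div_assoc]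
  gcongr
  exact key N

/-- Let `r > 1`, `ε ∈ (0,r)`, positive integers `n₁, …, n_s` with
least common multiple `K`, and `C₀ > 0`. If a real sequence `(a_m)` satisfies
`|a_m - r^m ∑_k n_k 1_{n_k ∣ m}| ≤ C₀ (r-ε)^m` for all `m ≥ 1`, then
`r^{-nK} ∑_{m=1}^{nK} a_m → ∑_k n_k r^{n_k}/(r^{n_k} - 1)` as `n → ∞`. -/
theorem stmt10 (r : ℝ) (hr : 1 < r) (ε : ℝ) (hε : 0 < ε) (hεr : ε < r)
    (s : ℕ) (hs : 1 ≤ s) (nn : Fin s → ℕ) (hnn : ∀ k, 0 < nn k)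
    (K : ℕ) (hK : K = Finset.univ.lcm nn)
    (C₀ : ℝ) (hC₀ : 0 < C₀) (a : ℕ → ℝ)
    (ha : ∀ m : ℕ, 1 ≤ m →
      |a m - r ^ m * ∑ k : Fin s, (if nn k ∣ m then (nn k : ℝ) else 0)|
        ≤ C₀ * (r - ε) ^ m) :
    Tendsto (fun n : ℕ => (∑ m ∈ Finset.Icc 1 (n * K), a m) / r ^ (n * K))
      atTop (nhds (∑ k : Fin s, (nn k : ℝ) * r ^ (nn k) / (r ^ (nn k) - 1))) := by
  have hKpos : 0 < K := by
    rw [hK, Nat.pos_iff_ne_zero, Ne, Finset.lcm_eq_zero_iff]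
    rintro ⟨k, _, hk⟩
    exact (hnn k).ne' hk
  have hdvd : ∀ k, nn k ∣ K := fun k => hK ▸ Finset.dvd_lcm (Finset.mem_univ k)
  have hr0 : 0 < r := by linarith
  have hN : Tendsto (fun n : ℕ => n * K) atTop atTop :=
    tendsto_id.atTop_mul_const' hKpos
  have herr := (aux_err _ C₀ (r - ε) r hr (by linarith) (by linarith) hC₀ ha).comp hN
  have hinv : Tendsto (fun n : ℕ => 1 - (1 / r) ^ (n * K)) atTop (nhds 1) := by
    have := ((tendsto_pow_atTop_nhds_zero_of_lt_one (r := 1 / r) (by positivity)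
      ((div_lt_one hr0).2 hr)).comp hN).const_sub 1
    simpa using this
  have hmain := tendsto_finsetSum Finset.univ (fun (k : Fin s) _ =>
    hinv.const_mul ((nn k : ℝ) * r ^ (nn k) / (r ^ (nn k) - 1)))
  have := herr.add hmain
  simp only [mul_one, zero_add] at this
  refine this.congr (fun n => ?_)
  simp only [Function.comp_apply]
  have hrn : r ^ (n * K) ≠ 0 := by positivity
  rw [Finset.sum_sub_distrib, sub_div, sub_add, sub_eq_self, sub_eq_zero]
  simp_rw [Finset.mul_sum]
  rw [Finset.sum_comm, Finset.sum_div]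
  refine Finset.sum_congr rfl (fun k _ => ?_)
  have h1 := aux_main r (nn k) (n * K)
  rw [Nat.mul_div_cancel' ((hdvd k).mul_left n)] at h1
  have hd : r ^ (nn k) - 1 ≠ 0 := by
    have := one_lt_pow₀ hr (hnn k).ne'
    linarith
  have h2 : ∑ m ∈ Finset.Icc 1 (n * K), r ^ m * (if nn k ∣ m then (nn k : ℝ) else 0)
      = (nn k : ℝ) * ∑ m ∈ Finset.Icc 1 (n * K), (if nn k ∣ m then r ^ m else 0) := by
    rw [Finset.mul_sum]
    refine Finset.sum_congr rfl (fun m _ => ?_)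
    split_ifs <;> ring
  rw [h2, eq_div_of_mul_eq hd h1, one_div, inv_pow]
  field_simp
end

section
/- Let X be an oriented graph with edge set E, let w be a transition weight on X with w(p) ≤ 1 for every closed path p, and let T be the Bass operator on ℓ²(E); assume its spectral radius r = r(T) satisfies r > 1. Let n₁, …, n_s, ε, C be as in the asymptotic expansion N_m = r^m ∑_{k=1}^s n_k·1_{n_k ∣ m} + O((r−ε)^m), let K be the least common multiple of n₁,…,n_s, and set C = ∑_{k=1}^s n_k r^{n_k}/(r^{n_k} − 1). Define θ(n) = ∑_{c₀ primitive, ℓ(c₀) ≤ n} w(c₀) ℓ(c₀), ψ(n) = ∑_{c : ℓ(c) ≤ n} w(c) ℓ(c₀(c)) (sum over all cycles c of length at most n, c₀(c) the underlying primitive cycle of c), and π(n) = ∑_{c₀ primitive, ℓ(c₀) ≤ n} w(c₀). Then, as n → ∞, θ(nK) ∼ C r^{nK}, ψ(nK) ∼ C r^{nK}, and π(nK) ∼ C r^{nK}/(nK). -/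
namespace PGT

variable {V E : Type*}

/-- The type of closed paths (of arbitrary positive length) of the graph. -/
def ClosedPath (s t : E → V) : Type _ :=
  {c : Σ n : ℕ, Fin n → E // 0 < c.1 ∧ IsClosedPath s t c.2}

/-- A closed path is primitive if it is not a nontrivial power of a shorter closed
path, i.e. it has no period `d` with `0 < d < n`. -/
def IsPrimitivePath {n : ℕ} (p : Fin n → E) : Prop :=
  ¬ ∃ d : ℕ, 0 < d ∧ d < n ∧ ∀ i : Fin n, p (cyc i d) = p i

/-- Two closed paths are related if one is a cyclic rotation of the other. -/
def RotRel (s t : E → V) (c d : ClosedPath s t) : Prop :=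
  ∃ h : c.1.1 = d.1.1, ∃ r : ℕ, ∀ i : Fin c.1.1,
    d.1.2 (Fin.cast h (cyc i r)) = c.1.2 i

/-- A cycle is an equivalence class of closed paths under cyclic rotation. -/
def Cycle (s t : E → V) : Type _ := Quot (RotRel s t)

/-- The length of a cycle. -/
noncomputable def Cycle.len {s t : E → V} (c : Cycle s t) : ℕ :=
  (Quot.out c).1.1

/-- The weight of a cycle. -/
noncomputable def Cycle.weight (w : E → E → ℝ) {s t : E → V} (c : Cycle s t) : ℝ :=
  pathWeight w (Quot.out c).1.2

/-- A cycle is primitive if its representing closed paths are primitive. -/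
noncomputable def Cycle.IsPrimitive {s t : E → V} (c : Cycle s t) : Prop :=
  IsPrimitivePath (Quot.out c).1.2

/-- The length `ℓ(c₀)` of the primitive cycle underlying `c`, i.e. the smallest
positive period of a representing closed path. -/
noncomputable def Cycle.primLen {s t : E → V} (c : Cycle s t) : ℕ :=
  sInf {d : ℕ | 0 < d ∧ ∀ i : Fin (Quot.out c).1.1,
    (Quot.out c).1.2 (cyc i d) = (Quot.out c).1.2 i}

end PGT

section analytic
open Filter Finset

lemma pgt_geom (r : ℝ) (hr : 1 < r) (a j : ℕ) (ha : 0 < a) :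
    ∑ m ∈ Icc 1 (a * j), (if a ∣ m then r ^ m else 0) =
      r ^ a * (r ^ (a * j) - 1) / (r ^ a - 1) := by
  have h1 : r ^ a - 1 ≠ 0 := by
    have := one_lt_pow₀ hr ha.ne'
    linarith
  have h2 : ∑ m ∈ Icc 1 (a * j), (if a ∣ m then r ^ m else 0) =
      ∑ i ∈ range j, r ^ (a * (i + 1)) := by
    rw [← Finset.sum_filter]
    symm
    refine Finset.sum_bij (fun i _ => a * (i + 1)) ?_ ?_ ?_ ?_
    · intro i hi
      simp only [mem_filter, mem_Icc, dvd_mul_right, and_true]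
      simp only [mem_range] at hi
      exact ⟨Nat.mul_pos ha (by omega), Nat.mul_le_mul_left _ (by omega)⟩
    · intro i _ i' _ h
      have := Nat.eq_of_mul_eq_mul_left ha h
      omega
    · intro b hb
      simp only [mem_filter, mem_Icc] at hb
      obtain ⟨⟨h1, h2⟩, c, rfl⟩ := hb
      have hc : c ≤ j := Nat.le_of_mul_le_mul_left h2 ha
      have hc0 : 0 < c := Nat.pos_of_mul_pos_left h1
      exact ⟨c - 1, by simp; omega, by congr 1; omega⟩
    · intros; rfl
  rw [h2]
  have h3 : ∀ i, r ^ (a * (i + 1)) = r ^ a * (r ^ a) ^ i := by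
    intro i; rw [← pow_mul, ← pow_add]; congr 1; ring
  simp_rw [h3]
  rw [← Finset.mul_sum, geom_sum_eq (by intro h; apply h1; linarith), pow_mul, mul_div_assoc]

lemma pgt_err (r q : ℝ) (hr : 1 < r) (hq : 0 < q) (hqr : q < r) :
    Tendsto (fun M : ℕ => (∑ m ∈ Icc 1 M, q ^ m) / r ^ M) atTop (nhds 0) := by
  set x := max q 1 with hx
  have hx1 : 1 ≤ x := le_max_right _ _
  have hxr : x < r := max_lt hqr hr
  have h := tendsto_self_mul_const_pow_of_lt_one (r := x / r) (by positivity)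
    ((div_lt_one (by linarith)).2 hxr)
  refine squeeze_zero (fun M => by positivity) (fun M => ?_) h
  have h1 : ∑ m ∈ Icc 1 M, q ^ m ≤ ∑ m ∈ Icc 1 M, x ^ M := by
    refine Finset.sum_le_sum fun m hm => ?_
    calc q ^ m ≤ x ^ m := pow_le_pow_left₀ hq.le (le_max_left _ _) _
      _ ≤ x ^ M := pow_le_pow_right₀ hx1 (mem_Icc.1 hm).2
  rw [div_pow, ← mul_div_assoc]
  gcongr
  simpa using h1

lemma pgt_analytic (r : ℝ) (hr : 1 < r) (N P : ℕ → ℝ)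
    (hP0 : ∀ m, 0 ≤ P m) (hPN : ∀ m, P m ≤ N m)
    (hNP : ∀ m, 1 ≤ m → N m - P m ≤ ∑ d ∈ Icc 1 (m / 2), N d)
    (s' : ℕ) (hs' : 1 ≤ s') (nn : Fin s' → ℕ) (hnn : ∀ k, 0 < nn k)
    (ε C₀ : ℝ) (hε : 0 < ε) (hεr : ε < r) (hC₀ : 0 < C₀)
    (hexp : ∀ m : ℕ, 1 ≤ m →
      |N m - r ^ m * ∑ k : Fin s', (if nn k ∣ m then (nn k : ℝ) else 0)|
        ≤ C₀ * (r - ε) ^ m)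
    (K : ℕ) (hK : K = Finset.univ.lcm nn)
    (C : ℝ) (hC : C = ∑ k : Fin s', (nn k : ℝ) * r ^ (nn k) / (r ^ (nn k) - 1))
    (θ ψ pp : ℕ → ℝ)
    (hθ : ∀ n : ℕ, θ n = ∑ m ∈ Icc 1 n, P m)
    (hψ : ∀ n : ℕ, ψ n = ∑ m ∈ Icc 1 n, N m)
    (hpp : ∀ n : ℕ, pp n = ∑ m ∈ Icc 1 n, P m / m) :
    Tendsto (fun n : ℕ => θ (n * K) / (C * r ^ (n * K))) atTop (nhds 1) ∧
    Tendsto (fun n : ℕ => ψ (n * K) / (C * r ^ (n * K))) atTop (nhds 1) ∧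
    Tendsto (fun n : ℕ => (n * K : ℝ) * pp (n * K) / (C * r ^ (n * K)))
      atTop (nhds 1) := by
  have hr0 : 0 < r := by linarith
  have hK0 : 0 < K := by
    rw [hK]
    apply Nat.pos_of_ne_zero
    rw [Ne, Finset.lcm_eq_zero_iff]
    rintro ⟨k, _, hk⟩
    exact (hnn k).ne' hk
  have hKt : Tendsto (fun n : ℕ => n * K) atTop atTop :=
    tendsto_id.atTop_mul_const' hK0
  have hpow : ∀ k, 0 < r ^ nn k - 1 := fun k => by
    have := one_lt_pow₀ hr (hnn k).ne'
    linarith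
  have hCpos : 0 < C := by
    rw [hC]
    have : Nonempty (Fin s') := ⟨⟨0, hs'⟩⟩
    refine Finset.sum_pos (fun k _ => ?_) Finset.univ_nonempty
    have := hpow k
    have := hnn k
    positivity
  have hN0 : ∀ m, 0 ≤ N m := fun m => (hP0 m).trans (hPN m)
  -- upper bound
  obtain ⟨A, hA0, hA⟩ : ∃ A : ℝ, 0 < A ∧ ∀ m, 1 ≤ m → N m ≤ A * r ^ m := by
    refine ⟨(∑ k, (nn k : ℝ)) + C₀, by positivity, fun m hm => ?_⟩
    have h1 := (abs_le.1 (hexp m hm)).2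
    have h2 : (r - ε) ^ m ≤ r ^ m := pow_le_pow_left₀ (by linarith) (by linarith) _
    have h3 : ∑ k : Fin s', (if nn k ∣ m then (nn k : ℝ) else 0) ≤ ∑ k, (nn k : ℝ) := by
      refine Finset.sum_le_sum fun k _ => ?_
      split_ifs <;> simp
    have h4 : 0 < r ^ m := by positivity
    nlinarith
  -- ψ
  have hψ1 : Tendsto (fun n : ℕ => ψ (n * K) / r ^ (n * K)) atTop (nhds C) := by
    set Mn : ℕ → ℝ := fun m => r ^ m * ∑ k : Fin s', (if nn k ∣ m then (nn k : ℝ) else 0) with hMn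
    have hmain : Tendsto (fun n : ℕ => (∑ m ∈ Icc 1 (n * K), Mn m) / r ^ (n * K)) atTop
        (nhds C) := by
      have e : ∀ n : ℕ, (∑ m ∈ Icc 1 (n * K), Mn m) / r ^ (n * K) =
          ∑ k, (nn k : ℝ) * r ^ (nn k) / (r ^ (nn k) - 1) * (1 - (r⁻¹) ^ (n * K)) := by
        intro n
        have e1 : ∑ m ∈ Icc 1 (n * K), Mn m =
            ∑ k, (nn k : ℝ) * ∑ m ∈ Icc 1 (n * K), (if nn k ∣ m then r ^ m else 0) := by
          simp only [hMn, Finset.mul_sum]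
          rw [Finset.sum_comm]
          refine Finset.sum_congr rfl fun k _ => Finset.sum_congr rfl fun m _ => ?_
          split_ifs <;> ring
        rw [e1, Finset.sum_div]
        refine Finset.sum_congr rfl fun k _ => ?_
        have hd : nn k ∣ n * K := by
          rw [hK]; exact (Finset.dvd_lcm (mem_univ k)).mul_left n
        obtain ⟨j, hj⟩ := hd
        rw [hj, pgt_geom r hr _ _ (hnn k), inv_pow]
        have := (hpow k).ne'
        field_simp
      simp_rw [e]
      have hz : Tendsto (fun n : ℕ => (r⁻¹) ^ (n * K)) atTop (nhds 0) :=
        (tendsto_pow_atTop_nhds_zero_of_lt_one (by positivity)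
          (inv_lt_one_of_one_lt₀ hr)).comp hKt
      rw [hC]
      refine tendsto_finsetSum _ fun k _ => ?_
      simpa using (hz.const_sub 1).const_mul ((nn k : ℝ) * r ^ (nn k) / (r ^ (nn k) - 1))
    have herr := ((pgt_err r (r - ε) hr (by linarith) (by linarith)).comp hKt).const_mul C₀
    rw [mul_zero] at herr
    have hd : Tendsto (fun n : ℕ => ψ (n * K) / r ^ (n * K) -
        (∑ m ∈ Icc 1 (n * K), Mn m) / r ^ (n * K)) atTop (nhds 0) := by
      refine squeeze_zero_norm (fun n => ?_) herr
      rw [← sub_div, hψ, ← Finset.sum_sub_distrib, Real.norm_eq_abs, abs_div,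
        abs_of_pos (pow_pos hr0 _), Function.comp_apply, ← mul_div_assoc, Finset.mul_sum]
      gcongr
      refine (Finset.abs_sum_le_sum_abs _ _).trans (Finset.sum_le_sum fun m hm => ?_)
      exact hexp m (mem_Icc.1 hm).1
    simpa using hd.add hmain
  -- ψ - θ
  have hψθ : Tendsto (fun M : ℕ => (ψ M - θ M) / r ^ M) atTop (nhds 0) := by
    have hs1 : 1 < Real.sqrt r := by rwa [Real.lt_sqrt (by norm_num), one_pow]
    have hss : Real.sqrt r * Real.sqrt r = r := Real.mul_self_sqrt hr0.le
    have h := (tendsto_pow_const_mul_const_pow_of_abs_lt_one 2 (r := (Real.sqrt r)⁻¹)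
      (by rw [abs_of_pos (by positivity)]; exact inv_lt_one_of_one_lt₀ hs1)).const_mul A
    rw [mul_zero] at h
    refine squeeze_zero (fun M => ?_) (fun M => ?_) h
    · rw [hψ, hθ, ← Finset.sum_sub_distrib]
      exact div_nonneg (Finset.sum_nonneg fun m _ => sub_nonneg.2 (hPN m)) (by positivity)
    · have h1 : ψ M - θ M ≤ M * (M * (A * (Real.sqrt r) ^ M)) := by
        rw [hψ, hθ, ← Finset.sum_sub_distrib]
        have : ∀ m ∈ Icc 1 M, N m - P m ≤ M * (A * (Real.sqrt r) ^ M) := by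
          intro m hm
          have hm := mem_Icc.1 hm
          refine (hNP m hm.1).trans ?_
          calc ∑ d ∈ Icc 1 (m / 2), N d ≤ ∑ d ∈ Icc 1 (m / 2), A * (Real.sqrt r) ^ M := by
                refine Finset.sum_le_sum fun d hd => ?_
                have hd := mem_Icc.1 hd
                refine (hA d hd.1).trans ?_
                gcongr
                rw [← hss, ← pow_two, ← pow_mul, Real.sqrt_sq (by positivity)]
                exact pow_le_pow_right₀ hs1.le (by omega)
            _ = ((m / 2 : ℕ) : ℝ) * (A * (Real.sqrt r) ^ M) := by simp
            _ ≤ _ := by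
                gcongr
                omega
        refine (Finset.sum_le_sum this).trans ?_
        simp
      rw [div_le_iff₀ (by positivity)]
      refine h1.trans (le_of_eq ?_)
      conv_rhs => rw [← hss]
      rw [mul_pow, inv_pow]
      field_simp
      rw [Real.sq_sqrt hr0.le]
  have hθ1 : Tendsto (fun n : ℕ => θ (n * K) / r ^ (n * K)) atTop (nhds C) := by
    have := hψ1.sub (hψθ.comp hKt)
    rw [sub_zero] at this
    refine this.congr fun n => ?_
    simp only [Function.comp_apply]
    ring
  have hpθ : Tendsto (fun M : ℕ => (M * pp M - θ M) / r ^ M) atTop (nhds 0) := by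
    have hsum : Summable fun j : ℕ => ((j : ℝ) ^ 2 + j) * (r⁻¹) ^ j := by
      have hri : ‖r⁻¹‖ < 1 := by
        rw [Real.norm_eq_abs, abs_of_pos (by positivity)]; exact inv_lt_one_of_one_lt₀ hr
      have a := summable_pow_mul_geometric_of_norm_lt_one 2 hri
      have b := summable_pow_mul_geometric_of_norm_lt_one 1 hri
      refine (a.add b).congr fun j => ?_
      ring
    set B := ∑' j : ℕ, ((j : ℝ) ^ 2 + j) * (r⁻¹) ^ j with hB
    have h : Tendsto (fun M : ℕ => A * B / (M : ℝ)) atTop (nhds 0) :=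
      tendsto_const_div_atTop_nhds_zero_nat _
    have key : ∀ M : ℕ, M * pp M - θ M = ∑ m ∈ Icc 1 M, P m * ((M - m) / m) := by
      intro M
      rw [hpp, hθ, Finset.mul_sum, ← Finset.sum_sub_distrib]
      refine Finset.sum_congr rfl fun m hm => ?_
      have : (m : ℝ) ≠ 0 := by
        have := (mem_Icc.1 hm).1
        positivity
      field_simp
    refine squeeze_zero' (Eventually.of_forall fun M => ?_) ?_ h
    · rw [key]
      refine div_nonneg (Finset.sum_nonneg fun m hm => ?_) (by positivity)
      have : (m : ℝ) ≤ M := by exact_mod_cast (mem_Icc.1 hm).2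
      exact mul_nonneg (hP0 m) (div_nonneg (by linarith) (by positivity))
    · filter_upwards [eventually_gt_atTop 0] with M hM
      have hM' : (0 : ℝ) < M := by exact_mod_cast hM
      rw [key, Finset.sum_div, mul_div_right_comm, hB]
      calc ∑ m ∈ Icc 1 M, P m * ((M - m) / m) / r ^ M
          ≤ ∑ m ∈ Icc 1 M, A / M * ((((M - m : ℕ) : ℝ) ^ 2 + (M - m : ℕ)) * (r⁻¹) ^ (M - m)) := by
            refine Finset.sum_le_sum fun m hm => ?_
            have hm := mem_Icc.1 hm
            obtain ⟨j, rfl⟩ := Nat.exists_eq_add_of_le hm.2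
            have hm0 : (1 : ℝ) ≤ m := by exact_mod_cast hm.1
            rw [Nat.add_sub_cancel_left]
            have hp : P m ≤ A * r ^ m := (hPN m).trans (hA m hm.1)
            push_cast
            have e1 : ((m : ℝ) + j - m) / m ≤ ((j : ℝ) ^ 2 + j) / (m + j) := by
              rw [div_le_div_iff₀ (by positivity) (by positivity)]
              have : (0 : ℝ) ≤ j := by positivity
              nlinarith [mul_nonneg (mul_nonneg this this) (sub_nonneg.2 hm0)]
            have e0 : 0 ≤ ((m : ℝ) + j - m) / m := by
              rw [add_sub_cancel_left]; positivity
            calc P m * (((m : ℝ) + j - m) / m) / r ^ (m + j)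
                ≤ (A * r ^ m) * (((j : ℝ) ^ 2 + j) / (m + j)) / r ^ (m + j) := by
                  gcongr
              _ = _ := by
                  rw [pow_add, inv_pow]
                  field_simp
        _ = A / M * ∑ m ∈ Icc 1 M, ((((M - m : ℕ) : ℝ) ^ 2 + (M - m : ℕ)) * (r⁻¹) ^ (M - m)) := by
            rw [Finset.mul_sum]
        _ ≤ _ := by
            gcongr
            rw [← Finset.sum_image (s := Icc 1 M) (g := fun m => M - m)
              (f := fun j : ℕ => ((j : ℝ) ^ 2 + j) * (r⁻¹) ^ j)]
            · exact hsum.sum_le_tsum _ (fun j _ => by positivity)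
            · intro a ha b hb hab
              simp only [coe_Icc, Set.mem_Icc] at ha hb hab
              omega
  have hp1 : Tendsto (fun n : ℕ => ((n * K : ℕ) : ℝ) * pp (n * K) / r ^ (n * K)) atTop (nhds C) := by
    have := hθ1.add (hpθ.comp hKt)
    rw [add_zero] at this
    refine this.congr fun n => ?_
    simp only [Function.comp_apply]
    ring
  have fin : ∀ f : ℕ → ℝ, Tendsto (fun n : ℕ => f n / r ^ (n * K)) atTop (nhds C) →
      Tendsto (fun n : ℕ => f n / (C * r ^ (n * K))) atTop (nhds 1) := by
    intro f hf
    have := hf.div_const C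
    rw [div_self hCpos.ne'] at this
    refine this.congr fun n => ?_
    rw [div_div, mul_comm]
  refine ⟨fin _ hθ1, fin _ hψ1, ?_⟩
  have := fin _ hp1
  push_cast at this
  exact this

end analytic

namespace PGT
section comb
open Finset
variable {V E : Type*} {s t : E → V}

/-- Length of a closed path. -/
def cpLen (c : ClosedPath s t) : ℕ := c.1.1

lemma cpLen_pos (c : ClosedPath s t) : 0 < cpLen c := c.2.1

/-- Periodic extension of a closed path. -/
def cpExt (c : ClosedPath s t) (i : ℕ) : E := c.1.2 ⟨i % c.1.1, Nat.mod_lt _ c.2.1⟩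

lemma cpExt_val (c : ClosedPath s t) (i : Fin c.1.1) : cpExt c i.1 = c.1.2 i := by
  have h : (⟨i.1 % c.1.1, Nat.mod_lt _ c.2.1⟩ : Fin c.1.1) = i :=
    Fin.ext (Nat.mod_eq_of_lt i.2)
  exact congrArg c.1.2 h

lemma cpExt_cyc (c : ClosedPath s t) (i : Fin c.1.1) (d : ℕ) :
    c.1.2 (cyc i d) = cpExt c (i.1 + d) := rfl

lemma cpExt_mod (c : ClosedPath s t) (i : ℕ) : cpExt c (i % cpLen c) = cpExt c i := by
  unfold cpExt cpLen
  simp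

lemma cpExt_mod_add (c : ClosedPath s t) (i j : ℕ) :
    cpExt c (i % cpLen c + j) = cpExt c (i + j) := by
  unfold cpExt cpLen
  simp

lemma cpExt_periodic (c : ClosedPath s t) : Function.Periodic (cpExt c) (cpLen c) := by
  intro i
  unfold cpExt cpLen
  simp

lemma cpExt_closed (c : ClosedPath s t) (i : ℕ) : t (cpExt c i) = s (cpExt c (i + 1)) := by
  have := c.2.2 ⟨i % c.1.1, Nat.mod_lt _ c.2.1⟩
  rw [cpExt_cyc] at this
  rw [← cpExt_mod_add]
  exact this

lemma cp_ext {c d : ClosedPath s t} (h : cpLen c = cpLen d) (h' : cpExt c = cpExt d) : c = d := by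
  have hc := cpExt_val c
  have hd := cpExt_val d
  obtain ⟨⟨n, p⟩, hp⟩ := c
  obtain ⟨⟨m, q⟩, hq⟩ := d
  have h : n = m := h
  subst h
  have : p = q := by
    funext i
    have a := hc i
    have b := hd i
    simp only at a b
    rw [← a, h', ← b]
  subst this
  rfl

/-- Closed path from a periodic sequence. -/
def cpMk (f : ℕ → E) (n : ℕ) (hn : 0 < n) (hf : Function.Periodic f n)
    (h : ∀ i, t (f i) = s (f (i + 1))) : ClosedPath s t :=
  ⟨⟨n, fun i => f i.1⟩, hn, fun i => by
    show t (f i.1) = s (f ((i.1 + 1) % n))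
    rw [h, hf.map_mod_nat]⟩

lemma cpMk_len (f : ℕ → E) (n : ℕ) (hn : 0 < n) (hf : Function.Periodic f n)
    (h : ∀ i, t (f i) = s (f (i + 1))) : cpLen (cpMk f n hn hf h) = n := rfl

lemma cpMk_ext (f : ℕ → E) (n : ℕ) (hn : 0 < n) (hf : Function.Periodic f n)
    (h : ∀ i, t (f i) = s (f (i + 1))) : cpExt (cpMk f n hn hf h) = f := by
  funext i
  exact hf.map_mod_nat i

lemma rotRel_iff {c d : ClosedPath s t} :
    RotRel s t c d ↔ cpLen c = cpLen d ∧ ∃ r, ∀ i, cpExt d (i + r) = cpExt c i := by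
  constructor
  · rintro ⟨h, r, hr⟩
    refine ⟨h, r, fun i => ?_⟩
    have := hr ⟨i % c.1.1, Nat.mod_lt _ c.2.1⟩
    rw [← cpExt_val d] at this
    have h2 : cpExt c i = c.1.2 ⟨i % c.1.1, Nat.mod_lt _ c.2.1⟩ := rfl
    rw [h2, ← this, Fin.val_cast]
    simp only [cyc]
    have h3 : c.1.1 = cpLen d := h
    rw [h3, cpExt_mod, cpExt_mod_add]
  · rintro ⟨h, r, hr⟩
    refine ⟨h, r, fun i => ?_⟩
    rw [← cpExt_val d, ← cpExt_val c, ← hr]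
    have h3 : cpExt d ((i.1 + r) % cpLen c) = cpExt d (i.1 + r) := by rw [h, cpExt_mod]
    exact h3

lemma rotRel_equiv : Equivalence (RotRel s t) := by
  refine ⟨fun c => rotRel_iff.2 ⟨rfl, 0, fun i => rfl⟩, ?_, ?_⟩
  · intro c d h
    obtain ⟨h, r, hr⟩ := rotRel_iff.1 h
    refine rotRel_iff.2 ⟨h.symm, r * (cpLen c - 1), fun i => ?_⟩
    rw [← hr, add_assoc]
    have hc := cpLen_pos c
    have : r * (cpLen c - 1) + r = r * cpLen d := by
      rw [← h]
      obtain ⟨k, hk⟩ := Nat.exists_eq_succ_of_ne_zero hc.ne'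
      rw [hk]; simp; ring
    rw [this]
    exact (cpExt_periodic d).nat_mul r i
  · intro c d e h h'
    obtain ⟨h, r, hr⟩ := rotRel_iff.1 h
    obtain ⟨h', r', hr'⟩ := rotRel_iff.1 h'
    refine rotRel_iff.2 ⟨h.trans h', r + r', fun i => ?_⟩
    rw [← hr, ← hr', add_assoc]

/-- The cycle of a closed path. -/
def mkC (c : ClosedPath s t) : Cycle s t := Quot.mk _ c

lemma mk_eq_iff {c d : ClosedPath s t} :
    (mkC c) = mkC d ↔ RotRel s t c d := by
  exact Quot.eq.trans rotRel_equiv.eqvGen_iff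

lemma out_rel (c : ClosedPath s t) : RotRel s t (Quot.out (mkC c)) c :=
  mk_eq_iff.1 (Quot.out_eq _)

lemma period_iff (c : ClosedPath s t) (d : ℕ) :
    (∀ i : Fin c.1.1, c.1.2 (cyc i d) = c.1.2 i) ↔ Function.Periodic (cpExt c) d := by
  constructor
  · intro h i
    have := h ⟨i % c.1.1, Nat.mod_lt _ c.2.1⟩
    rw [cpExt_cyc] at this
    rw [← cpExt_mod_add]
    exact this
  · intro h i
    rw [cpExt_cyc, h, cpExt_val]

lemma rot_period {c d : ClosedPath s t} (h : RotRel s t c d) (k : ℕ)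
    (hk : Function.Periodic (cpExt d) k) : Function.Periodic (cpExt c) k := by
  obtain ⟨h, r, hr⟩ := rotRel_iff.1 h
  intro i
  rw [← hr, ← hr, add_right_comm, hk]

lemma rot_period_iff {c d : ClosedPath s t} (h : RotRel s t c d) (k : ℕ) :
    Function.Periodic (cpExt c) k ↔ Function.Periodic (cpExt d) k :=
  ⟨rot_period (rotRel_equiv.symm h) k, rot_period h k⟩

lemma weight_eq (w : E → E → ℝ) (c : ClosedPath s t) :
    pathWeight w c.1.2 = ∏ i ∈ range (cpLen c), w (cpExt c i) (cpExt c (i + 1)) := by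
  rw [Finset.prod_range]
  refine Finset.prod_congr rfl fun i _ => ?_
  rw [cpExt_cyc]
  congr 1
  exact (cpExt_val c i).symm

lemma prod_shift (g : ℕ → ℝ) (n : ℕ) (hg : Function.Periodic g n) (r : ℕ) :
    ∏ i ∈ range n, g (i + r) = ∏ i ∈ range n, g i := by
  induction r with
  | zero => rfl
  | succ r ih =>
    rw [← ih]
    cases n with
    | zero => rfl
    | succ m =>
      rw [prod_range_succ, prod_range_succ' (fun i => g (i + r))]
      congr 1
      · refine prod_congr rfl fun i _ => ?_
        congr 1; ring
      · have := hg r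
        rw [← add_assoc, zero_add, ← this]
        congr 1; ring

lemma prod_mul_period (g : ℕ → ℝ) (n : ℕ) (hg : Function.Periodic g n) (k : ℕ) :
    ∏ i ∈ range (n * k), g i = (∏ i ∈ range n, g i) ^ k := by
  induction k with
  | zero => simp
  | succ k ih =>
    rw [Nat.mul_succ, prod_range_add, ih, pow_succ]
    congr 1
    refine prod_congr rfl fun i _ => ?_
    rw [add_comm, mul_comm]
    exact hg.nat_mul k i

lemma rot_weight (w : E → E → ℝ) {c d : ClosedPath s t} (h : RotRel s t c d) :
    pathWeight w c.1.2 = pathWeight w d.1.2 := by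
  obtain ⟨h, r, hr⟩ := rotRel_iff.1 h
  rw [weight_eq, weight_eq, h]
  simp_rw [← hr]
  have := prod_shift (fun i => w (cpExt d i) (cpExt d (i + 1))) (cpLen d) (fun i => by
    simp only
    rw [add_right_comm, cpExt_periodic, cpExt_periodic]) r
  rw [← this]
  refine prod_congr rfl fun i _ => ?_
  rw [add_right_comm]

lemma mk_weight (w : E → E → ℝ) (c : ClosedPath s t) :
    Cycle.weight w (mkC c) = pathWeight w c.1.2 :=
  rot_weight w (out_rel c)

lemma mk_len (c : ClosedPath s t) : Cycle.len (mkC c) = cpLen c :=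
  (rotRel_iff.1 (out_rel c)).1

lemma prim_iff (c : ClosedPath s t) :
    IsPrimitivePath c.1.2 ↔ ¬ ∃ d, 0 < d ∧ d < cpLen c ∧ Function.Periodic (cpExt c) d := by
  unfold IsPrimitivePath
  simp_rw [period_iff]
  rfl

lemma mk_prim (c : ClosedPath s t) :
    Cycle.IsPrimitive (mkC c) ↔ IsPrimitivePath c.1.2 := by
  unfold Cycle.IsPrimitive
  rw [prim_iff, prim_iff, (rotRel_iff.1 (out_rel c)).1]
  simp_rw [rot_period_iff (out_rel c)]

/-- Minimal period. -/
noncomputable def cpPer (c : ClosedPath s t) : ℕ :=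
  sInf {d : ℕ | 0 < d ∧ Function.Periodic (cpExt c) d}

lemma cpPer_spec (c : ClosedPath s t) : 0 < cpPer c ∧ Function.Periodic (cpExt c) (cpPer c) :=
  Nat.sInf_mem (s := {d : ℕ | 0 < d ∧ Function.Periodic (cpExt c) d})
    ⟨cpLen c, cpLen_pos c, cpExt_periodic c⟩

lemma cpPer_le (c : ClosedPath s t) {d : ℕ} (hd : 0 < d) (h : Function.Periodic (cpExt c) d) :
    cpPer c ≤ d := Nat.sInf_le ⟨hd, h⟩

lemma cpPer_dvd (c : ClosedPath s t) : cpPer c ∣ cpLen c := by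
  by_contra hnd
  obtain ⟨h0, hp⟩ := cpPer_spec c
  have hm : 0 < cpLen c % cpPer c :=
    Nat.pos_of_ne_zero fun h => hnd (Nat.dvd_of_mod_eq_zero h)
  have : Function.Periodic (cpExt c) (cpLen c % cpPer c) := by
    intro i
    have h1 := hp.nat_mul (cpLen c / cpPer c) (i + cpLen c % cpPer c)
    rw [← h1, add_assoc]
    have : cpLen c % cpPer c + (cpLen c / cpPer c : ℕ) * cpPer c = cpLen c := Nat.mod_add_div' _ _
    simp only [Nat.cast_id]
    rw [this, cpExt_periodic]
  exact absurd (cpPer_le c hm this) (not_le.2 (Nat.mod_lt _ h0))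

lemma primLen_eq (c : Cycle s t) : Cycle.primLen c = cpPer (Quot.out c) := by
  unfold Cycle.primLen cpPer
  simp_rw [period_iff]

lemma primLen_of_prim (c : Cycle s t) (h : c.IsPrimitive) : Cycle.primLen c = Cycle.len c := by
  rw [primLen_eq]
  have h' := (prim_iff _).1 h
  push Not at h'
  obtain ⟨h0, hp⟩ := cpPer_spec (Quot.out c)
  refine le_antisymm (Nat.le_of_dvd (cpLen_pos _) (cpPer_dvd _)) ?_
  by_contra hlt
  exact h' _ h0 (not_le.1 hlt) hp

/-- Rotation of a closed path. -/
def cpRot (c : ClosedPath s t) (r : ℕ) : ClosedPath s t :=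
  cpMk (fun i => cpExt c (i + r)) (cpLen c) (cpLen_pos c)
    (fun i => by
      show cpExt c (i + cpLen c + r) = cpExt c (i + r)
      rw [add_right_comm, cpExt_periodic])
    (fun i => by
      show t (cpExt c (i + r)) = s (cpExt c (i + 1 + r))
      rw [cpExt_closed c, add_right_comm])

lemma cpRot_ext (c : ClosedPath s t) (r i : ℕ) : cpExt (cpRot c r) i = cpExt c (i + r) :=
  congrFun (cpMk_ext _ _ _ _ _) i

lemma cpRot_rel (c : ClosedPath s t) (r : ℕ) : RotRel s t (cpRot c r) c :=
  rotRel_iff.2 ⟨rfl, r, fun i => by rw [cpRot_ext]⟩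

lemma cpRot_inj_aux (q : ClosedPath s t) {a b : ℕ} (hab : a < b) (hb : b < cpPer q)
    (h : cpRot q a = cpRot q b) : False := by
  have h1 : ∀ i, cpExt q (i + a) = cpExt q (i + b) := by
    intro i
    have := congrFun (congrArg cpExt h) i
    rwa [cpRot_ext, cpRot_ext] at this
  have hp : Function.Periodic (cpExt q) (b - a) := by
    intro i
    obtain ⟨k, hk⟩ : ∃ k, a ≤ k * cpLen q :=
      ⟨a, Nat.le_mul_of_pos_right _ (cpLen_pos q)⟩
    have e : ∀ x, cpExt q (x + k * cpLen q) = cpExt q x := (cpExt_periodic q).nat_mul k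
    rw [← e i, ← e (i + (b - a))]
    have := h1 (i + (k * cpLen q - a))
    rw [show i + k * cpLen q = i + (k * cpLen q - a) + a by omega, this]
    congr 1; omega
  have := cpPer_le q (by omega) hp
  omega

lemma fiber_card (c : Cycle s t) :
    Nat.card {p : ClosedPath s t // (mkC p) = c} = Cycle.primLen c := by
  rw [primLen_eq]
  set q := Quot.out c with hq
  have hqc : (mkC q) = c := Quot.out_eq c
  have : Function.Bijective (fun j : Fin (cpPer q) =>
      (⟨cpRot q j, by rw [← hqc]; exact mk_eq_iff.2 (cpRot_rel q j)⟩ :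
        {p : ClosedPath s t // (mkC p) = c})) := by
    constructor
    · intro a b h
      have h := congrArg Subtype.val h
      simp only at h
      rcases lt_trichotomy a.1 b.1 with hab | hab | hab
      · exact (cpRot_inj_aux q hab b.2 h).elim
      · exact Fin.ext hab
      · exact (cpRot_inj_aux q hab a.2 h.symm).elim
    · rintro ⟨p, hp⟩
      rw [← hqc, mk_eq_iff, rotRel_iff] at hp
      obtain ⟨hl, r, hr⟩ := hp
      obtain ⟨h0, hper⟩ := cpPer_spec q
      refine ⟨⟨r % cpPer q, Nat.mod_lt _ h0⟩, Subtype.ext (cp_ext hl.symm ?_)⟩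
      funext i
      simp only
      rw [← hr, cpRot_ext]
      have := hper.nat_mul (r / cpPer q) (i + r % cpPer q)
      rw [← this, add_assoc]
      congr 2
      exact Nat.mod_add_div' _ _
  rw [← Nat.card_eq_of_bijective _ this, Nat.card_fin]

lemma tsum_cycle (G : Cycle s t → ℝ) (h : Summable fun p : ClosedPath s t => G (mkC p)) :
    ∑' p : ClosedPath s t, G (mkC p) = ∑' c, G c * Cycle.primLen c := by
  let e := Equiv.sigmaFiberEquiv (fun p : ClosedPath s t => (mkC p))
  have h' : Summable fun x => G (mkC (e x)) := (e.summable_iff).2 h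
  have h1 := e.tsum_eq (fun p : ClosedPath s t => G (mkC p))
  rw [← h1, h'.tsum_sigma]
  refine tsum_congr fun c => ?_
  have : ∀ p : {p : ClosedPath s t // (mkC p) = c},
      G (mkC (e ⟨c, p⟩)) = G c := fun p => congrArg G p.2
  simp_rw [this]
  rw [tsum_const, fiber_card, nsmul_eq_mul, mul_comm]

/-- sum over closed paths split by length -/
lemma sum_by_len (g : ∀ m : ℕ, (Fin m → E) → ℝ) (hg : ∀ m p, IsClosedPath s t p → 0 ≤ g m p)
    (hs : ∀ m, 0 < m → Summable fun p : {p : Fin m → E // IsClosedPath s t p} => g m p.1) (n : ℕ) :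
    (Summable fun p : ClosedPath s t => if cpLen p ≤ n then g p.1.1 p.1.2 else 0) ∧
    ∑' p : ClosedPath s t, (if cpLen p ≤ n then g p.1.1 p.1.2 else 0) =
      ∑ m ∈ Icc 1 n, ∑' p : {p : Fin m → E // IsClosedPath s t p}, g m p.1 := by
  let F : (Σ m : {m : ℕ // 0 < m}, {p : Fin m.1 → E // IsClosedPath s t p}) → ℝ :=
    fun x => if x.1.1 ≤ n then g x.1.1 x.2.1 else 0
  let e : ClosedPath s t ≃ (Σ m : {m : ℕ // 0 < m}, {p : Fin m.1 → E // IsClosedPath s t p}) :=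
    { toFun := fun c => ⟨⟨c.1.1, c.2.1⟩, ⟨c.1.2, c.2.2⟩⟩
      invFun := fun x => ⟨⟨x.1.1, x.2.1⟩, x.1.2, x.2.2⟩
      left_inv := fun _ => rfl
      right_inv := fun _ => rfl }
  have hfib : ∀ m : {m : ℕ // 0 < m}, Summable fun p => F ⟨m, p⟩ := by
    intro m
    simp only [F]
    by_cases hm : m.1 ≤ n
    · simpa only [hm, if_true] using hs m.1 m.2
    · simpa only [hm, if_false] using summable_zero
  have htot : ∀ m : {m : ℕ // 0 < m}, ∑' p, F ⟨m, p⟩ =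
      if m.1 ≤ n then ∑' p : {p : Fin m.1 → E // IsClosedPath s t p}, g m p.1 else 0 := by
    intro m
    simp only [F]
    by_cases hm : m.1 ≤ n
    · simp only [hm, if_true]
    · simp only [hm, if_false, tsum_zero]
  have hF0 : ∀ x, 0 ≤ F x := by
    intro x
    simp only [F]
    split_ifs
    · exact hg _ _ x.2.2
    · exact le_rfl
  let S : Finset {m : ℕ // 0 < m} := (Icc 1 n).subtype _
  have hS : ∀ m ∉ S, (if m.1 ≤ n then
      ∑' p : {p : Fin m.1 → E // IsClosedPath s t p}, g m p.1 else 0) = 0 := by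
    intro m hm
    rw [if_neg]
    intro h
    apply hm
    simp only [S, Finset.mem_subtype, mem_Icc]
    exact ⟨m.2, h⟩
  have hFs : Summable F := by
    rw [summable_sigma_of_nonneg hF0]
    refine ⟨hfib, ?_⟩
    simp_rw [htot]
    exact summable_of_ne_finset_zero hS
  have hFe : ∀ p : ClosedPath s t, F (e p) = if cpLen p ≤ n then g p.1.1 p.1.2 else 0 :=
    fun p => rfl
  have h1 := e.tsum_eq F
  have h3 := e.summable_iff.2 hFs
  simp only [Function.comp_def, hFe] at h1 h3
  refine ⟨h3, ?_⟩
  rw [h1, hFs.tsum_sigma' hfib]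
  simp_rw [htot]
  rw [tsum_eq_sum hS]
  rw [Finset.sum_subtype_of_mem (p := fun m => 0 < m) (fun m : ℕ => if m ≤ n then
      ∑' p : {p : Fin m → E // IsClosedPath s t p}, g m p.1 else 0)
      (fun m hm => (mem_Icc.1 hm).1)]
  refine Finset.sum_congr rfl fun m hm => ?_
  rw [if_pos (mem_Icc.1 hm).2]

lemma summable_paths (w : E → E → ℝ) (hw : ∀ e f, 0 ≤ w e f)
    (hsum : Summable fun q : E × E => w q.1 q.2) (m : ℕ) :
    Summable fun p : Fin m → E => pathWeight w p := by
  classical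
  have h1 : Summable fun q : Fin m → E × E => ∏ i, w (q i).1 (q i).2 := by
    refine summable_of_sum_le (c := ∏ _i : Fin m, ∑' q : E × E, w q.1 q.2)
      (fun q => prod_nonneg fun i _ => hw _ _) fun u => ?_
    calc ∑ q ∈ u, ∏ i, w (q i).1 (q i).2
        ≤ ∑ q ∈ Fintype.piFinset (fun i => u.image (fun q => q i)), ∏ i, w (q i).1 (q i).2 := by
          refine sum_le_sum_of_subset_of_nonneg ?_ fun q _ _ => prod_nonneg fun i _ => hw _ _
          intro q hq
          rw [Fintype.mem_piFinset]
          exact fun i => mem_image_of_mem _ hq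
      _ = ∏ i : Fin m, ∑ x ∈ u.image (fun q => q i), w x.1 x.2 := by
          rw [Finset.prod_univ_sum]
      _ ≤ _ := by
          refine prod_le_prod (fun i _ => sum_nonneg fun x _ => hw _ _) fun i _ => ?_
          exact hsum.sum_le_tsum _ fun x _ => hw _ _
  have hinj : Function.Injective (fun (p : Fin m → E) (i : Fin m) => (p i, p (cyc i 1))) := by
    intro p q h
    funext i
    exact congrArg Prod.fst (congrFun h i)
  refine (h1.comp_injective hinj).congr fun p => ?_
  simp only [Function.comp_apply, pathWeight]

lemma nonprim_bound (w : E → E → ℝ) (hw : ∀ e f, 0 ≤ w e f)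
    (hsum : Summable fun q : E × E => w q.1 q.2)
    (hle : ∀ (n : ℕ) (p : Fin n → E), IsClosedPath s t p → pathWeight w p ≤ 1)
    (m : ℕ) (hm : 1 ≤ m) :
    ∑' p : {p : Fin m → E // IsClosedPath s t p}, ({p | ¬ IsPrimitivePath p}.indicator
        (fun p => pathWeight w p) p.1) ≤
      ∑ d ∈ Icc 1 (m / 2), ∑' p : {p : Fin d → E // IsClosedPath s t p}, pathWeight w p.1 := by
  have hW0 : ∀ (n : ℕ) (p : Fin n → E), 0 ≤ pathWeight w p :=
    fun n p => prod_nonneg fun i _ => hw _ _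
  obtain ⟨hs1, hs2⟩ := sum_by_len (s := s) (t := t) (fun m p => pathWeight w p)
    (fun m p _ => hW0 m p)
    (fun m _ => (summable_paths w hw hsum m).comp_injective Subtype.val_injective) (m / 2)
  rw [← hs2]
  let A := {p : {p : Fin m → E // IsClosedPath s t p} // ¬ IsPrimitivePath p.1}
  have hA : ∑' p : {p : Fin m → E // IsClosedPath s t p}, ({p | ¬ IsPrimitivePath p}.indicator
        (fun p => pathWeight w p) p.1) = ∑' p : A, pathWeight w p.1.1 :=
    (tsum_subtype {p : {p : Fin m → E // IsClosedPath s t p} | ¬ IsPrimitivePath p.1}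
      (fun p => pathWeight w p.1)).symm
  rw [hA]
  let toC : A → ClosedPath s t := fun p => ⟨⟨m, p.1.1⟩, hm, p.1.2⟩
  have toC_len : ∀ p, cpLen (toC p) = m := fun p => rfl
  let root : A → ClosedPath s t := fun p =>
    cpMk (cpExt (toC p)) (cpPer (toC p)) (cpPer_spec _).1 (cpPer_spec _).2 (cpExt_closed _)
  have root_ext : ∀ p, cpExt (root p) = cpExt (toC p) := fun p => cpMk_ext _ _ _ _ _
  have root_len : ∀ p, cpLen (root p) = cpPer (toC p) := fun p => rfl
  have hinj : Function.Injective root := by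
    intro p q h
    have : toC p = toC q := cp_ext rfl (by rw [← root_ext, ← root_ext, h])
    have h1 : (⟨m, p.1.1⟩ : Σ n : ℕ, Fin n → E) = ⟨m, q.1.1⟩ := congrArg Subtype.val this
    have h2 : p.1.1 = q.1.1 := by simpa using h1
    exact Subtype.ext (Subtype.ext h2)
  have hsA : Summable fun p : A => pathWeight w p.1.1 :=
    (summable_paths w hw hsum m).comp_injective
      (Subtype.val_injective.comp Subtype.val_injective)
  refine Summable.tsum_le_tsum_of_inj root hinj ?_ ?_ hsA hs1
  · intro c _
    split_ifs
    · exact hW0 _ _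
    · exact le_rfl
  · intro p
    obtain ⟨k, hk⟩ := cpPer_dvd (toC p)
    have hkm : m = cpPer (toC p) * k := hk
    have hper0 := (cpPer_spec (toC p)).1
    have hlt : cpPer (toC p) < m := by
      have := (prim_iff (toC p)).not.1 p.2
      push Not at this
      obtain ⟨d, h1, h2, h3⟩ := this
      exact (cpPer_le _ h1 h3).trans_lt h2
    have hk2 : 2 ≤ k := by
      by_contra hcon
      have : k ≤ 1 := by omega
      have := Nat.mul_le_mul_left (cpPer (toC p)) this
      omega
    have hlen : cpLen (root p) ≤ m / 2 := by
      rw [root_len, Nat.le_div_iff_mul_le (by norm_num)]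
      conv_rhs => rw [hkm]
      exact Nat.mul_le_mul_left _ hk2
    rw [if_pos hlen]
    have e1 : pathWeight w p.1.1 = (pathWeight w (root p).1.2) ^ k := by
      have a := weight_eq w (toC p)
      have b := weight_eq w (root p)
      rw [b, root_ext, root_len]
      refine Eq.trans a ?_
      rw [toC_len, ← prod_mul_period, ← hkm]
      intro i
      have hp := (cpPer_spec (toC p)).2
      simp only
      rw [add_right_comm, hp, hp]
    rw [e1]
    exact pow_le_of_le_one (hW0 _ _) (hle _ _ (root p).2.2) (by omega)

end comb
end PGT

open PGT Filter in
/-- Prime geodesic theorem for a weighted graph: with `r = r(T) > 1`,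
`w(p) ≤ 1` for all closed paths, `n₁, …, n_s, ε, C₀` as in the asymptotic expansion of
`N_m`, `K = lcm(n₁, …, n_s)` and `C = ∑_k n_k r^{n_k}/(r^{n_k}-1)`, one has
`θ(nK) ∼ C·r^{nK}`, `ψ(nK) ∼ C·r^{nK}` and `π(nK) ∼ C·r^{nK}/(nK)` as `n → ∞`. -/
theorem stmt12 {V E : Type*} [DecidableEq E] (s t : E → V) (w : E → E → ℝ)
    (hw_nonneg : ∀ e f, 0 ≤ w e f)
    (hw_adj : ∀ e f, w e f ≠ 0 → t e = s f)
    (hw_sum : Summable fun q : E × E => w q.1 q.2)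
    (hw_le_one : ∀ (n : ℕ) (p : Fin n → E), IsClosedPath s t p → pathWeight w p ≤ 1)
    (T : lp (fun _ : E => ℂ) 2 →L[ℂ] lp (fun _ : E => ℂ) 2)
    (hT : IsBassOperator w T)
    (r : ℝ) (hr : 1 < r) (hrad : spectralRadius ℂ T = ENNReal.ofReal r)
    (N : ℕ → ℝ)
    (hN : ∀ m : ℕ, N m =
      ∑' p : {p : Fin m → E // IsClosedPath s t p}, pathWeight w p.1)
    (s' : ℕ) (hs' : 1 ≤ s') (nn : Fin s' → ℕ) (hnn : ∀ k, 0 < nn k)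
    (ε C₀ : ℝ) (hε : 0 < ε) (hεr : ε < r) (hC₀ : 0 < C₀)
    (hexp : ∀ m : ℕ, 1 ≤ m →
      |N m - r ^ m * ∑ k : Fin s', (if nn k ∣ m then (nn k : ℝ) else 0)|
        ≤ C₀ * (r - ε) ^ m)
    (K : ℕ) (hK : K = Finset.univ.lcm nn)
    (C : ℝ) (hC : C = ∑ k : Fin s', (nn k : ℝ) * r ^ (nn k) / (r ^ (nn k) - 1))
    (θ ψ pp : ℕ → ℝ)
    (hθ : ∀ n : ℕ, θ n =
      ∑' c : {c : Cycle s t // c.IsPrimitive ∧ Cycle.len c ≤ n},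
        Cycle.weight w c.1 * (Cycle.len c.1 : ℝ))
    (hψ : ∀ n : ℕ, ψ n =
      ∑' c : {c : Cycle s t // Cycle.len c ≤ n},
        Cycle.weight w c.1 * (Cycle.primLen c.1 : ℝ))
    (hpp : ∀ n : ℕ, pp n =
      ∑' c : {c : Cycle s t // c.IsPrimitive ∧ Cycle.len c ≤ n},
        Cycle.weight w c.1) :
    Tendsto (fun n : ℕ => θ (n * K) / (C * r ^ (n * K))) atTop (nhds 1) ∧
    Tendsto (fun n : ℕ => ψ (n * K) / (C * r ^ (n * K))) atTop (nhds 1) ∧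
    Tendsto (fun n : ℕ => (n * K : ℝ) * pp (n * K) / (C * r ^ (n * K)))
      atTop (nhds 1) := by
  classical
  have hW0 : ∀ (n : ℕ) (p : Fin n → E), 0 ≤ pathWeight w p :=
    fun n p => Finset.prod_nonneg fun i _ => hw_nonneg _ _
  have hSm : ∀ m : ℕ, Summable fun p : {p : Fin m → E // IsClosedPath s t p} => pathWeight w p.1 :=
    fun m => (summable_paths w hw_nonneg hw_sum m).comp_injective Subtype.val_injective
  let gP : ∀ m : ℕ, (Fin m → E) → ℝ := fun m p => if IsPrimitivePath p then pathWeight w p else 0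
  have hgP : ∀ (m : ℕ) (p : Fin m → E),
      gP m p = if IsPrimitivePath p then pathWeight w p else 0 := fun _ _ => rfl
  have hgP0 : ∀ (m : ℕ) (p : Fin m → E), 0 ≤ gP m p := by
    intro m p
    rw [hgP]
    split_ifs
    · exact hW0 _ _
    · exact le_rfl
  have hgPle : ∀ (m : ℕ) (p : Fin m → E), gP m p ≤ pathWeight w p := by
    intro m p
    rw [hgP]
    split_ifs
    · exact le_rfl
    · exact hW0 _ _
  have hSP : ∀ m : ℕ, Summable fun p : {p : Fin m → E // IsClosedPath s t p} => gP m p.1 :=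
    fun m => Summable.of_nonneg_of_le (fun p => hgP0 m p.1) (fun p => hgPle m p.1) (hSm m)
  let P : ℕ → ℝ := fun m => ∑' p : {p : Fin m → E // IsClosedPath s t p}, gP m p.1
  refine pgt_analytic r hr N P ?_ ?_ ?_ s' hs' nn hnn ε C₀ hε hεr hC₀ hexp K hK C hC θ ψ pp
    ?_ ?_ ?_
  · exact fun m => tsum_nonneg fun p => hgP0 m p.1
  · intro m
    rw [hN]
    exact (hSP m).tsum_le_tsum (fun p => hgPle m p.1) (hSm m)
  · intro m hm
    have h := nonprim_bound w hw_nonneg hw_sum hw_le_one m hm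
    simp_rw [hN]
    refine le_trans (le_of_eq ?_) h
    rw [← (hSm m).tsum_sub (hSP m)]
    refine tsum_congr fun p => ?_
    rw [hgP, Set.indicator_apply]
    by_cases hp : IsPrimitivePath p.1
    · simp [hp]
    · simp [hp]
  · intro n
    obtain ⟨h1, h2⟩ := sum_by_len (s := s) (t := t) gP (fun m p _ => hgP0 m p) (fun m _ => hSP m) n
    let G : PGT.Cycle s t → ℝ := fun c =>
      if c.IsPrimitive ∧ PGT.Cycle.len c ≤ n then PGT.Cycle.weight w c else 0
    have hG : ∀ p : ClosedPath s t, G (mkC p) = if cpLen p ≤ n then gP p.1.1 p.1.2 else 0 := by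
      intro p
      simp only [G, mk_prim, mk_len, mk_weight, hgP]
      by_cases h : cpLen p ≤ n <;> by_cases h' : IsPrimitivePath p.1.2 <;> simp [h, h']
    have h3 := tsum_cycle G (by simp_rw [hG]; exact h1)
    simp_rw [hG] at h3
    rw [hθ, ← h2, h3]
    refine (tsum_subtype {c : PGT.Cycle s t | c.IsPrimitive ∧ PGT.Cycle.len c ≤ n}
      (fun c => PGT.Cycle.weight w c * (PGT.Cycle.len c : ℝ))).trans ?_
    refine tsum_congr fun c => ?_
    rw [Set.indicator_apply]
    by_cases h : c.IsPrimitive ∧ PGT.Cycle.len c ≤ n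
    · have h' := primLen_of_prim c h.1
      simp only [G, Set.mem_setOf_eq, h, h', and_self, if_true]
    · simp only [G, Set.mem_setOf_eq, h, if_false, zero_mul]
  · intro n
    obtain ⟨h1, h2⟩ := sum_by_len (s := s) (t := t) (fun m p => pathWeight w p)
      (fun m p _ => hW0 m p) (fun m _ => hSm m) n
    let G : PGT.Cycle s t → ℝ := fun c =>
      if PGT.Cycle.len c ≤ n then PGT.Cycle.weight w c else 0
    have hG : ∀ p : ClosedPath s t, G (mkC p) =
        if cpLen p ≤ n then pathWeight w p.1.2 else 0 := by
      intro p
      simp only [G, mk_len, mk_weight]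
    have h3 := tsum_cycle G (by simp_rw [hG]; exact h1)
    simp_rw [hG] at h3
    simp_rw [hN]
    rw [hψ, ← h2, h3]
    refine (tsum_subtype {c : PGT.Cycle s t | PGT.Cycle.len c ≤ n}
      (fun c => PGT.Cycle.weight w c * (PGT.Cycle.primLen c : ℝ))).trans ?_
    refine tsum_congr fun c => ?_
    rw [Set.indicator_apply]
    by_cases h : PGT.Cycle.len c ≤ n
    · simp only [G, Set.mem_setOf_eq, h, if_true]
    · simp only [G, Set.mem_setOf_eq, h, if_false, zero_mul]
  · intro n
    obtain ⟨h1, h2⟩ := sum_by_len (s := s) (t := t) (fun m p => gP m p / m)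
      (fun m p _ => div_nonneg (hgP0 m p) (Nat.cast_nonneg m))
      (fun m _ => (hSP m).div_const _) n
    let G : PGT.Cycle s t → ℝ := fun c =>
      if c.IsPrimitive ∧ PGT.Cycle.len c ≤ n then
        PGT.Cycle.weight w c / (PGT.Cycle.len c : ℝ) else 0
    have hG : ∀ p : ClosedPath s t, G (mkC p) =
        if cpLen p ≤ n then gP p.1.1 p.1.2 / (p.1.1 : ℝ) else 0 := by
      intro p
      have hl : (p.1.1 : ℝ) = (cpLen p : ℝ) := rfl
      simp only [G, mk_prim, mk_len, mk_weight, hgP, hl]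
      by_cases h : cpLen p ≤ n <;> by_cases h' : IsPrimitivePath p.1.2 <;> simp [h, h']
    have h3 := tsum_cycle G (by simp_rw [hG]; exact h1)
    simp_rw [hG] at h3
    have h4 : ∑ m ∈ Finset.Icc 1 n, P m / (m : ℝ) = ∑ m ∈ Finset.Icc 1 n,
        ∑' p : {p : Fin m → E // IsClosedPath s t p}, gP m p.1 / (m : ℝ) :=
      Finset.sum_congr rfl fun m _ => tsum_div_const.symm
    rw [hpp, h4, ← h2, h3]
    refine (tsum_subtype {c : PGT.Cycle s t | c.IsPrimitive ∧ PGT.Cycle.len c ≤ n}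
      (fun c => PGT.Cycle.weight w c)).trans ?_
    refine tsum_congr fun c => ?_
    rw [Set.indicator_apply]
    by_cases h : c.IsPrimitive ∧ PGT.Cycle.len c ≤ n
    · have h' := primLen_of_prim c h.1
      have h0 : (PGT.Cycle.len c : ℝ) ≠ 0 := by
        have : 0 < PGT.Cycle.len c := cpLen_pos (Quot.out c)
        exact_mod_cast this.ne'
      simp only [G, Set.mem_setOf_eq, h, h', and_self, if_true]
      rw [div_mul_cancel₀ _ h0]
    · simp only [G, Set.mem_setOf_eq, h, if_false, zero_mul]
end

section
/- Let X be an oriented graph with edge set E, w a transition weight on X, and T the Bass operator on ℓ²(E); assume the spectral radius r = r(T) is positive. Then 1/r = sup{ u > 0 : ∑_p w(p) u^{ℓ(p)} < ∞ }, where the sum runs over all closed paths p of X and ℓ(p) denotes the length of p. -/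
namespace Aux
open scoped ENNReal

def Mat (E : Type*) := E → E → ℝ≥0∞

variable {E : Type*}

noncomputable instance : AddCommMonoid (Mat E) := inferInstanceAs (AddCommMonoid (E → E → ℝ≥0∞))

theorem add_ap (A B : Mat E) (e f : E) : (A + B) e f = A e f + B e f := rfl
theorem zero_ap (e f : E) : (0 : Mat E) e f = 0 := rfl

open Classical in
noncomputable instance : Semiring (Mat E) :=
  { (inferInstance : AddCommMonoid (Mat E)) with
    mul := fun A B e f => ∑' g, A e g * B g f
    one := fun e f => if e = f then 1 else 0
    left_distrib := by
      intro A B C; funext e f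
      change ∑' g, A e g * (B g f + C g f) = ∑' g, A e g * B g f + ∑' g, A e g * C g f
      rw [← ENNReal.tsum_add]; simp only [mul_add]
    right_distrib := by
      intro A B C; funext e f
      change ∑' g, (A e g + B e g) * C g f = ∑' g, A e g * C g f + ∑' g, B e g * C g f
      rw [← ENNReal.tsum_add]; simp only [add_mul]
    zero_mul := by
      intro A; funext e f
      change ∑' g, (0 : ℝ≥0∞) * A g f = 0
      simp
    mul_zero := by
      intro A; funext e f
      change ∑' g, A e g * (0 : ℝ≥0∞) = 0
      simp
    mul_assoc := by
      intro A B C; funext e f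
      change ∑' g, (∑' h, A e h * B h g) * C g f = ∑' h, A e h * ∑' g, B h g * C g f
      simp only [← ENNReal.tsum_mul_left, ← ENNReal.tsum_mul_right]
      rw [ENNReal.tsum_comm]
      simp only [mul_assoc]
    one_mul := by
      intro A; funext e f
      change ∑' g, (if e = g then (1 : ℝ≥0∞) else 0) * A g f = A e f
      rw [tsum_eq_single e]
      · simp
      · intro b hb; simp [hb.symm]
    mul_one := by
      intro A; funext e f
      change ∑' g, A e g * (if g = f then (1 : ℝ≥0∞) else 0) = A e f
      rw [tsum_eq_single f]
      · simp
      · intro b hb; simp [hb] }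

theorem mul_ap (A B : Mat E) (e f : E) : (A * B) e f = ∑' g, A e g * B g f := rfl
open Classical in
theorem one_ap (e f : E) : (1 : Mat E) e f = if e = f then 1 else 0 := rfl

instance : PartialOrder (Mat E) := inferInstanceAs (PartialOrder (E → E → ℝ≥0∞))

theorem le_iff (A B : Mat E) : A ≤ B ↔ ∀ e f, A e f ≤ B e f := Iff.rfl

theorem add_mono {A B C D : Mat E} (h : A ≤ B) (h' : C ≤ D) : A + C ≤ B + D :=
  fun e f => add_le_add (h e f) (h' e f)

theorem mul_mono {A B C D : Mat E} (h : A ≤ B) (h' : C ≤ D) : A * C ≤ B * D :=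
  fun e f => ENNReal.tsum_le_tsum fun g => mul_le_mul' (h e g) (h' g f)

theorem pow_mono {A B : Mat E} (h : A ≤ B) (n : ℕ) : A ^ n ≤ B ^ n := by
  induction n with
  | zero => simp
  | succ n ih => rw [pow_succ, pow_succ]; exact mul_mono ih h

/-- Green function -/
noncomputable def G (A : Mat E) : Mat E := fun e f => ∑' n : ℕ, (A ^ n) e f

theorem G_mono {A B : Mat E} (h : A ≤ B) : G A ≤ G B :=
  fun e f => ENNReal.tsum_le_tsum fun n => pow_mono h n e f

theorem mul_G (A : Mat E) (e f : E) : (A * G A) e f = ∑' n : ℕ, (A ^ (n + 1)) e f := by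
  rw [mul_ap]
  simp only [G, ← ENNReal.tsum_mul_left]
  rw [ENNReal.tsum_comm]
  simp only [pow_succ', mul_ap]

theorem G_mul (A : Mat E) (e f : E) : (G A * A) e f = ∑' n : ℕ, (A ^ (n + 1)) e f := by
  rw [mul_ap]
  simp only [G, ← ENNReal.tsum_mul_right]
  rw [ENNReal.tsum_comm]
  simp only [pow_succ, mul_ap]

theorem G_eq (A : Mat E) : G A = 1 + A * G A := by
  funext e f
  rw [add_ap, mul_G, G, tsum_eq_zero_add' ENNReal.summable, pow_zero]

theorem G_eq' (A : Mat E) : G A = 1 + G A * A := by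
  funext e f
  rw [add_ap, G_mul, G, tsum_eq_zero_add' ENNReal.summable, pow_zero]

theorem sum_ap (A : ℕ → Mat E) (s : Finset ℕ) (e f : E) :
    (∑ n ∈ s, A n) e f = ∑ n ∈ s, A n e f := by
  classical
  induction s using Finset.induction_on with
  | empty => rfl
  | insert a s ha ih => rw [Finset.sum_insert ha, Finset.sum_insert ha, add_ap, ih]

theorem sum_le_G (A : Mat E) (N : ℕ) : ∑ n ∈ Finset.range N, A ^ n ≤ G A := by
  intro e f
  rw [sum_ap]
  exact ENNReal.sum_le_tsum _

theorem G_le {A X : Mat E} (h : ∀ N, ∑ n ∈ Finset.range N, A ^ n ≤ X) : G A ≤ X := by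
  intro e f
  refine ENNReal.tsum_le_of_sum_range_le fun N => ?_
  rw [← sum_ap]; exact h N e f

theorem zero_le' (A : Mat E) : 0 ≤ A := fun _ _ => zero_le

theorem G_add_le (A D : Mat E) : G (A + D) ≤ G A + G (A + D) * (D * G A) := by
  refine G_le fun N => ?_
  induction N with
  | zero => simpa using zero_le' _
  | succ N ih =>
    have h1 : ∑ n ∈ Finset.range (N + 1), (A + D) ^ n
        = 1 + ((∑ n ∈ Finset.range N, (A + D) ^ n) * A
            + (∑ n ∈ Finset.range N, (A + D) ^ n) * D) := by
      rw [Finset.sum_range_succ', ← mul_add, Finset.sum_mul, add_comm]; simp [pow_succ]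
    rw [h1]
    have h2 := add_mono (le_refl (1 : Mat E))
      (add_mono (mul_mono ih (le_refl A)) (mul_mono (sum_le_G (A + D) N) (le_refl D)))
    refine h2.trans (le_of_eq ?_)
    calc _ = (1 + G A * A) + G (A + D) * (D * (1 + G A * A)) := by
            simp only [mul_add, add_mul, mul_one, mul_assoc]; abel
      _ = _ := by rw [← G_eq' A]

theorem G_add_le' (A D : Mat E) : G (A + D) ≤ G A + G A * (D * G (A + D)) := by
  refine G_le fun N => ?_
  induction N with
  | zero => simpa using zero_le' _
  | succ N ih =>
    have h1 : ∑ n ∈ Finset.range (N + 1), (A + D) ^ n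
        = 1 + (A * (∑ n ∈ Finset.range N, (A + D) ^ n)
            + D * (∑ n ∈ Finset.range N, (A + D) ^ n)) := by
      rw [Finset.sum_range_succ', ← add_mul, Finset.mul_sum, add_comm]; simp [pow_succ']
    rw [h1]
    have h2 := add_mono (le_refl (1 : Mat E))
      (add_mono (mul_mono (le_refl A) ih) (mul_mono (le_refl D) (sum_le_G (A + D) N)))
    refine h2.trans (le_of_eq ?_)
    calc _ = (1 + A * G A) + (1 + A * G A) * (D * G (A + D)) := by
            simp only [mul_add, add_mul, one_mul, mul_assoc]; abel
      _ = _ := by rw [← G_eq A]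

noncomputable def tot (A : Mat E) : ℝ≥0∞ := ∑' e, ∑' f, A e f

theorem tot_add (A B : Mat E) : tot (A + B) = tot A + tot B := by
  simp only [tot, add_ap, ENNReal.tsum_add]

theorem tot_mono {A B : Mat E} (h : A ≤ B) : tot A ≤ tot B :=
  ENNReal.tsum_le_tsum fun e => ENNReal.tsum_le_tsum fun f => h e f

theorem tot_mul (A B : Mat E) : tot (A * B) ≤ tot A * tot B := by
  calc tot (A * B) = ∑' e, ∑' g, A e g * ∑' f, B g f := by
        simp only [tot, mul_ap]
        congr 1; funext e
        rw [ENNReal.tsum_comm]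
        simp only [ENNReal.tsum_mul_left]
    _ ≤ ∑' e, ∑' g, A e g * tot B := by
        gcongr with e g
        exact ENNReal.le_tsum (f := fun g => ∑' f, B g f) g
    _ = _ := by simp only [ENNReal.tsum_mul_right, tot]

theorem tot_mul_row (X Y : Mat E) (a : E) (hY : ∀ g f, g ≠ a → Y g f = 0) :
    tot (X * Y) = (∑' e, X e a) * ∑' f, Y a f := by
  have : ∀ e f, (X * Y) e f = X e a * Y a f := by
    intro e f
    rw [mul_ap, tsum_eq_single a]
    intro b hb; rw [hY b f hb, mul_zero]
  simp only [tot, this, ENNReal.tsum_mul_left, ENNReal.tsum_mul_right]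

theorem tot_mul_G (A B : Mat E) (hA : tot A < ∞) (hB : tot (B * G B) < ∞) :
    tot (A * G B) < ∞ := by
  rw [G_eq, mul_add, mul_one, tot_add]
  exact ENNReal.add_lt_top.2 ⟨hA, (tot_mul _ _).trans_lt (ENNReal.mul_lt_top hA hB)⟩

theorem step (B D : Mat E) (a : E) (hD : ∀ g f, g ≠ a → D g f = 0)
    (hBD : tot (B + D) < ∞) (hG : tot (B * G B) < ∞) (ha : G (B + D) a a < ∞) :
    tot ((B + D) * G (B + D)) < ∞ := by
  have hDt : tot D < ∞ := by rw [tot_add] at hBD; exact (ENNReal.add_lt_top.1 hBD).2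
  have hrow : ∀ X : Mat E, ∀ g f, g ≠ a → (D * X) g f = 0 := by
    intro X g f hg
    rw [mul_ap]; simp [hD g _ hg]
  have h1 : (B + D) * G (B + D)
      ≤ (B + D) * G B + ((B + D) * G (B + D)) * (D * G B) := by
    refine (mul_mono le_rfl (G_add_le B D)).trans (le_of_eq ?_)
    rw [mul_add (B + D), mul_assoc (B + D)]
  refine (tot_mono h1).trans_lt ?_
  rw [tot_add, tot_mul_row _ _ a (hrow _)]
  refine ENNReal.add_lt_top.2 ⟨tot_mul_G _ _ hBD hG, ENNReal.mul_lt_top ?_ ?_⟩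
  · have hcol : ∀ e, ((B + D) * G (B + D)) e a ≤ G B e a * G (B + D) a a := by
      intro e
      calc ((B + D) * G (B + D)) e a ≤ G (B + D) e a := by
            conv_rhs => rw [G_eq, add_ap]
            exact le_add_self
        _ ≤ G B e a + (G B * (D * G (B + D))) e a := G_add_le' B D e a
        _ = G B e a * (1 + (D * G (B + D)) a a) := by
            rw [mul_ap (G B), tsum_eq_single a, mul_add, mul_one]
            intro b hb; rw [hrow _ b a hb, mul_zero]
        _ ≤ G B e a * G (B + D) a a := by
            gcongr
            conv_rhs => rw [G_eq, add_ap, one_ap, if_pos rfl, add_mul, add_ap]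
            gcongr
            exact le_add_self
    refine (ENNReal.tsum_le_tsum hcol).trans_lt ?_
    rw [ENNReal.tsum_mul_right]
    refine ENNReal.mul_lt_top ?_ ha
    rw [G_eq]
    simp only [add_ap, ENNReal.tsum_add]
    refine ENNReal.add_lt_top.2 ⟨?_, ?_⟩
    · rw [tsum_eq_single a]
      · simp [one_ap]
      · intro b hb; simp [one_ap, hb]
    · refine lt_of_le_of_lt ?_ hG
      exact ENNReal.tsum_le_tsum fun e => ENNReal.le_tsum (f := fun f => (B * G B) e f) a
  · refine lt_of_le_of_lt ?_ (tot_mul_G _ _ hDt hG)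
    exact ENNReal.le_tsum (f := fun e => ∑' f, (D * G B) e f) a

open Classical in
noncomputable def cut (A : Mat E) (K : Finset E) : Mat E := fun e f => if e ∈ K then 0 else A e f

theorem cut_le (A : Mat E) (K : Finset E) : cut A K ≤ A := by
  intro e f; unfold cut; split_ifs <;> simp

theorem cut_ind (A : Mat E) (hA : tot A < ∞) (hG : ∀ a, G A a a < ∞) (K : Finset E) :
    tot (cut A K * G (cut A K)) < ∞ → tot (A * G A) < ∞ := by
  classical
  induction K using Finset.induction_on with
  | empty =>
    have : cut A ∅ = A := by funext e f; simp [cut]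
    rw [this]; exact id
  | insert a K ha ih =>
    intro h
    apply ih
    let D : Mat E := fun e f => if e = a then A e f else 0
    have hD : cut A K = cut A (insert a K) + D := by
      funext e f
      rw [add_ap]
      by_cases he : e = a
      · subst he; simp [cut, D, ha]
      · simp [cut, D, he]
    rw [hD]
    apply step _ _ a _ _ h
    · rw [← hD]; exact (G_mono (cut_le A K) a a).trans_lt (hG a)
    · intro g f hg; simp [D, hg]
    · rw [← hD]; exact (tot_mono (cut_le A K)).trans_lt hA

theorem tot_pow (A : Mat E) (n : ℕ) : tot (A ^ (n + 1)) ≤ tot A ^ (n + 1) := by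
  induction n with
  | zero => simp
  | succ n ih =>
    rw [pow_succ, pow_succ (tot A)]
    exact (tot_mul _ _).trans (by gcongr)

theorem tot_G_eq (A : Mat E) : tot (A * G A) = ∑' n : ℕ, tot (A ^ (n + 1)) := by
  simp only [tot, mul_G]
  rw [ENNReal.tsum_comm (α := ℕ)]
  congr 1; funext e
  rw [ENNReal.tsum_comm]

theorem small (A : Mat E) (h : tot A < 1) : tot (A * G A) < ∞ := by
  rw [tot_G_eq]
  refine (ENNReal.tsum_le_tsum (tot_pow A)).trans_lt ?_
  have : ∑' n : ℕ, tot A ^ (n + 1) ≤ ∑' n : ℕ, tot A ^ n := by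
    rw [tsum_eq_zero_add' (f := fun n => tot A ^ n) ENNReal.summable]
    exact le_add_self
  refine this.trans_lt ?_
  rw [ENNReal.tsum_geometric]
  simpa using h

theorem main (A : Mat E) (hA : tot A < ∞) (hG : ∀ a, G A a a < ∞) : tot (A * G A) < ∞ := by
  have := ENNReal.tendsto_tsum_compl_atTop_zero (f := fun e => ∑' f, A e f) hA.ne
  obtain ⟨K, hK⟩ := (this.eventually (gt_mem_nhds one_pos)).exists
  refine cut_ind A hA hG K (small _ (lt_of_le_of_lt (le_of_eq ?_) hK))
  classical
  have h2 := tsum_subtype (Set.ofPred fun x => x ∉ K) (fun e => ∑' f, A e f)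
  refine Eq.trans ?_ h2.symm
  unfold tot
  congr 1; funext e
  by_cases he : e ∈ K
  · simp [cut, he]
  · simp [cut, he]

/-- path expansion -/
theorem pow_path (A : Mat E) (n : ℕ) (e f : E) :
    (A ^ (n + 1)) e f = ∑' q : Fin n → E,
      ∏ i : Fin (n + 1), A (Fin.cons (α := fun _ => E) e q i) (Fin.snoc (α := fun _ => E) q f i) := by
  induction n generalizing e with
  | zero =>
    rw [tsum_eq_single default (fun b hb => absurd (Subsingleton.elim _ _) hb)]
    simp [Fin.snoc]
  | succ n ih =>
    rw [pow_succ', mul_ap, ← (Fin.consEquiv (fun _ => E)).tsum_eq, ENNReal.tsum_prod']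
    congr 1; funext g
    rw [ih, ← ENNReal.tsum_mul_left]
    congr 1; funext q
    conv_rhs => rw [Fin.prod_univ_succ]
    simp only [Fin.consEquiv, Equiv.coe_fn_mk, Fin.cons_zero, Fin.cons_succ]
    rw [← Fin.cons_snoc_eq_snoc_cons]
    simp only [Fin.cons_zero, Fin.cons_succ]


section Op
open PGT

noncomputable def scal (c : ℝ≥0∞) (W : Mat E) : Mat E := fun e f => c * W e f

theorem scal_ap (c : ℝ≥0∞) (W : Mat E) (e f : E) : scal c W e f = c * W e f := rfl

theorem scal_pow (c : ℝ≥0∞) (W : Mat E) (n : ℕ) (e f : E) :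
    (scal c W ^ n) e f = c ^ n * (W ^ n) e f := by
  induction n generalizing e with
  | zero => rw [pow_zero, pow_zero, pow_zero, one_mul]
  | succ n ih =>
    rw [pow_succ' (scal c W), pow_succ' W, mul_ap, mul_ap, ← ENNReal.tsum_mul_left]
    congr 1; funext g
    rw [ih, pow_succ, scal_ap]; ring

noncomputable def wm (w : E → E → ℝ) : Mat E := fun e f => ENNReal.ofReal (w e f)

theorem cons_cyc {n : ℕ} (e : E) (q : Fin n → E) (i : Fin (n + 1)) :
    (Fin.cons e q : Fin (n + 1) → E) (cyc i 1) = (Fin.snoc q e : Fin (n + 1) → E) i := by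
  induction i using Fin.lastCases with
  | last =>
    have : cyc (Fin.last n) 1 = 0 := by ext; simp [cyc]
    rw [this]; simp
  | cast j =>
    have : cyc j.castSucc 1 = j.succ := by
      ext; simp [cyc]
    rw [this]; simp

theorem paths {V : Type*} (s t : E → V) (w : E → E → ℝ)
    (hw_nonneg : ∀ e f, 0 ≤ w e f)
    (hw_adj : ∀ e f, w e f ≠ 0 → t e = s f) (u : ℝ) (hu : 0 < u) :
    ∑' p : ClosedPath s t, ENNReal.ofReal (pathWeight w p.1.2 * u ^ p.1.1)
      = ∑' n : ℕ, ∑' e, ENNReal.ofReal u ^ (n + 1) * (wm w ^ (n + 1)) e e := by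
  have h2 := tsum_subtype (Set.ofPred fun c : (Σ n : ℕ, Fin n → E) => 0 < c.1 ∧ IsClosedPath s t c.2)
    (fun c => ENNReal.ofReal (pathWeight w c.2 * u ^ c.1))
  refine Eq.trans h2 ?_
  rw [ENNReal.tsum_sigma', tsum_eq_zero_add' ENNReal.summable]
  have h0 : ∀ b : Fin 0 → E, Set.indicator
      (Set.ofPred fun c : (Σ n : ℕ, Fin n → E) => 0 < c.1 ∧ IsClosedPath s t c.2)
      (fun c => ENNReal.ofReal (pathWeight w c.2 * u ^ c.1)) ⟨0, b⟩ = 0 := by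
    intro b
    apply Set.indicator_of_notMem
    simp
  simp only [h0, tsum_zero, zero_add]
  congr 1; funext n
  have h1 : ∀ b : Fin (n + 1) → E, Set.indicator
      (Set.ofPred fun c : (Σ n : ℕ, Fin n → E) => 0 < c.1 ∧ IsClosedPath s t c.2)
      (fun c => ENNReal.ofReal (pathWeight w c.2 * u ^ c.1)) ⟨n + 1, b⟩
      = ENNReal.ofReal u ^ (n + 1) * ∏ i, wm w (b i) (b (cyc i 1)) := by
    intro b
    have hb : ENNReal.ofReal (pathWeight w b * u ^ (n + 1))
        = ENNReal.ofReal u ^ (n + 1) * ∏ i, wm w (b i) (b (cyc i 1)) := by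
      rw [mul_comm, ENNReal.ofReal_mul (by positivity), ENNReal.ofReal_pow hu.le, pathWeight,
        ENNReal.ofReal_prod_of_nonneg (fun i _ => hw_nonneg _ _)]
      rfl
    rw [← hb]
    by_cases hc : IsClosedPath s t b
    · apply Set.indicator_of_mem
      exact ⟨Nat.succ_pos n, hc⟩
    · rw [Set.indicator_of_notMem (fun h => hc h.2)]
      unfold IsClosedPath at hc
      push Not at hc
      obtain ⟨i, hi⟩ := hc
      have : w (b i) (b (cyc i 1)) = 0 := by
        by_contra hne
        exact hi (hw_adj _ _ hne)
      rw [pathWeight, Finset.prod_eq_zero (Finset.mem_univ i) this]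
      simp
  simp only [h1]
  rw [← (Fin.consEquiv (fun _ => E)).tsum_eq, ENNReal.tsum_prod']
  congr 1; funext e
  rw [pow_path, ← ENNReal.tsum_mul_left]
  congr 1; funext q
  simp only [Fin.consEquiv, Equiv.coe_fn_mk, cons_cyc]

noncomputable abbrev L2 (E : Type*) := lp (fun _ : E => ℂ) 2

variable [DecidableEq E]

theorem coord (w : E → E → ℝ) (hw_nonneg : ∀ e f, 0 ≤ w e f)
    (T : L2 E →L[ℂ] L2 E) (hT : IsBassOperator w T) (n : ℕ) (e f : E) :
    ∃ x : ℝ, 0 ≤ x ∧ (T ^ n) (lp.single 2 e (1 : ℂ)) f = (x : ℂ) ∧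
      (wm w ^ n) e f = ENNReal.ofReal x := by
  induction n generalizing e with
  | zero =>
    by_cases h : e = f
    · subst h
      exact ⟨1, zero_le_one, by simp, by simp [one_ap]⟩
    · exact ⟨0, le_rfl, by simp [Pi.single_apply, Ne.symm h], by simp [one_ap, h]⟩
  | succ n ih =>
    choose x hx0 hx1 hx2 using ih
    have h1 : HasSum (fun g => ((w e g * x g : ℝ) : ℂ)) ((T ^ (n + 1)) (lp.single 2 e (1 : ℂ)) f) := by
      have := (hT e).mapL ((lp.evalCLM ℂ (fun _ : E => ℂ) 2 f).comp (T ^ n))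
      rw [pow_succ]
      refine Eq.mp (congrArg (fun F => HasSum F _) ?_) this
      funext g
      rw [map_smul]
      have : (lp.evalCLM ℂ (fun _ : E => ℂ) 2 f).comp (T ^ n) (lp.single 2 g (1 : ℂ)) = (x g : ℂ) := hx1 g
      rw [this]
      simp
    have hre := Complex.hasSum_re h1
    have him := Complex.hasSum_im h1
    simp only [Complex.ofReal_re, Complex.ofReal_im] at hre him
    have hnn : ∀ g, 0 ≤ w e g * x g := fun g => mul_nonneg (hw_nonneg _ _) (hx0 g)
    refine ⟨_, hre.nonneg hnn, ?_, ?_⟩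
    · apply Complex.ext
      · simp
      · simpa using (him.unique hasSum_zero)
    · rw [pow_succ', mul_ap, ← hre.tsum_eq, ENNReal.ofReal_tsum_of_nonneg hnn hre.summable]
      congr 1; funext g
      rw [hx2, ENNReal.ofReal_mul (hw_nonneg _ _)]; rfl

theorem coord_enorm (w : E → E → ℝ) (hw_nonneg : ∀ e f, 0 ≤ w e f)
    (T : L2 E →L[ℂ] L2 E) (hT : IsBassOperator w T) (n : ℕ) (e f : E) :
    (wm w ^ n) e f = ‖(T ^ n) (lp.single 2 e (1 : ℂ)) f‖ₑ := by
  obtain ⟨x, h0, h1, h2⟩ := coord w hw_nonneg T hT n e f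
  rw [h1, h2, ← ofReal_norm, Complex.norm_real, Real.norm_of_nonneg h0]

theorem enorm_ap_le (x : L2 E) (e : E) : ‖x e‖ₑ ≤ ‖x‖ₑ := by
  rw [← ofReal_norm, ← ofReal_norm]
  exact ENNReal.ofReal_le_ofReal (lp.norm_apply_le_norm (by norm_num) x e)

theorem enorm_single (e : E) (c : ℂ) : ‖(lp.single 2 e c : L2 E)‖ₑ = ‖c‖ₑ := by
  rw [← ofReal_norm, ← ofReal_norm, lp.norm_single (by norm_num)]

theorem coord_le (w : E → E → ℝ) (hw_nonneg : ∀ e f, 0 ≤ w e f)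
    (T : L2 E →L[ℂ] L2 E) (hT : IsBassOperator w T) (n : ℕ) (e f : E) :
    (wm w ^ n) e f ≤ ‖T ^ n‖ₑ := by
  rw [coord_enorm w hw_nonneg T hT]
  refine (enorm_ap_le _ _).trans (((T ^ n).le_opENorm _).trans ?_)
  rw [enorm_single]; simp

theorem le_tot (w : E → E → ℝ) (hw_nonneg : ∀ e f, 0 ≤ w e f)
    (T : L2 E →L[ℂ] L2 E) (hT : IsBassOperator w T) (n : ℕ) :
    ‖T ^ n‖ₑ ≤ tot (wm w ^ n) := by
  have hs : ∀ x : L2 E, ‖x‖ₑ ≤ ∑' e, ‖x e‖ₑ := by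
    intro x
    have := lp.hasSum_single (p := 2) (by norm_num) x
    exact this.enorm_le_of_bounded ENNReal.summable.hasSum fun i => (enorm_single _ _).le
  refine (T ^ n).opENorm_le_bound fun x => ?_
  have h1 := (lp.hasSum_single (p := 2) (by norm_num) x).mapL (T ^ n)
  refine (h1.enorm_le_of_bounded (g := fun e => (∑' f, (wm w ^ n) e f) * ‖x‖ₑ)
    ENNReal.summable.hasSum fun e => ?_).trans (le_of_eq ?_)
  · have : (lp.single 2 e (x e) : L2 E) = x e • lp.single 2 e (1 : ℂ) := by
      rw [← lp.single_smul]; simp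
    rw [this, map_smul, enorm_smul, mul_comm]
    gcongr
    · refine (hs _).trans (le_of_eq ?_)
      simp only [coord_enorm w hw_nonneg T hT]
    · exact enorm_ap_le x e
  · rw [ENNReal.tsum_mul_right, tot]

theorem rad_pow_le (T : L2 E →L[ℂ] L2 E) (n : ℕ) :
    spectralRadius ℂ T ^ (n + 1) ≤ ‖T ^ (n + 1)‖ₑ := by
  have h := spectrum.spectralRadius_le_pow_nnnorm_pow_one_div ℂ T n
  have h1 : (‖(1 : L2 E →L[ℂ] L2 E)‖₊ : ℝ≥0∞) ≤ 1 := by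
    have : ‖(1 : L2 E →L[ℂ] L2 E)‖ ≤ 1 := ContinuousLinearMap.norm_id_le
    exact_mod_cast this
  have h2 : spectralRadius ℂ T ≤ (‖T ^ (n + 1)‖₊ : ℝ≥0∞) ^ (1 / (n + 1) : ℝ) := by
    refine h.trans ((mul_le_mul_right (ENNReal.rpow_le_one h1 (by positivity)) _).trans ?_)
    rw [mul_one]
  refine (pow_le_pow_left' h2 (n + 1)).trans (le_of_eq ?_)
  rw [← ENNReal.rpow_natCast, ← ENNReal.rpow_mul]
  have : (1 / ((n : ℝ) + 1)) * ((n + 1 : ℕ) : ℝ) = 1 := by push_cast; field_simp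
  rw [this, ENNReal.rpow_one]; rfl

theorem conv (T : L2 E →L[ℂ] L2 E) (c : ℝ≥0∞) (hc0 : c ≠ 0) (hc : c ≠ ∞)
    (h : spectralRadius ℂ T < c⁻¹) : ∑' n : ℕ, c ^ n * ‖T ^ n‖ₑ < ∞ := by
  obtain ⟨ρ, h1, h2⟩ := exists_between h
  have hg := spectrum.pow_nnnorm_pow_one_div_tendsto_nhds_spectralRadius T
  have hev := (hg.eventually (gt_mem_nhds h1)).and (Filter.eventually_gt_atTop 0)
  obtain ⟨N, hN⟩ := Filter.eventually_atTop.1 hev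
  have hle : ∀ n ≥ N, c ^ n * ‖T ^ n‖ₑ ≤ (c * ρ) ^ n := by
    intro n hn
    obtain ⟨h3, h4⟩ := hN n hn
    rw [mul_pow]
    gcongr
    have h5 := pow_le_pow_left' h3.le n
    rw [← ENNReal.rpow_natCast (_ ^ _), ← ENNReal.rpow_mul] at h5
    have : (1 / (n : ℝ)) * (n : ℝ) = 1 := by field_simp
    rw [this, ENNReal.rpow_one] at h5
    exact h5
  rw [← ENNReal.summable.sum_add_tsum_nat_add' (k := N)]
  refine ENNReal.add_lt_top.2 ⟨?_, ?_⟩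
  · refine ENNReal.sum_lt_top.2 fun i _ => ENNReal.mul_lt_top (ENNReal.pow_lt_top hc.lt_top) ?_
    exact enorm_lt_top
  · have hlt : c * ρ < 1 := by
      have := ENNReal.mul_lt_mul_right hc0 hc h2
      rwa [ENNReal.mul_inv_cancel hc0 hc] at this
    calc ∑' n, c ^ (n + N) * ‖T ^ (n + N)‖ₑ ≤ ∑' n, (c * ρ) ^ (n + N) :=
          ENNReal.tsum_le_tsum fun n => hle _ (by omega)
      _ ≤ ∑' n, (c * ρ) ^ n := by
          exact ENNReal.tsum_le_tsum fun n => pow_le_pow_right_of_le_one' hlt.le (by omega)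
      _ < ∞ := by
          rw [ENNReal.tsum_geometric]; simpa using hlt

theorem tot_wm (w : E → E → ℝ) (hw_sum : Summable fun q : E × E => w q.1 q.2) :
    tot (wm w) < ∞ := by
  have := hw_sum.tsum_ofReal_ne_top
  rw [ENNReal.tsum_prod'] at this
  exact this.lt_top

theorem summable_iff {ι : Type*} (f : ι → ℝ) (hf : ∀ i, 0 ≤ f i) :
    Summable f ↔ ∑' i, ENNReal.ofReal (f i) < ∞ := by
  refine ⟨fun h => h.tsum_ofReal_lt_top, fun h => ?_⟩
  have := ENNReal.summable_toReal h.ne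
  refine this.congr fun i => ?_
  rw [ENNReal.toReal_ofReal (hf i)]

end Op
end Aux

open PGT in
/-- For the Bass operator `T` of a weighted oriented graph with
positive spectral radius `r`,
`1/r = sup{ u > 0 : ∑_p w(p) u^{ℓ(p)} < ∞ }`, the sum over all closed paths `p`. -/
theorem stmt13 {V E : Type*} [DecidableEq E] (s t : E → V) (w : E → E → ℝ)
    (hw_nonneg : ∀ e f, 0 ≤ w e f)
    (hw_adj : ∀ e f, w e f ≠ 0 → t e = s f)
    (hw_sum : Summable fun q : E × E => w q.1 q.2)
    (T : lp (fun _ : E => ℂ) 2 →L[ℂ] lp (fun _ : E => ℂ) 2)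
    (hT : IsBassOperator w T)
    (r : ℝ) (hr : 0 < r) (hrad : spectralRadius ℂ T = ENNReal.ofReal r) :
    1 / r = sSup {u : ℝ | 0 < u ∧
      Summable fun p : ClosedPath s t => pathWeight w p.1.2 * u ^ p.1.1} := by
  have key : ∀ u : ℝ, 0 < u →
      ((Summable fun p : ClosedPath s t => pathWeight w p.1.2 * u ^ p.1.1) ↔
        ∑' n : ℕ, ∑' e, ENNReal.ofReal u ^ (n + 1) * (Aux.wm w ^ (n + 1)) e e < ⊤) := by
    intro u hu
    rw [← Aux.paths s t w hw_nonneg hw_adj u hu, Aux.summable_iff]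
    intro p
    exact mul_nonneg (Finset.prod_nonneg fun i _ => hw_nonneg _ _) (by positivity)
  have htot := Aux.tot_wm w hw_sum
  have hlow : ∀ u : ℝ, 0 < u → u < 1 / r →
      Summable fun p : ClosedPath s t => pathWeight w p.1.2 * u ^ p.1.1 := by
    intro u hu hur
    rw [key u hu]
    have hc := Aux.conv T (ENNReal.ofReal u) (by simpa using hu) ENNReal.ofReal_ne_top (by
      rw [hrad, ← ENNReal.ofReal_inv_of_pos hu, ENNReal.ofReal_lt_ofReal_iff (by positivity)]
      rw [lt_div_iff₀ hr] at hur
      rw [lt_inv_comm₀ hr hu]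
      rw [← one_div, lt_div_iff₀ hr]; exact hur)
    have hb : ∀ n : ℕ, ∑' e, ENNReal.ofReal u ^ (n + 1) * (Aux.wm w ^ (n + 1)) e e
        ≤ (ENNReal.ofReal u * Aux.tot (Aux.wm w)) * (ENNReal.ofReal u ^ n * ‖T ^ n‖ₑ) := by
      intro n
      rw [ENNReal.tsum_mul_left]
      have : ∑' e, (Aux.wm w ^ (n + 1)) e e ≤ Aux.tot (Aux.wm w) * ‖T ^ n‖ₑ := by
        rw [Aux.tot, ← ENNReal.tsum_mul_right]
        refine ENNReal.tsum_le_tsum fun e => ?_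
        rw [pow_succ', Aux.mul_ap, ← ENNReal.tsum_mul_right]
        refine ENNReal.tsum_le_tsum fun f => ?_
        gcongr
        exact Aux.coord_le w hw_nonneg T hT n f e
      calc _ ≤ ENNReal.ofReal u ^ (n + 1) * (Aux.tot (Aux.wm w) * ‖T ^ n‖ₑ) := by gcongr
        _ = _ := by rw [pow_succ]; ring
    refine (ENNReal.tsum_le_tsum hb).trans_lt ?_
    rw [ENNReal.tsum_mul_left]
    exact ENNReal.mul_lt_top (ENNReal.mul_lt_top ENNReal.ofReal_lt_top htot) hc
  have hup : ∀ u : ℝ, 0 < u →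
      (Summable fun p : ClosedPath s t => pathWeight w p.1.2 * u ^ p.1.1) → u ≤ 1 / r := by
    intro u hu hs
    rw [key u hu] at hs
    let A : Aux.Mat E := Aux.scal (ENNReal.ofReal u) (Aux.wm w)
    have hA : Aux.tot A = ENNReal.ofReal u * Aux.tot (Aux.wm w) := by
      simp only [Aux.tot, A, Aux.scal_ap, ENNReal.tsum_mul_left]
    have hpow : ∀ n e f, (A ^ n) e f = ENNReal.ofReal u ^ n * (Aux.wm w ^ n) e f :=
      Aux.scal_pow _ _
    have hfin := Aux.main A (by rw [hA]; exact ENNReal.mul_lt_top ENNReal.ofReal_lt_top htot) (by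
      intro a
      rw [Aux.G_eq, Aux.add_ap, Aux.one_ap, if_pos rfl, Aux.mul_G]
      refine ENNReal.add_lt_top.2 ⟨ENNReal.one_lt_top, lt_of_le_of_lt ?_ hs⟩
      refine ENNReal.tsum_le_tsum fun n => ?_
      rw [hpow]
      exact ENNReal.le_tsum (f := fun e => ENNReal.ofReal u ^ (n + 1) * (Aux.wm w ^ (n + 1)) e e) a)
    rw [Aux.tot_G_eq] at hfin
    by_contra hlt
    push Not at hlt
    have hone : ∀ n : ℕ, (1 : ENNReal) ≤ Aux.tot (A ^ (n + 1)) := by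
      intro n
      have h1 : Aux.tot (A ^ (n + 1))
          = ENNReal.ofReal u ^ (n + 1) * Aux.tot (Aux.wm w ^ (n + 1)) := by
        simp only [Aux.tot, hpow, ENNReal.tsum_mul_left]
      rw [h1]
      calc (1 : ENNReal) ≤ (ENNReal.ofReal u * ENNReal.ofReal r) ^ (n + 1) := by
            apply one_le_pow_of_one_le'
            rw [← ENNReal.ofReal_mul hu.le, ENNReal.one_le_ofReal]
            rw [div_lt_iff₀ hr] at hlt
            exact hlt.le
        _ = ENNReal.ofReal u ^ (n + 1) * spectralRadius ℂ T ^ (n + 1) := by rw [mul_pow, hrad]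
        _ ≤ _ := by
            gcongr
            exact (Aux.rad_pow_le T n).trans (Aux.le_tot w hw_nonneg T hT (n + 1))
    have := (ENNReal.tsum_le_tsum hone).trans_lt hfin
    rw [ENNReal.tsum_const_eq_top_of_ne_zero one_ne_zero] at this
    exact lt_irrefl _ this
  have hr' : 0 < 1 / r := by positivity
  symm
  apply csSup_eq_of_forall_le_of_forall_lt_exists_gt
  · exact ⟨1 / r / 2, by positivity, hlow _ (by positivity) (by linarith)⟩
  · rintro u ⟨hu, hs⟩; exact hup u hu hs
  · intro v hv
    obtain ⟨u, h1, h2⟩ := exists_between (max_lt hv hr')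
    have hu : 0 < u := (le_max_right _ _).trans_lt h1
    exact ⟨u, ⟨hu, hlow u hu h2⟩, (le_max_left _ _).trans_lt h1⟩
end

section
/- Let X be an oriented graph with edge set E, w a transition weight on X, and T the Bass operator on ℓ²(E). Suppose there exist two primitive closed paths c₀ and d₀ which both start with the same oriented edge e, are not cyclic rotations of one another, and satisfy w(c₀) = w(d₀) ≥ 1. Then the spectral radius satisfies r(T) > 1. -/
namespace PGT
open scoped ComplexOrder

section aux
variable {E : Type*} [DecidableEq E] {w : E → E → ℝ}
  {T : lp (fun _ : E => ℂ) 2 →L[ℂ] lp (fun _ : E => ℂ) 2}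

lemma T_single_apply (hT : IsBassOperator w T) (e g : E) :
    (T (lp.single 2 e (1:ℂ)) : E → ℂ) g = w e g := by
  have h1 := (hT e).mapL (lp.evalCLM ℂ (fun _ : E => ℂ) 2 g)
  have h2 : HasSum (fun f : E => lp.evalCLM ℂ (fun _ : E => ℂ) 2 g
      ((w e f : ℂ) • lp.single 2 f (1 : ℂ))) (w e g : ℂ) := by
    have := hasSum_single (f := fun f : E => lp.evalCLM ℂ (fun _ : E => ℂ) 2 g
      ((w e f : ℂ) • lp.single 2 f (1 : ℂ))) g (by
        intro f hf
        simp [lp.evalCLM, lp.single_apply, Pi.single_apply, hf.symm])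
    simpa [lp.evalCLM, lp.single_apply] using this
  exact h1.unique h2

lemma T_apply (hT : IsBassOperator w T) (x : lp (fun _ : E => ℂ) 2) (g : E) :
    HasSum (fun f => (x : E → ℂ) f * w f g) ((T x : E → ℂ) g) := by
  have h0 := lp.hasSum_single (p := 2) (by norm_num) x
  have h1 := (h0.mapL T).mapL (lp.evalCLM ℂ (fun _ : E => ℂ) 2 g)
  have h2 : (fun f => (x : E → ℂ) f * w f g) = fun f =>
      (lp.evalCLM ℂ (fun _ : E => ℂ) 2 g) (T (lp.single 2 f ((x : E → ℂ) f))) := by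
    funext f
    have aux : ∀ a : ℂ, (lp.evalCLM ℂ (fun _ : E => ℂ) 2 g) (T (lp.single 2 f a)) = a * w f g := by
      intro a
      have h3 : (lp.single 2 f a : lp (fun _ : E => ℂ) 2) = a • lp.single 2 f (1:ℂ) := by
        rw [← lp.single_smul, smul_eq_mul, mul_one]
      rw [h3, map_smul, map_smul, smul_eq_mul, ← T_single_apply hT f g]
      rfl
    exact (aux _).symm
  rw [h2]
  exact h1

lemma sum_le_T (hw : ∀ e f, 0 ≤ w e f) (hT : IsBassOperator w T)
    (x : lp (fun _ : E => ℂ) 2) (hx : ∀ f, 0 ≤ (x : E → ℂ) f) (g : E) (S : Finset E) :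
    ∑ f ∈ S, (x : E → ℂ) f * w f g ≤ (T x : E → ℂ) g :=
  sum_le_hasSum S (fun f _ => mul_nonneg (hx f) (by exact_mod_cast hw f g)) (T_apply hT x g)

lemma T_nonneg (hw : ∀ e f, 0 ≤ w e f) (hT : IsBassOperator w T)
    (x : lp (fun _ : E => ℂ) 2) (hx : ∀ f, 0 ≤ (x : E → ℂ) f) (g : E) :
    0 ≤ (T x : E → ℂ) g := by
  simpa using sum_le_T hw hT x hx g ∅

lemma Tpow_nonneg (hw : ∀ e f, 0 ≤ w e f) (hT : IsBassOperator w T) (n : ℕ)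
    (x : lp (fun _ : E => ℂ) 2) (hx : ∀ f, 0 ≤ (x : E → ℂ) f) (g : E) :
    0 ≤ ((T ^ n) x : E → ℂ) g := by
  induction n generalizing g with
  | zero => simpa using hx g
  | succ n ih =>
    rw [pow_succ']
    exact T_nonneg hw hT _ ih g

lemma single_nonneg' (e f : E) : 0 ≤ (lp.single 2 e (1:ℂ) : lp (fun _ : E => ℂ) 2) f := by
  by_cases h : f = e
  · subst h; simp [lp.single_apply]
  · simp [lp.single_apply, Pi.single_apply, h]

/-- weight of the initial walk -/
def W (w : E → E → ℝ) (P : ℕ → E) (m : ℕ) : ℝ := ∏ i ∈ Finset.range m, w (P i) (P (i+1))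

lemma one_walk (hw : ∀ e f, 0 ≤ w e f) (hT : IsBassOperator w T) (P : ℕ → E) (m : ℕ) :
    ((W w P m : ℝ) : ℂ) ≤ ((T ^ m) (lp.single 2 (P 0) 1) : E → ℂ) (P m) := by
  induction m with
  | zero => simp [W, lp.single_apply]
  | succ m ih =>
    rw [pow_succ']
    have := sum_le_T hw hT _ (Tpow_nonneg hw hT m _ (single_nonneg' (P 0))) (P (m+1)) {P m}
    refine le_trans ?_ this
    rw [Finset.sum_singleton, W, Finset.prod_range_succ, Complex.ofReal_mul]
    exact mul_le_mul_of_nonneg_right ih (by exact_mod_cast hw _ _)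

lemma two_walk (hw : ∀ e f, 0 ≤ w e f) (hT : IsBassOperator w T) (P Q : ℕ → E)
    (h0 : P 0 = Q 0) (m : ℕ) (hne : ∃ i ≤ m, P i ≠ Q i) (hm : P m = Q m) :
    ((W w P m : ℝ) : ℂ) + (W w Q m : ℝ) ≤ ((T ^ m) (lp.single 2 (P 0) 1) : E → ℂ) (P m) := by
  induction m with
  | zero =>
    obtain ⟨i, hi, hne⟩ := hne
    obtain rfl : i = 0 := by omega
    exact absurd h0 hne
  | succ m ih =>
    rw [pow_succ']
    have key := sum_le_T hw hT _ (Tpow_nonneg hw hT m _ (single_nonneg' (P 0))) (P (m+1))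
    have e1 : W w P (m+1) = W w P m * w (P m) (P (m+1)) := by rw [W, Finset.prod_range_succ]; rfl
    have e2 : W w Q (m+1) = W w Q m * w (Q m) (P (m+1)) := by
      rw [W, Finset.prod_range_succ, hm]; rfl
    rw [e1, e2, Complex.ofReal_mul, Complex.ofReal_mul]
    by_cases hPQ : P m = Q m
    · have hi : ∃ i ≤ m, P i ≠ Q i := by
        obtain ⟨i, hi, hne⟩ := hne
        refine ⟨i, ?_, hne⟩
        rcases Nat.lt_or_ge m i with h | h
        · obtain rfl : i = m + 1 := by omega
          exact absurd hm hne
        · exact h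
      refine le_trans ?_ (key {P m})
      rw [Finset.sum_singleton, ← hPQ, ← add_mul]
      exact mul_le_mul_of_nonneg_right (ih hi hPQ) (by exact_mod_cast hw _ _)
    · refine le_trans ?_ (key {P m, Q m})
      rw [Finset.sum_pair hPQ]
      have q := one_walk hw hT Q m
      rw [← h0] at q
      exact add_le_add
        (mul_le_mul_of_nonneg_right (one_walk hw hT P m) (by exact_mod_cast hw _ _))
        (mul_le_mul_of_nonneg_right q (by exact_mod_cast hw _ _))

lemma Tpow_mono (hw : ∀ e f, 0 ≤ w e f) (hT : IsBassOperator w T) (n : ℕ)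
    (x y : lp (fun _ : E => ℂ) 2) (hx : ∀ f, (x : E → ℂ) f ≤ (y : E → ℂ) f) (g : E) :
    ((T ^ n) x : E → ℂ) g ≤ ((T ^ n) y : E → ℂ) g := by
  have := Tpow_nonneg hw hT n (y - x) (fun f => by simpa using hx f) g
  rw [map_sub] at this
  simpa using this

lemma iter_bound (hw : ∀ e f, 0 ≤ w e f) (hT : IsBassOperator w T) (N : ℕ) (e : E)
    (h : (2:ℂ) ≤ ((T ^ N) (lp.single 2 e 1) : E → ℂ) e) (k : ℕ) :
    (2:ℂ)^k ≤ ((T ^ (N * k)) (lp.single 2 e 1) : E → ℂ) e := by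
  induction k with
  | zero => simp [lp.single_apply]
  | succ k ih =>
    have h1 : ∀ f, (((2:ℂ) • lp.single 2 e (1:ℂ) : lp (fun _ : E => ℂ) 2) : E → ℂ) f ≤
        ((T ^ N) (lp.single 2 e 1) : E → ℂ) f := by
      intro f
      by_cases hf : f = e
      · subst hf; simpa [lp.single_apply] using h
      · have := Tpow_nonneg hw hT N _ (single_nonneg' e) f
        simpa [lp.single_apply, Pi.single_apply, hf] using this
    have h2 := Tpow_mono hw hT (N * k) _ _ h1 e
    rw [Nat.mul_succ, pow_add T]
    refine le_trans ?_ h2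
    rw [map_smul, pow_succ']
    exact mul_le_mul_of_nonneg_left ih (by norm_num)

lemma norm_bound (hw : ∀ e f, 0 ≤ w e f) (hT : IsBassOperator w T) (N : ℕ) (e : E)
    (h : (2:ℂ) ≤ ((T ^ N) (lp.single 2 e 1) : E → ℂ) e) (k : ℕ) :
    (2:ℝ)^k ≤ ‖T ^ (N * k)‖ := by
  have h1 := iter_bound hw hT N e h k
  have h2 : (2:ℝ)^k ≤ ‖((T ^ (N * k)) (lp.single 2 e 1) : E → ℂ) e‖ := by
    have h7 := (Complex.le_def.1 h1).1
    have h8 : ((2:ℂ)^k).re = (2:ℝ)^k := by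
      rw [← Complex.ofReal_ofNat, ← Complex.ofReal_pow, Complex.ofReal_re]
    rw [h8] at h7
    exact h7.trans (Complex.re_le_norm _)
  have h3 := lp.norm_apply_le_norm (p := 2) (by norm_num) ((T ^ (N * k)) (lp.single 2 e 1)) e
  have h4 := (T ^ (N * k)).le_opNorm (lp.single 2 e 1)
  have h5 : ‖(lp.single 2 e (1:ℂ) : lp (fun _ : E => ℂ) 2)‖ = 1 := by
    rw [lp.norm_single (by norm_num)]; simp
  rw [h5, mul_one] at h4
  exact h2.trans (h3.trans h4)

lemma radius_bound (hw : ∀ e f, 0 ≤ w e f) (hT : IsBassOperator w T) (N : ℕ) (hN : 0 < N) (e : E)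
    (h : (2:ℂ) ≤ ((T ^ N) (lp.single 2 e 1) : E → ℂ) e) :
    1 < spectralRadius ℂ T := by
  have h1 := spectrum.pow_nnnorm_pow_one_div_tendsto_nhds_spectralRadius T
  have h2 : Filter.Tendsto (fun k : ℕ => N * k) Filter.atTop Filter.atTop :=
    Filter.tendsto_id.const_mul_atTop' hN
  have h3 := h1.comp h2
  have h4 : (2:ENNReal) ^ (1 / N : ℝ) ≤ spectralRadius ℂ T := by
    refine ge_of_tendsto h3 ?_
    filter_upwards [Filter.eventually_gt_atTop 0] with k hk
    have h5 := norm_bound hw hT N e h k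
    have h6 : (2:ENNReal)^k ≤ (‖T ^ (N * k)‖₊ : ENNReal) := by
      have : (2:NNReal)^k ≤ ‖T ^ (N * k)‖₊ := by
        rw [← NNReal.coe_le_coe]; simpa using h5
      exact_mod_cast this
    simp only [Function.comp]
    refine le_trans (le_of_eq ?_) (ENNReal.rpow_le_rpow h6 (by positivity))
    rw [← ENNReal.rpow_natCast, ← ENNReal.rpow_mul]
    congr 1
    have : (k:ℝ) ≠ 0 := by positivity
    have : (N:ℝ) ≠ 0 := by positivity
    push_cast
    field_simp
  refine lt_of_lt_of_le ?_ h4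
  exact ENNReal.one_lt_rpow (by norm_num) (by positivity)

lemma radius_two (hw : ∀ e f, 0 ≤ w e f) (hT : IsBassOperator w T) (P Q : ℕ → E)
    (h0 : P 0 = Q 0) (m : ℕ) (h_pos : 0 < m) (hne : ∃ i ≤ m, P i ≠ Q i) (hm : P m = Q m)
    (hP : P m = P 0) (h : 2 ≤ W w P m + W w Q m) : 1 < spectralRadius ℂ T := by
  have h2 := two_walk hw hT P Q h0 m hne hm
  rw [hP] at h2
  refine radius_bound hw hT m h_pos (P 0) (le_trans ?_ h2)
  exact_mod_cast h

/-- periodic extension -/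
def ext {n : ℕ} (hn : 0 < n) (p : Fin n → E) (i : ℕ) : E := p ⟨i % n, Nat.mod_lt _ hn⟩

lemma ext_periodic {n : ℕ} (hn : 0 < n) (p : Fin n → E) : Function.Periodic (ext hn p) n := by
  intro i; simp [ext]

lemma W_ext {n : ℕ} (hn : 0 < n) (p : Fin n → E) : W w (ext hn p) n = pathWeight w p := by
  rw [W, pathWeight, ← Fin.prod_univ_eq_prod_range (fun i => w (ext hn p i) (ext hn p (i+1)))]
  refine Finset.prod_congr rfl fun i _ => ?_
  simp [ext, cyc, Nat.mod_eq_of_lt i.2]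

lemma W_ext_mul {n : ℕ} (hn : 0 < n) (p : Fin n → E) (k : ℕ) :
    W w (ext hn p) (n * k) = pathWeight w p ^ k := by
  induction k with
  | zero => simp [W]
  | succ k ih =>
    rw [pow_succ, ← ih, ← W_ext hn p, Nat.mul_succ, W, Finset.prod_range_add]
    refine congrArg₂ _ rfl (Finset.prod_congr rfl fun i _ => ?_)
    congr 1
    · simp [ext]
    · simp [ext, add_assoc]

lemma periodic_gcd {P : ℕ → E} {a b : ℕ} (hb : 0 < b)
    (h1 : Function.Periodic P a) (h2 : Function.Periodic P b) :
    Function.Periodic P (Nat.gcd a b) := by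
  rcases Nat.lt_or_ge (Nat.gcd a b) b with h | h
  · obtain ⟨m, -, hm⟩ := Nat.exists_mul_mod_eq_gcd h
    intro i
    have e : i + a * m = i + Nat.gcd a b + (a * m / b) * b := by
      have := Nat.div_add_mod (a * m) b
      rw [hm] at this
      nlinarith
    have q1 := h1.nat_mul m i
    have q2 := h2.nat_mul (a * m / b) (i + Nat.gcd a b)
    simp only [Nat.cast_id] at q1 q2
    rw [← q2, ← e, mul_comm a m, q1]
  · have : Nat.gcd a b = b := le_antisymm (Nat.gcd_le_right _ hb) h
    rw [this]; exact h2

lemma prim_le {n : ℕ} (hn : 0 < n) (p : Fin n → E) (hp : IsPrimitivePath p) (g : ℕ) (hg : 0 < g)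
    (h : Function.Periodic (ext hn p) g) : n ≤ g := by
  by_contra hlt
  refine hp ⟨g, hg, by omega, fun i => ?_⟩
  have := h i
  simpa [ext, cyc, Nat.mod_eq_of_lt i.2] using this

end aux
end PGT

open PGT in
/-- If a weighted oriented graph has two primitive closed paths
`c₀, d₀` starting with the same oriented edge, which are not cyclic rotations of one
another and satisfy `w(c₀) = w(d₀) ≥ 1`, then the spectral radius of the Bass
operator satisfies `r(T) > 1`. -/
theorem stmt14 {V E : Type*} [DecidableEq E] (s t : E → V) (w : E → E → ℝ)
    (hw_nonneg : ∀ e f, 0 ≤ w e f)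
    (hw_adj : ∀ e f, w e f ≠ 0 → t e = s f)
    (hw_sum : Summable fun q : E × E => w q.1 q.2)
    (T : lp (fun _ : E => ℂ) 2 →L[ℂ] lp (fun _ : E => ℂ) 2)
    (hT : IsBassOperator w T)
    (n₁ n₂ : ℕ) (hn₁ : 0 < n₁) (hn₂ : 0 < n₂)
    (c₀ : Fin n₁ → E) (d₀ : Fin n₂ → E)
    (hc₀ : IsClosedPath s t c₀) (hd₀ : IsClosedPath s t d₀)
    (hc₀prim : IsPrimitivePath c₀) (hd₀prim : IsPrimitivePath d₀)
    (hstart : c₀ ⟨0, hn₁⟩ = d₀ ⟨0, hn₂⟩)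
    (hdistinct : ¬ ∃ h : n₁ = n₂, ∃ ρ : ℕ, ∀ i : Fin n₁,
      d₀ (Fin.cast h (cyc i ρ)) = c₀ i)
    (hw_eq : pathWeight w c₀ = pathWeight w d₀)
    (hw_ge : 1 ≤ pathWeight w c₀) :
    1 < spectralRadius ℂ T := by
  have hN : 0 < n₁ * n₂ := Nat.mul_pos hn₁ hn₂
  have h0 : ext hn₁ c₀ 0 = ext hn₂ d₀ 0 := by simpa [ext] using hstart
  have hNc : ext hn₁ c₀ (n₁ * n₂) = ext hn₁ c₀ 0 := by simp [ext]
  have hNd : ext hn₂ d₀ (n₁ * n₂) = ext hn₂ d₀ 0 := by simp [ext]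
  have hne : ∃ i ≤ n₁ * n₂, ext hn₁ c₀ i ≠ ext hn₂ d₀ i := by
    by_contra hcon
    push Not at hcon
    have heq : ext hn₁ c₀ = ext hn₂ d₀ := by
      funext i
      have := hcon (i % (n₁ * n₂)) (Nat.mod_lt _ hN).le
      simpa [ext] using this
    have p1 := ext_periodic hn₁ c₀
    have p2 := ext_periodic hn₂ d₀
    have g1 := periodic_gcd hn₂ p1 (heq ▸ p2)
    have g0 : 0 < Nat.gcd n₁ n₂ := Nat.gcd_pos_of_pos_left _ hn₁
    have l1 := prim_le hn₁ c₀ hc₀prim _ g0 g1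
    have l2 := prim_le hn₂ d₀ hd₀prim _ g0 (heq ▸ g1)
    have l3 := Nat.gcd_le_left n₂ hn₁
    have l4 := Nat.gcd_le_right n₁ hn₂
    have h : n₁ = n₂ := by omega
    subst h
    refine hdistinct ⟨rfl, 0, fun i => ?_⟩
    have := congrFun heq i
    simpa [ext, cyc, Nat.mod_eq_of_lt i.2] using this.symm
  have a1 : 1 ≤ W w (ext hn₁ c₀) (n₁ * n₂) := by
    rw [W_ext_mul]; exact one_le_pow₀ hw_ge
  have a2 : 1 ≤ W w (ext hn₂ d₀) (n₁ * n₂) := by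
    rw [mul_comm, W_ext_mul]; exact one_le_pow₀ (hw_eq ▸ hw_ge)
  have a3 : (2:ℝ) ≤ W w (ext hn₁ c₀) (n₁ * n₂) + W w (ext hn₂ d₀) (n₁ * n₂) := by linarith
  exact radius_two hw_nonneg hT (ext hn₁ c₀) (ext hn₂ d₀) h0 (n₁ * n₂) hN hne
    (by rw [hNc, hNd, h0]) hNc a3
end
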